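/- Let (u, π, v, θ) be a smooth solution of the stationary 3D tropical climate model. Suppose p ∈ [3, 9/2], q ∈ [1, 2), r ∈ [2, 2p′) where p′ = p/(p−1), α ∈ [0, 3/p − 2/3], β ∈ [0, 3/q − 1/2], γ ∈ [0, 3/r − 1/2], and the inequalities α + ((4p−6)q/((6−q)p))·β ≤ 1, α + ((4p−6)r/((6−r)p))·γ ≤ 1, and (2q/(6−q))·β + γ ≤ (6−r)/(2r) hold. Assume there exists a sequence R_j → +∞ such that X_{α,p,R_j} → 0 as j → ∞ and the limits lim_{j→∞} Y_{β,q,R_j} and lim_{j→∞} Z_{γ,r,R_j} exist and are finite. Then u = 0, v = 0 and θ = 0 identically on ℝ³. -/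

import Mathlib

open MeasureTheory Filter Metric

noncomputable section

abbrev R3 : Type := EuclideanSpace ℝ (Fin 3)

/-- Partial derivative of `f` in the `j`-th coordinate direction. -/
def pd (f : R3 → ℝ) (j : Fin 3) (x : R3) : ℝ :=
  fderiv ℝ f x (EuclideanSpace.single j 1)

/-- Laplacian of `f`. -/
def lap (f : R3 → ℝ) (x : R3) : ℝ := ∑ j, pd (pd f j) j x

/-- The stationary 3D tropical climate model:
`-Δu + (u·∇)u + ∇π + div(v⊗v) = 0`, `-Δv + (u·∇)v + ∇θ + (v·∇)u = 0`,
`-Δθ + u·∇θ + div v = 0`, `div u = 0`. -/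
def TCM (u v : R3 → R3) (pr θ : R3 → ℝ) : Prop :=
  (∀ i x, -lap (fun y => u y i) x + (∑ j, u x j * pd (fun y => u y i) j x)
      + pd pr i x + (∑ j, pd (fun y => v y j * v y i) j x) = 0) ∧
  (∀ i x, -lap (fun y => v y i) x + (∑ j, u x j * pd (fun y => v y i) j x)
      + pd θ i x + (∑ j, v x j * pd (fun y => u y i) j x) = 0) ∧
  (∀ x, -lap θ x + (∑ j, u x j * pd θ j x) + (∑ j, pd (fun y => v y j) j x) = 0) ∧
  (∀ x, (∑ j, pd (fun y => u y j) j x) = 0)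

/-- The annulus `B_{2R} \ B_R`. -/
def annulus (R : ℝ) : Set R3 := ball (0 : R3) (2 * R) \ ball 0 R

/-- `L^p` norm of a scalar function on a set `E`. -/
def lpS (g : R3 → ℝ) (p : ℝ) (E : Set R3) : ℝ := (∫ x in E, |g x| ^ p) ^ (1 / p)

/-- `X_{α,p,R} = R^{-α} ‖f‖_{L^p(B_{2R} \ B_R)}` for a vector field `f`. -/
def XnV (f : R3 → R3) (a p R : ℝ) : ℝ := R ^ (-a) * lpS (fun x => ‖f x‖) p (annulus R)

/-- `X_{α,p,R} = R^{-α} ‖f‖_{L^p(B_{2R} \ B_R)}` for a scalar function `f`. -/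
def XnS (f : R3 → ℝ) (a p R : ℝ) : ℝ := R ^ (-a) * lpS f p (annulus R)

section FourierPart
open scoped FourierTransform SchwartzMap ComplexConjugate
open Complex

structure Good (g : R3 → ℂ) : Prop where
  int : Integrable g
  l2 : MemLp g 2

lemma fourier_flip {f g : R3 → ℂ} (hf : Integrable f) (hg : Integrable g) :
    ∫ x, (𝓕 f x) * g x = ∫ x, f x * 𝓕 g x := by
  have := VectorFourier.integral_fourierIntegral_smul_eq_flip (L := innerₗ R3)
    (μ := volume) (ν := volume) (F := ℂ) Real.continuous_fourierChar continuous_inner hf hg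
  simp only [smul_eq_mul, flip_innerₗ] at this
  exact this

lemma fourier_norm_le {g : R3 → ℂ} (x : R3) : ‖𝓕 g x‖ ≤ ∫ ξ, ‖g ξ‖ := by
  rw [Real.fourier_eq]
  refine (norm_integral_le_integral_norm _).trans (le_of_eq ?_)
  congr 1; ext ξ; simp

lemma fourier_cont {g : R3 → ℂ} (hg : Integrable g) : Continuous (𝓕 g) :=
  VectorFourier.fourierIntegral_continuous Real.continuous_fourierChar continuous_inner hg

lemma fourier_L2_ae {g : R3 → ℂ} (hg : Good g) :
    (𝓕 (hg.l2.toLp g) : Lp ℂ 2 (volume : Measure R3)) =ᵐ[volume] 𝓕 g := by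
  apply ae_eq_of_integral_contDiff_smul_eq
  · exact (Lp.memLp _).locallyIntegrable (by norm_num)
  · exact (fourier_cont hg.int).locallyIntegrable
  intro φ hφ hφs
  have hφs' : HasCompactSupport (fun x => (φ x : ℂ)) := hφs.comp_left (g := Complex.ofReal) rfl
  have hφ' : ContDiff ℝ ((⊤ : ℕ∞) : WithTop ℕ∞) (fun x => (φ x : ℂ)) :=
    Complex.ofRealCLM.contDiff.comp hφ
  set Φ : 𝓢(R3, ℂ) := hφs'.toSchwartzMap hφ' with hΦ
  have hΦx : ∀ x, Φ x = (φ x : ℂ) := fun x => rfl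
  have h1 := congrArg (fun T => T Φ) (Lp.fourier_toTemperedDistribution_eq (hg.l2.toLp g))
  simp only [TemperedDistribution.fourier_apply, Lp.toTemperedDistribution_apply] at h1
  have e1 : ∫ x, φ x • (𝓕 (hg.l2.toLp g) : Lp ℂ 2 (volume : Measure R3)) x
      = ∫ x, Φ x • (𝓕 (hg.l2.toLp g) : Lp ℂ 2 (volume : Measure R3)) x := by
    congr 1
  rw [e1, ← h1]
  have e2 : ∫ x, (𝓕 Φ) x • (hg.l2.toLp g) x = ∫ x, (𝓕 (Φ : R3 → ℂ)) x * g x := by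
    apply integral_congr_ae
    filter_upwards [hg.l2.coeFn_toLp] with x hx
    rw [hx, SchwartzMap.fourier_coe, smul_eq_mul]
  rw [e2, fourier_flip Φ.integrable hg.int]
  congr 1

lemma Good.memLp_fourier {g : R3 → ℂ} (hg : Good g) : MemLp (𝓕 g) 2 :=
  (memLp_congr_ae (fourier_L2_ae hg)).1 (Lp.memLp _)

lemma Good.parseval {a b : R3 → ℂ} (ha : Good a) (hb : Good b) :
    ∫ x, conj (𝓕 a x) * 𝓕 b x = ∫ x, conj (a x) * b x := by
  have h := Lp.inner_fourier_eq (ha.l2.toLp a) (hb.l2.toLp b)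
  rw [L2.inner_def, L2.inner_def] at h
  have e1 : ∫ x, conj (𝓕 a x) * 𝓕 b x = ∫ x, inner ℂ ((𝓕 (ha.l2.toLp a) : Lp ℂ 2 (volume : Measure R3)) x)
      ((𝓕 (hb.l2.toLp b) : Lp ℂ 2 (volume : Measure R3)) x) := by
    apply integral_congr_ae
    filter_upwards [fourier_L2_ae ha, fourier_L2_ae hb] with x h1 h2
    rw [h1, h2, RCLike.inner_apply, mul_comm]
  have e2 : ∫ x, conj (a x) * b x = ∫ x, inner ℂ ((ha.l2.toLp a) x) ((hb.l2.toLp b) x) := by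
    apply integral_congr_ae
    filter_upwards [ha.l2.coeFn_toLp, hb.l2.coeFn_toLp] with x h1 h2
    rw [h1, h2, RCLike.inner_apply, mul_comm]
  rw [e1, e2, h]

lemma Good.plancherel {a : R3 → ℂ} (ha : Good a) :
    ∫ x, ‖𝓕 a x‖ ^ 2 = ∫ x, ‖a x‖ ^ 2 := by
  have h := ha.parseval ha
  have : ∀ z : ℂ, conj z * z = ((‖z‖ ^ 2 : ℝ) : ℂ) := by
    intro z; rw [mul_comm, Complex.mul_conj, Complex.normSq_eq_norm_sq]
  simp only [this] at h
  rw [integral_complex_ofReal, integral_complex_ofReal] at h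
  exact_mod_cast h

lemma Good.int_pow {g : R3 → ℂ} (hg : Good g) (n : ℕ) (hn : 2 ≤ n) :
    Integrable (fun x => (𝓕 g x) ^ n) := by
  obtain ⟨k, rfl⟩ := Nat.exists_eq_add_of_le hn
  have h2 : Integrable (fun x => ‖𝓕 g x‖ ^ 2) := hg.memLp_fourier.integrable_norm_pow (by norm_num)
  refine (h2.const_mul ((∫ ξ, ‖g ξ‖) ^ k)).mono'
    (((fourier_cont hg.int).pow _).aestronglyMeasurable) ?_
  refine Eventually.of_forall fun x => ?_
  rw [norm_pow, pow_add, mul_comm]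
  have := fourier_norm_le (g := g) x
  gcongr

lemma Good.mul {g m : R3 → ℂ} (hg : Good g) (hm : Measurable m) {M : ℝ} (hM : ∀ x, ‖m x‖ ≤ M) :
    Good (fun x => m x * g x) := by
  constructor
  · exact hg.int.bdd_mul hm.aestronglyMeasurable (Eventually.of_forall hM)
  · refine MemLp.of_le_mul (c := M) hg.l2 (hm.aestronglyMeasurable.mul hg.int.1)
      (Eventually.of_forall fun x => ?_)
    rw [norm_mul]
    exact mul_le_mul_of_nonneg_right (hM x) (norm_nonneg _)

lemma Good.conj_neg {g : R3 → ℂ} (hg : Good g) : Good (fun x => conj (g (-x))) := by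
  have mp := Measure.measurePreserving_neg (volume : Measure R3)
  have h1 : MemLp (fun x => g (-x)) 2 := hg.l2.comp_measurePreserving mp
  exact ⟨(Complex.conjLIE.integrable_comp_iff (φ := fun x => g (-x))).2 hg.int.comp_neg,
    h1.star⟩

lemma Good.shift {g : R3 → ℂ} (hg : Good g) (ξ : R3) : Good (fun x => g (x - ξ)) := by
  have mp := measurePreserving_sub_right (volume : Measure R3) ξ
  exact ⟨hg.int.comp_sub_right ξ, hg.l2.comp_measurePreserving mp⟩

lemma fourier_conj_neg (g : R3 → ℂ) (x : R3) :
    𝓕 (fun x => conj (g (-x))) x = conj (𝓕 g x) := by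
  rw [Real.fourier_eq', Real.fourier_eq', ← integral_conj,
    ← integral_neg_eq_self]
  congr 1; ext v
  simp only [inner_neg_left, neg_neg, smul_eq_mul, map_mul, ← Complex.exp_conj]
  simp [Complex.conj_ofNat]

lemma fourier_shift (g : R3 → ℂ) (ξ x : R3) :
    𝓕 (fun x => g (x - ξ)) x = Complex.exp ((-2 * Real.pi * inner ℝ x ξ : ℝ) * I) * 𝓕 g x := by
  rw [Real.fourier_eq', Real.fourier_eq', ← integral_const_mul,
    ← integral_add_right_eq_self _ ξ]
  congr 1; ext v
  simp only [add_sub_cancel_right, smul_eq_mul, ← mul_assoc, ← Complex.exp_add]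
  congr 2
  rw [inner_add_left, real_inner_comm ξ x]; push_cast; ring

lemma fourier_mod (f : R3 → ℂ) (ξ η : R3) :
    𝓕 (fun x => f x * Complex.exp ((-2 * Real.pi * inner ℝ x ξ : ℝ) * I)) η = 𝓕 f (η + ξ) := by
  rw [Real.fourier_eq', Real.fourier_eq']
  congr 1; ext v
  simp only [smul_eq_mul]
  rw [mul_comm (f v), ← mul_assoc, ← Complex.exp_add]
  congr 2
  rw [inner_add_right]; push_cast; ring

lemma fourier_pow_half {g : R3 → ℂ} (hg : Good g) (y : R3)
    (hs : ∀ ξ, inner ℝ y ξ ≤ 0 → g ξ = 0) (n : ℕ) (ξ : R3) (hξ : 0 ≤ inner ℝ y ξ) :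
    𝓕 (fun x => (𝓕 g x) ^ (n + 2)) ξ = 0 := by
  induction n generalizing ξ with
  | zero =>
    have h := (hg.conj_neg).parseval (hg.shift ξ)
    have e : 𝓕 (fun x => (𝓕 g x) ^ (0 + 2)) ξ
        = ∫ x, conj (𝓕 (fun x => conj (g (-x))) x) * 𝓕 (fun x => g (x - ξ)) x := by
      rw [Real.fourier_eq']
      congr 1; ext x
      rw [fourier_conj_neg, fourier_shift, Complex.conj_conj, smul_eq_mul]; ring
    rw [e, h]
    rw [integral_eq_zero_of_ae]
    refine Eventually.of_forall fun x => ?_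
    simp only [Complex.conj_conj, Pi.zero_apply, mul_eq_zero]
    by_cases h1 : inner ℝ y (-x) ≤ 0
    · exact Or.inl (hs _ h1)
    · refine Or.inr (hs _ ?_)
      rw [inner_neg_right] at h1
      rw [inner_sub_right]; linarith
  | succ n ih =>
    set e : R3 → ℂ := fun x => Complex.exp ((-2 * Real.pi * inner ℝ x ξ : ℝ) * I)
    have e1 : 𝓕 (fun x => (𝓕 g x) ^ (n + 1 + 2)) ξ
        = ∫ x, (𝓕 g x) * ((𝓕 g x) ^ (n + 2) * e x) := by
      rw [Real.fourier_eq']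
      congr 1; ext x
      simp only [smul_eq_mul, e]; ring
    have hint : Integrable (fun x => (𝓕 g x) ^ (n + 2) * e x) := by
      refine (hg.int_pow (n + 2) (by omega)).mul_bdd (c := 1) ?_ ?_
      · apply Continuous.aestronglyMeasurable; fun_prop
      · refine Eventually.of_forall fun x => ?_
        simp only [e, Complex.norm_exp_ofReal_mul_I, le_refl]
    rw [e1, fourier_flip hg.int hint, integral_eq_zero_of_ae]
    refine Eventually.of_forall fun η => ?_
    simp only [Pi.zero_apply, mul_eq_zero]
    by_cases h1 : inner ℝ y η ≤ 0
    · exact Or.inl (hs _ h1)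
    · right
      rw [fourier_mod]
      apply ih
      rw [inner_add_right]; linarith

lemma integral_pow_half {g : R3 → ℂ} (hg : Good g) (y : R3)
    (hs : ∀ ξ, inner ℝ y ξ ≤ 0 → g ξ = 0) : ∫ x, (𝓕 g x) ^ 6 = 0 := by
  have := fourier_pow_half hg y hs 4 0 (by simp)
  rw [Real.fourier_eq'] at this
  simpa using this

end FourierPart

section HilbertPart
open scoped FourierTransform ComplexConjugate
open Complex

def Herm (g : R3 → ℂ) : Prop := ∀ ξ, g (-ξ) = conj (g ξ)

lemma Herm.real {g : R3 → ℂ} (hg : Herm g) (x : R3) : conj (𝓕 g x) = 𝓕 g x := by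
  rw [← fourier_conj_neg]
  have : (fun x => conj (g (-x))) = g := by
    ext ξ
    rw [hg, Complex.conj_conj]
  rw [this]

lemma Herm.ofReal {g : R3 → ℂ} (hg : Herm g) (x : R3) : 𝓕 g x = ((𝓕 g x).re : ℂ) :=
  (Complex.conj_eq_iff_re.1 (hg.real x)).symm

lemma Herm.mul {g m : R3 → ℂ} (hg : Herm g) (hm : Herm m) : Herm (fun ξ => m ξ * g ξ) := by
  intro ξ
  simp only [hg ξ, hm ξ, map_mul]

def sg (t : ℝ) : ℝ := if 0 < t then 1 else if t < 0 then -1 else 0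

lemma sg_meas : Measurable sg := by
  unfold sg
  refine Measurable.ite measurableSet_Ioi measurable_const ?_
  exact Measurable.ite measurableSet_Iio measurable_const measurable_const

lemma sg_neg (t : ℝ) : sg (-t) = - sg t := by
  unfold sg
  split_ifs <;> linarith

lemma sg_abs (t : ℝ) : |sg t| ≤ 1 := by
  unfold sg
  split_ifs <;> simp

lemma sg_mul (t : ℝ) : sg t * t = |t| := by
  unfold sg
  split_ifs with h1 h2
  · rw [abs_of_pos h1]; ring
  · rw [abs_of_neg h2]; ring
  · have : t = 0 := by linarith
    simp [this]

def hm (y ξ : R3) : ℂ := -I * (sg (inner ℝ y ξ) : ℝ)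

lemma hm_meas (y : R3) : Measurable (hm y) := by
  unfold hm
  have : Measurable fun ξ : R3 => sg (inner ℝ y ξ) := sg_meas.comp (by fun_prop)
  fun_prop

lemma hm_norm (y ξ : R3) : ‖hm y ξ‖ ≤ 1 := by
  unfold hm
  simpa using sg_abs _

lemma hm_herm (y : R3) : Herm (hm y) := by
  intro ξ
  simp only [hm, inner_neg_right, sg_neg, map_mul, map_neg, Complex.conj_I, Complex.conj_ofReal]
  push_cast; ring

lemma hilbert_poly (a b : ℝ) :
    b ^ 6 ≤ -2 * (((a : ℂ) + I * b) ^ 6).re + 27002 * a ^ 6 := by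
  have e : (((a : ℂ) + I * b) ^ 6).re = a ^ 6 - 15 * a ^ 4 * b ^ 2 + 15 * a ^ 2 * b ^ 4 - b ^ 6 := by
    have : ((a : ℂ) + I * b) ^ 6 = ((a ^ 6 - 15 * a ^ 4 * b ^ 2 + 15 * a ^ 2 * b ^ 4 - b ^ 6 : ℝ) : ℂ)
        + ((6 * a ^ 5 * b - 20 * a ^ 3 * b ^ 3 + 6 * a * b ^ 5 : ℝ) : ℂ) * I := by
      push_cast
      have h2 : (I : ℂ) ^ 2 = -1 := Complex.I_sq
      have h3 : (I : ℂ) ^ 3 = -I := by rw [pow_succ, h2]; ring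
      have h4 : (I : ℂ) ^ 4 = 1 := by rw [pow_succ, h3]; simp
      have h5 : (I : ℂ) ^ 5 = I := by rw [pow_succ, h4]; simp
      have h6 : (I : ℂ) ^ 6 = -1 := by rw [pow_succ, h5]; simp
      ring_nf
      rw [h2, h3, h4, h5, h6]; ring
    rw [this, Complex.add_re, Complex.ofReal_re, Complex.re_ofReal_mul, Complex.I_re]; ring
  rw [e]
  have hx : 0 ≤ b ^ 2 := sq_nonneg b
  have hy : 0 ≤ a ^ 2 := sq_nonneg a
  have key : 30 * a ^ 2 * (b ^ 2) ^ 2 ≤ (b ^ 2) ^ 3 + 27000 * (a ^ 2) ^ 3 := by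
    rcases le_total (30 * a ^ 2) (b ^ 2) with h | h
    · nlinarith [mul_le_mul_of_nonneg_right h (sq_nonneg (b ^ 2)), pow_nonneg hy 3]
    · have : (b ^ 2) ^ 2 ≤ (30 * a ^ 2) ^ 2 := by gcongr
      nlinarith [mul_le_mul_of_nonneg_left this hy, pow_nonneg hx 3]
  have : 0 ≤ a ^ 4 * b ^ 2 := by positivity
  nlinarith

lemma hyper_null {y : R3} (hy : y ≠ 0) : ∀ᵐ ξ : R3, inner ℝ y ξ ≠ 0 := by
  have h := Measure.addHaar_submodule (volume : Measure R3) (LinearMap.ker (innerₗ R3 y)) (by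
    intro h
    have : y ∈ LinearMap.ker (innerₗ R3 y) := by rw [h]; trivial
    simp only [LinearMap.mem_ker, innerₗ_apply_apply, inner_self_eq_zero] at this
    exact hy this)
  rw [ae_iff]
  convert h using 2
  ext ξ
  simp

lemma int_re6 {k : R3 → ℂ} (hk : Good k) (hkk : Herm k) : Integrable (fun x => ((𝓕 k x).re) ^ 6) := by
  have := (hk.int_pow 6 (by norm_num)).re
  refine this.congr (Eventually.of_forall fun x => ?_)
  have e := hkk.ofReal x
  change ((𝓕 k x) ^ 6).re = (𝓕 k x).re ^ 6
  generalize (𝓕 k x).re = a at *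
  rw [e, ← Complex.ofReal_pow, Complex.ofReal_re]

lemma hilbert6 {g : R3 → ℂ} (hg : Good g) (hh : Herm g) (y : R3) :
    ∫ x, ((𝓕 (fun ξ => hm y ξ * g ξ) x).re) ^ 6 ≤ 27002 * ∫ x, ((𝓕 g x).re) ^ 6 := by
  by_cases hy : y = 0
  · have : (fun ξ => hm y ξ * g ξ) = fun _ => 0 := by
      ext ξ; simp [hm, hy, sg]
    rw [this]
    have h0 : ∀ x : R3, 𝓕 (fun _ : R3 => (0:ℂ)) x = 0 := by
      intro x; rw [Real.fourier_eq']; simp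
    simp only [h0]
    simp only [Complex.zero_re, ne_eq, OfNat.ofNat_ne_zero, not_false_eq_true, zero_pow, integral_zero]
    apply mul_nonneg (by norm_num)
    exact integral_nonneg fun x => by positivity
  set mp : R3 → ℂ := fun ξ => if 0 < inner ℝ y ξ then 1 else 0 with hmp
  have mpm : Measurable mp :=
    Measurable.ite (measurableSet_lt measurable_const (by fun_prop)) measurable_const measurable_const
  have hgp : Good (fun ξ => mp ξ * g ξ) := hg.mul mpm (M := 1) (by
    intro ξ; simp only [mp]; split_ifs <;> simp)
  have hgh : Good (fun ξ => hm y ξ * g ξ) := hg.mul (hm_meas y) (hm_norm y)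
  have h6 := integral_pow_half hgp y (by
    intro ξ h; simp [mp, not_lt.2 h])
  have hhh : Herm (fun ξ => hm y ξ * g ξ) := hh.mul (hm_herm y)
  have key : ∀ x, 𝓕 (fun ξ => mp ξ * g ξ) x =
      (1/2 : ℂ) * (((𝓕 g x).re : ℂ) + I * ((𝓕 (fun ξ => hm y ξ * g ξ) x).re : ℂ)) := by
    intro x
    rw [← hh.ofReal, ← hhh.ofReal]
    simp only [Real.fourier_eq]
    rw [← integral_const_mul, ← integral_add, ← integral_const_mul]
    · apply integral_congr_ae
      filter_upwards [hyper_null hy] with ξ hξ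
      simp only [Circle.smul_def, smul_eq_mul, mp, hm, sg]
      rcases lt_or_gt_of_ne hξ with h | h
      · simp only [not_lt.2 h.le, h, if_true, if_false]
        push_cast
        linear_combination (-(1/2:ℂ) * (Real.fourierChar (-inner ℝ ξ x) : ℂ) * g ξ) * Complex.I_sq
      · simp only [h, if_true]
        push_cast
        linear_combination ((1/2:ℂ) * (Real.fourierChar (-inner ℝ ξ x) : ℂ) * g ξ) * Complex.I_sq
    · exact (Real.fourierIntegral_convergent_iff x).2 hg.int
    · exact ((Real.fourierIntegral_convergent_iff x).2 hgh.int).const_mul I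
  have i6 : Integrable (fun x => (((𝓕 g x).re : ℂ) + I * ((𝓕 (fun ξ => hm y ξ * g ξ) x).re : ℂ)) ^ 6) := by
    have := (hgp.int_pow 6 (by norm_num)).const_mul 64
    refine this.congr (Eventually.of_forall fun x => ?_)
    simp only [key x]; ring
  have z6 : ∫ x, (((𝓕 g x).re : ℂ) + I * ((𝓕 (fun ξ => hm y ξ * g ξ) x).re : ℂ)) ^ 6 = 0 := by
    have e : ∀ x, (((𝓕 g x).re : ℂ) + I * ((𝓕 (fun ξ => hm y ξ * g ξ) x).re : ℂ)) ^ 6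
      = 64 * (𝓕 (fun ξ => mp ξ * g ξ) x) ^ 6 := by
      intro x; rw [key x]; ring
    simp only [e]
    rw [integral_const_mul, h6, mul_zero]
  have zr : ∫ x, ((((𝓕 g x).re : ℂ) + I * ((𝓕 (fun ξ => hm y ξ * g ξ) x).re : ℂ)) ^ 6).re = 0 := by
    have := integral_re i6
    rw [z6] at this
    simpa using this
  have ire : Integrable fun x => ((((𝓕 g x).re : ℂ) + I * ((𝓕 (fun ξ => hm y ξ * g ξ) x).re : ℂ)) ^ 6).re := i6.re
  calc _ ≤ ∫ x, (-2 * ((((𝓕 g x).re : ℂ) + I * ((𝓕 (fun ξ => hm y ξ * g ξ) x).re : ℂ)) ^ 6).re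
        + 27002 * ((𝓕 g x).re) ^ 6) := by
        apply integral_mono (int_re6 hgh hhh) ((ire.const_mul (-2)).add ((int_re6 hg hh).const_mul _))
        intro x
        exact hilbert_poly _ _
    _ = _ := by
      rw [integral_add (ire.const_mul (-2)) ((int_re6 hg hh).const_mul _), integral_const_mul,
        integral_const_mul, zr]
      ring

end HilbertPart

section RieszPart
open scoped FourierTransform ComplexConjugate
open Complex

lemma ball_isom (e : R3 ≃ₗᵢ[ℝ] R3) (F : R3 → ℝ) :
    ∫ y in ball (0:R3) 1, F (e y) = ∫ y in ball (0:R3) 1, F y := by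
  have h := e.measurePreserving.setIntegral_preimage_emb
    e.toHomeomorph.measurableEmbedding F (ball (0:R3) 1)
  rw [← h]
  congr 2
  ext y; simp

def kk (ξ : R3) : ℝ := ∫ y in ball (0:R3) 1, |inner ℝ y ξ|

lemma kk_smul {t : ℝ} (ht : 0 ≤ t) (ξ : R3) : kk (t • ξ) = t * kk ξ := by
  unfold kk
  rw [← integral_const_mul]
  congr 1; ext y
  rw [inner_smul_right, abs_mul, abs_of_nonneg ht]

lemma kk_norm {ξ η : R3} (h : ‖ξ‖ = ‖η‖) : kk ξ = kk η := by
  unfold kk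
  set e := (Submodule.span ℝ {ξ - η})ᗮ.reflection with he
  have h1 : e ξ = η := Submodule.reflection_sub h
  rw [← ball_isom e (fun y => |inner ℝ y η|)]
  congr 1; ext y
  rw [← h1, LinearIsometryEquiv.inner_map_map]

lemma sgint (ξ η : R3) : IntegrableOn (fun y => sg (inner ℝ y ξ) * inner ℝ y η) (ball (0:R3) 1) := by
  have h1 : IntegrableOn (fun y : R3 => inner ℝ y η) (ball (0:R3) 1) := by
    have : ContinuousOn (fun y : R3 => inner ℝ y η) (closedBall (0:R3) 1) := by fun_prop
    exact (this.integrableOn_compact (isCompact_closedBall _ _)).mono_set ball_subset_closedBall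
  refine h1.bdd_mul (c := 1) ?_ (Eventually.of_forall fun y => ?_)
  · exact (sg_meas.comp (by fun_prop)).aestronglyMeasurable
  · simpa using sg_abs _

lemma avg_inner (ξ η : R3) (hξ : ξ ≠ 0) :
    ∫ y in ball (0:R3) 1, sg (inner ℝ y ξ) * inner ℝ y η
      = (inner ℝ ξ η / ‖ξ‖ ^ 2) * kk ξ := by
  set c := inner ℝ ξ η / ‖ξ‖ ^ 2
  have hn : ‖ξ‖ ^ 2 ≠ 0 := by positivity
  set ζ := η - c • ξ with hζ
  have hz : inner ℝ ξ ζ = 0 := by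
    rw [hζ, inner_sub_right, inner_smul_right, real_inner_self_eq_norm_sq]
    simp only [c]; field_simp; ring
  have h0 : ∫ y in ball (0:R3) 1, sg (inner ℝ y ξ) * inner ℝ y ζ = 0 := by
    set e := (Submodule.span ℝ {ζ})ᗮ.reflection with he
    have h1 : e ζ = -ζ := Submodule.reflection_orthogonalComplement_singleton_eq_neg ζ
    have h2 : e ξ = ξ := by
      apply Submodule.reflection_mem_subspace_eq_self
      rw [Submodule.mem_orthogonal_singleton_iff_inner_right, real_inner_comm]
      exact hz
    have h3 := ball_isom e (fun y => sg (inner ℝ y ξ) * inner ℝ y ζ)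
    have h4 : ∀ y, sg (inner ℝ (e y) ξ) * inner ℝ (e y) ζ = - (sg (inner ℝ y ξ) * inner ℝ y ζ) := by
      intro y
      have a1 : inner ℝ (e y) ξ = inner ℝ y ξ := by
        rw [← LinearIsometryEquiv.inner_map_map e y ξ, h2]
      have a2 := LinearIsometryEquiv.inner_map_map e y ζ
      rw [h1, inner_neg_right] at a2
      rw [a1]
      linear_combination (-sg (inner ℝ y ξ)) * a2
    simp only [h4, integral_neg] at h3
    linarith
  have h1 : η = c • ξ + ζ := by rw [hζ]; abel
  have h2 : ∀ y, sg (inner ℝ y ξ) * inner ℝ y η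
      = c * (sg (inner ℝ y ξ) * inner ℝ y ξ) + sg (inner ℝ y ξ) * inner ℝ y ζ := by
    intro y
    rw [h1, inner_add_right, inner_smul_right]; ring
  simp only [h2]
  rw [integral_add ((sgint ξ ξ).const_mul c) (sgint ξ ζ), h0, integral_const_mul, add_zero]
  congr 1
  unfold kk
  congr 1; ext y; exact sg_mul _

def cR : ℝ := kk (EuclideanSpace.single 0 1)

lemma kk_eq (ξ : R3) : kk ξ = ‖ξ‖ * cR := by
  rw [cR, ← kk_smul (norm_nonneg ξ)]
  apply kk_norm
  rw [norm_smul]; simp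

lemma cR_pos : 0 < cR := by
  unfold cR kk
  have hc : Continuous fun y : R3 => |inner ℝ y (EuclideanSpace.single 0 1 : R3)| := by fun_prop
  rw [setIntegral_pos_iff_support_of_nonneg_ae (Eventually.of_forall fun y => abs_nonneg _)
    ((hc.continuousOn.integrableOn_compact (isCompact_closedBall 0 1)).mono_set ball_subset_closedBall)]
  apply IsOpen.measure_pos
  · exact (hc.isOpen_support).inter isOpen_ball
  · refine ⟨EuclideanSpace.single 0 (1/2), ?_, ?_⟩
    · simp [EuclideanSpace.inner_single_right]
    · simp; norm_num

def rz (j : Fin 3) (ξ : R3) : ℂ := -I * ((ξ j / ‖ξ‖ : ℝ) : ℂ)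

lemma coord_le (ξ : R3) (j : Fin 3) : |ξ j| ≤ ‖ξ‖ := by
  have := PiLp.norm_apply_le ξ j
  simpa using this

lemma rz_norm (j : Fin 3) (ξ : R3) : ‖rz j ξ‖ ≤ 1 := by
  unfold rz
  rw [norm_mul, norm_neg, Complex.norm_I, one_mul, Complex.norm_real, Real.norm_eq_abs, abs_div,
    abs_norm]
  exact div_le_one_of_le₀ (coord_le ξ j) (norm_nonneg _)

lemma rz_meas (j : Fin 3) : Measurable (rz j) := by
  unfold rz
  have : Measurable fun ξ : R3 => ξ j / ‖ξ‖ := by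
    have : Measurable fun ξ : R3 => ξ j := by fun_prop
    exact this.div measurable_norm
  fun_prop

lemma rz_herm (j : Fin 3) : Herm (rz j) := by
  intro ξ
  simp only [rz, norm_neg, PiLp.neg_apply, map_mul, map_neg, Complex.conj_I, Complex.conj_ofReal]
  push_cast; ring

lemma rz_avg (j : Fin 3) (ξ : R3) :
    ∫ y in ball (0:R3) 1, ((y j : ℝ) : ℂ) * hm y ξ = cR * rz j ξ := by
  have h1 : ∀ y : R3, ((y j : ℝ) : ℂ) * hm y ξ
     = -I * ((sg (inner ℝ y ξ) * inner ℝ y (EuclideanSpace.single j (1:ℝ)) : ℝ) : ℂ) := by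
    intro y
    simp [hm, EuclideanSpace.inner_single_right]; ring
  simp only [h1]
  rw [integral_const_mul, integral_complex_ofReal]
  by_cases hξ : ξ = 0
  · subst hξ
    simp [rz, sg]
  · rw [avg_inner _ _ hξ, kk_eq]
    have hn : ‖ξ‖ ≠ 0 := by positivity
    have hn' : (‖ξ‖ : ℂ) ≠ 0 := by exact_mod_cast hn
    simp only [rz, EuclideanSpace.inner_single_right]
    simp
    field_simp

lemma hm_meas2 : Measurable (fun p : R3 × R3 => hm p.1 p.2) := by
  unfold hm
  have : Measurable fun p : R3 × R3 => sg (inner ℝ p.1 p.2) := sg_meas.comp (by fun_prop)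
  fun_prop

lemma finB : IsFiniteMeasure ((volume : Measure R3).restrict (ball (0:R3) 1)) :=
  ⟨by simpa using measure_ball_lt_top⟩

lemma riesz_rep {g : R3 → ℂ} (hg : Good g) (j : Fin 3) (x : R3) :
    ∫ y in ball (0:R3) 1, ((y j : ℝ) : ℂ) * 𝓕 (fun ξ => hm y ξ * g ξ) x
      = cR * 𝓕 (fun ξ => rz j ξ * g ξ) x := by
  have e1 : ∀ y : R3, ((y j : ℝ) : ℂ) * 𝓕 (fun ξ => hm y ξ * g ξ) x
     = ∫ ξ, (Real.fourierChar (-inner ℝ ξ x) : ℂ) * g ξ * (((y j : ℝ) : ℂ) * hm y ξ) := by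
    intro y
    rw [Real.fourier_eq, ← integral_const_mul]
    congr 1; ext ξ
    simp only [Circle.smul_def, smul_eq_mul]; ring
  simp only [e1]
  rw [integral_integral_swap]
  · simp only [integral_const_mul, rz_avg]
    rw [Real.fourier_eq, ← integral_const_mul]
    congr 1; ext ξ
    simp only [Circle.smul_def, smul_eq_mul]; ring
  · haveI := finB
    have hi : Integrable (fun p : R3 × R3 => (1:ℝ) * ‖g p.2‖)
        ((volume.restrict (ball (0:R3) 1)).prod volume) :=
      Integrable.mul_prod (f := fun _ : R3 => (1:ℝ)) (g := fun ξ => ‖g ξ‖)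
        (integrable_const _) hg.int.norm
    have hm1 : AEStronglyMeasurable (Function.uncurry fun (y ξ : R3) =>
        (Real.fourierChar (-inner ℝ ξ x) : ℂ) * g ξ * (((y j : ℝ) : ℂ) * hm y ξ))
        ((volume.restrict (ball (0:R3) 1)).prod volume) := by
      refine AEStronglyMeasurable.mul (AEStronglyMeasurable.mul ?_ ?_) (AEStronglyMeasurable.mul ?_ ?_)
      · apply Continuous.aestronglyMeasurable
        have := Real.continuous_fourierChar
        fun_prop
      · exact hg.int.1.comp_snd
      · apply Continuous.aestronglyMeasurable
        fun_prop
      · exact hm_meas2.aestronglyMeasurable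
    refine hi.mono' hm1 ?_
    have hb : ∀ᵐ p : R3 × R3 ∂((volume.restrict (ball (0:R3) 1)).prod volume), p.1 ∈ ball (0:R3) 1 := by
      have : ∀ᵐ y : R3 ∂(volume.restrict (ball (0:R3) 1)), y ∈ ball (0:R3) 1 :=
        ae_restrict_mem measurableSet_ball
      exact Measure.quasiMeasurePreserving_fst.ae this
    filter_upwards [hb] with p hp
    simp only [Function.uncurry, norm_mul, Circle.norm_coe, one_mul, Complex.norm_real]
    have h1 : ‖p.1 j‖ ≤ 1 := by
      have := coord_le p.1 j
      rw [Real.norm_eq_abs]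
      have h2 : ‖p.1‖ < 1 := by simpa using hp
      linarith
    have h2 := hm_norm p.1 p.2
    have : ‖p.1 j‖ * ‖hm p.1 p.2‖ ≤ 1 := by
      calc _ ≤ (1:ℝ) * 1 := by gcongr
        _ = 1 := by norm_num
    nlinarith [norm_nonneg (g p.2)]

def HH (g : R3 → ℂ) (y x : R3) : ℝ := (𝓕 (fun ξ => hm y ξ * g ξ) x).re

lemma HH_meas {g : R3 → ℂ} (hg : Good g) :
    StronglyMeasurable (Function.uncurry (HH g)) := by
  obtain ⟨g', hg', hgg⟩ := hg.int.1
  have e : Function.uncurry (HH g) = fun p : R3 × R3 =>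
      (∫ ξ, (Real.fourierChar (-inner ℝ ξ p.2) : ℂ) * (hm p.1 ξ * g' ξ)).re := by
    ext p
    simp only [Function.uncurry, HH, Real.fourier_eq]
    congr 1
    apply integral_congr_ae
    filter_upwards [hgg] with ξ h
    simp only [Circle.smul_def, smul_eq_mul, h]
  rw [e]
  have : StronglyMeasurable fun p : R3 × R3 =>
      (∫ ξ, (Real.fourierChar (-inner ℝ ξ p.2) : ℂ) * (hm p.1 ξ * g' ξ)) := by
    apply StronglyMeasurable.integral_prod_right (f := fun (p : R3 × R3) (ξ : R3) =>
      (Real.fourierChar (-inner ℝ ξ p.2) : ℂ) * (hm p.1 ξ * g' ξ))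
    change StronglyMeasurable fun q : (R3 × R3) × R3 =>
      (Real.fourierChar (-inner ℝ q.2 q.1.2) : ℂ) * (hm q.1.1 q.2 * g' q.2)
    refine StronglyMeasurable.mul ?_ (StronglyMeasurable.mul ?_ ?_)
    · have h : Continuous fun q : (R3 × R3) × R3 => -inner ℝ q.2 q.1.2 := by fun_prop
      have h' : Continuous fun q : (R3 × R3) × R3 => (Real.fourierChar (-inner ℝ q.2 q.1.2) : ℂ) :=
        continuous_subtype_val.comp (Real.continuous_fourierChar.comp h)
      exact h'.stronglyMeasurable
    · have h2 : Measurable (fun q : (R3 × R3) × R3 => hm q.1.1 q.2) :=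
        Measurable.comp (f := fun q : (R3 × R3) × R3 => (q.1.1, q.2)) hm_meas2 (by fun_prop)
      exact h2.stronglyMeasurable
    · exact hg'.comp_measurable measurable_snd
  exact Complex.continuous_re.comp_stronglyMeasurable this

lemma HH_bd {g : R3 → ℂ} (y x : R3) (hg : Good g) : |HH g y x| ≤ ∫ ξ, ‖g ξ‖ := by
  unfold HH
  refine (Complex.abs_re_le_norm _).trans (fourier_norm_le x |>.trans ?_)
  apply integral_mono_of_nonneg (Eventually.of_forall fun _ => norm_nonneg _) hg.int.norm
  refine Eventually.of_forall fun ξ => ?_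
  simp only [norm_mul]
  nlinarith [hm_norm y ξ, norm_nonneg (g ξ)]

end RieszPart

section RieszPart2
open scoped FourierTransform ComplexConjugate
open Complex

lemma avg6 (j : Fin 3) (H : R3 → R3 → ℝ) (hmeas : StronglyMeasurable (Function.uncurry H))
    (N c D : ℝ) (hN : ∀ y x, |H y x| ≤ N) (hc : 0 ≤ c)
    (hHi : ∀ y, Integrable (fun x => (H y x) ^ 6)) (hil : ∀ y, ∫ x, (H y x) ^ 6 ≤ D)
    (F : R3 → ℝ) (hF : Integrable (fun x => F x ^ 6))
    (rep : ∀ x, F x = c * ∫ y in ball (0:R3) 1, y j * H y x) :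
    ∫ x, F x ^ 6 ≤ c ^ 6 * (volume.real (ball (0:R3) 1) ^ 6 * D) := by
  set V := volume.real (ball (0:R3) 1) with hV
  have Vpos : 0 < V := ENNReal.toReal_pos (measure_ball_pos _ _ one_pos).ne' measure_ball_lt_top.ne
  set μB := (volume : Measure R3).restrict (ball (0:R3) 1) with hμ
  have hμu : μB.real Set.univ = V := by simp [μB, hV, measureReal_def]
  have : IsFiniteMeasure μB := finB
  have : NeZero μB := ⟨by
    intro h
    rw [h] at hμu; simp at hμu; linarith⟩
  have hHm : ∀ x, StronglyMeasurable (fun y => H y x) := fun x => by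
    have hp : Measurable (fun y : R3 => (y, x)) := measurable_prodMk_right
    exact hmeas.comp_measurable hp
  have hI : ∀ (x : R3) (n : ℕ), Integrable (fun y => (H y x) ^ n) μB := by
    intro x n
    refine (integrable_const (N ^ n)).mono' ((hHm x).pow n).aestronglyMeasurable
      (Eventually.of_forall fun y => ?_)
    rw [norm_pow, Real.norm_eq_abs]
    have := hN y x
    gcongr
  have hb : ∀ᵐ y : R3 ∂μB, |y j| ≤ 1 := by
    filter_upwards [ae_restrict_mem measurableSet_ball] with y hy
    have := coord_le y j
    have h2 : ‖y‖ < 1 := by simpa using hy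
    linarith
  have hI2 : ∀ (x : R3) (n : ℕ), Integrable (fun y : R3 => (y j * H y x) ^ n) μB := by
    intro x n
    refine (hI x n).norm.mono' ?_ ?_
    · apply StronglyMeasurable.aestronglyMeasurable
      apply StronglyMeasurable.pow
      refine StronglyMeasurable.mul ?_ (hHm x)
      apply Continuous.stronglyMeasurable
      fun_prop
    · filter_upwards [hb] with y hy
      rw [norm_pow, norm_pow, norm_mul]
      gcongr
      have := norm_nonneg (H y x)
      rw [Real.norm_eq_abs (y j)]
      nlinarith
  have jen : ∀ x, F x ^ 6 ≤ c ^ 6 * (V ^ 5 * ∫ y, (H y x) ^ 6 ∂μB) := by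
    intro x
    have h := ConvexOn.map_average_le (μ := μB) (s := Set.univ) (f := fun y => y j * H y x)
      (g := fun t : ℝ => t ^ 6) (Even.convexOn_pow (by decide)) (by fun_prop) isClosed_univ
      (by simp) (by simpa using hI2 x 1) (hI2 x 6)
    rw [average_eq, average_eq, hμu, smul_eq_mul, smul_eq_mul, mul_pow] at h
    have h3 : ∫ y, (y j * H y x) ^ 6 ∂μB ≤ ∫ y, (H y x) ^ 6 ∂μB := by
      apply integral_mono_ae (hI2 x 6) (hI x 6)
      filter_upwards [hb] with y hy
      rw [mul_pow]
      have h4 : (y j) ^ 6 ≤ 1 := by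
        rw [← Even.pow_abs (by decide : Even 6)]
        exact pow_le_one₀ (abs_nonneg _) hy
      have h5 : 0 ≤ (H y x) ^ 6 := by positivity
      nlinarith
    rw [rep, mul_pow]
    gcongr
    have h6 : (∫ y, y j * H y x ∂μB) ^ 6 = V ^ 6 * (V⁻¹ ^ 6 * (∫ y, y j * H y x ∂μB) ^ 6) := by
      field_simp
    have h7 : V ^ 6 * (V⁻¹ * ∫ y, (y j * H y x) ^ 6 ∂μB) = V ^ 5 * ∫ y, (y j * H y x) ^ 6 ∂μB := by
      field_simp
    rw [h6]
    calc _ ≤ V ^ 6 * (V⁻¹ * ∫ y, (y j * H y x) ^ 6 ∂μB) := by gcongr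
      _ = _ := h7
      _ ≤ _ := by gcongr
  have hint : Integrable (fun p : R3 × R3 => (H p.1 p.2) ^ 6) (μB.prod volume) := by
    have hmeas : StronglyMeasurable (fun p : R3 × R3 => (H p.1 p.2) ^ 6) := hmeas.pow 6
    rw [integrable_prod_iff hmeas.aestronglyMeasurable]
    constructor
    · exact Eventually.of_forall fun y => hHi y
    · refine (integrable_const D).mono' ?_ (Eventually.of_forall fun y => ?_)
      · exact hmeas.norm.aestronglyMeasurable.integral_prod_right'
      · rw [Real.norm_eq_abs, abs_of_nonneg (integral_nonneg fun x => norm_nonneg _)]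
        refine le_trans (le_of_eq ?_) (hil y)
        congr 1; ext x
        rw [Real.norm_eq_abs, abs_of_nonneg (by positivity)]
  have swap := integral_integral_swap (f := fun y x => (H y x) ^ 6) hint
  calc _ ≤ ∫ x, c ^ 6 * (V ^ 5 * ∫ y, (H y x) ^ 6 ∂μB) := by
        apply integral_mono hF
        · exact (hint.integral_prod_right.const_mul _).const_mul _
        · exact jen
    _ = c ^ 6 * (V ^ 5 * ∫ y, ∫ x, (H y x) ^ 6 ∂volume ∂μB) := by
        rw [integral_const_mul, integral_const_mul, swap]
    _ ≤ c ^ 6 * (V ^ 5 * ∫ y, D ∂μB) := by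
        have := integral_mono hint.integral_prod_left (integrable_const D) hil
        gcongr
    _ = _ := by
        rw [integral_const, hμu, smul_eq_mul]; ring

lemma riesz6 : ∃ C : ℝ, 0 ≤ C ∧ ∀ (j : Fin 3) (g : R3 → ℂ), Good g → Herm g →
    ∫ x, ((𝓕 (fun ξ => rz j ξ * g ξ) x).re) ^ 6 ≤ C * ∫ x, ((𝓕 g x).re) ^ 6 := by
  refine ⟨cR⁻¹ ^ 6 * (volume.real (ball (0:R3) 1) ^ 6 * 27002), by positivity, fun j g hg hh => ?_⟩
  have rep : ∀ x, (𝓕 (fun ξ => rz j ξ * g ξ) x).re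
      = cR⁻¹ * ∫ y in ball (0:R3) 1, y j * HH g y x := by
    intro x
    have h1 := riesz_rep hg j x
    have e : ∀ y : R3, ((y j : ℝ) : ℂ) * 𝓕 (fun ξ => hm y ξ * g ξ) x
        = ((y j * HH g y x : ℝ) : ℂ) := by
      intro y
      rw [(hh.mul (hm_herm y)).ofReal x]; push_cast; rfl
    simp only [e] at h1
    rw [integral_complex_ofReal, (hh.mul (rz_herm j)).ofReal x] at h1
    have h2 : ∫ y in ball (0:R3) 1, y j * HH g y x = cR * (𝓕 (fun ξ => rz j ξ * g ξ) x).re := by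
      exact_mod_cast h1
    rw [h2]
    have := cR_pos.ne'
    field_simp
  have h := avg6 j (HH g) (HH_meas hg) (∫ ξ, ‖g ξ‖) cR⁻¹ (27002 * ∫ x, ((𝓕 g x).re) ^ 6)
    (fun y x => HH_bd y x hg) (inv_nonneg.2 cR_pos.le)
    (fun y => int_re6 (hg.mul (hm_meas y) (hm_norm y)) (hh.mul (hm_herm y)))
    (fun y => hilbert6 hg hh y) _
    (int_re6 (hg.mul (rz_meas j) (rz_norm j)) (hh.mul (rz_herm j))) rep
  refine h.trans (le_of_eq ?_)
  ring

def rr (i j : Fin 3) (ξ : R3) : ℂ := rz i ξ * rz j ξ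

lemma rr_eq (i j : Fin 3) (ξ : R3) : rr i j ξ = -((ξ i * ξ j / ‖ξ‖ ^ 2 : ℝ) : ℂ) := by
  unfold rr rz
  push_cast
  linear_combination ((ξ i : ℂ) / ‖ξ‖ * (ξ j / ‖ξ‖)) * Complex.I_sq

lemma rr_meas (i j : Fin 3) : Measurable (rr i j) := (rz_meas i).mul (rz_meas j)

lemma rr_norm (i j : Fin 3) (ξ : R3) : ‖rr i j ξ‖ ≤ 1 := by
  unfold rr
  rw [norm_mul]
  exact mul_le_one₀ (rz_norm i ξ) (norm_nonneg _) (rz_norm j ξ)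

lemma rr_herm (i j : Fin 3) : Herm (rr i j) := (rz_herm j).mul (rz_herm i)

lemma rr6 : ∃ C : ℝ, 0 ≤ C ∧ ∀ (i j : Fin 3) (g : R3 → ℂ), Good g → Herm g →
    ∫ x, ((𝓕 (fun ξ => rr i j ξ * g ξ) x).re) ^ 6 ≤ C * ∫ x, ((𝓕 g x).re) ^ 6 := by
  obtain ⟨C, hC, h⟩ := riesz6
  refine ⟨C * C, by positivity, fun i j g hg hh => ?_⟩
  have h1 := h j g hg hh
  have h2 := h i (fun ξ => rz j ξ * g ξ) (hg.mul (rz_meas j) (rz_norm j)) (hh.mul (rz_herm j))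
  simp only [← mul_assoc] at h2
  simp only [rr]
  refine h2.trans ?_
  rw [mul_assoc]
  gcongr

lemma rr2 (i j : Fin 3) {g : R3 → ℂ} (hg : Good g) (hh : Herm g) :
    ∫ x, ((𝓕 (fun ξ => rr i j ξ * g ξ) x).re) ^ 2 ≤ ∫ x, ((𝓕 g x).re) ^ 2 := by
  have hg2 := hg.mul (rr_meas i j) (rr_norm i j)
  have hh2 := hh.mul (rr_herm i j)
  have e : ∀ {k : R3 → ℂ}, Good k → Herm k → ∫ x, ((𝓕 k x).re) ^ 2 = ∫ ξ, ‖k ξ‖ ^ 2 := by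
    intro k hk hkk
    rw [← hk.plancherel]
    congr 1; ext x
    have := hkk.ofReal x
    generalize (𝓕 k x).re = a at *
    rw [this]; simp
  rw [e hg2 hh2, e hg hh]
  apply integral_mono_of_nonneg (Eventually.of_forall fun _ => by positivity)
  · exact hg.l2.integrable_norm_pow (by norm_num)
  · refine Eventually.of_forall fun ξ => ?_
    simp only
    rw [norm_mul]
    have h1 := rr_norm i j ξ
    gcongr
    nlinarith [norm_nonneg (g ξ)]

end RieszPart2

section Marcin
open scoped ContDiff

def CcS (f : R3 → ℝ) : Prop := ContDiff ℝ ∞ f ∧ HasCompactSupport f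

lemma lint_low {r a : ℝ} (hr : -1 < r) (ha : 0 ≤ a) :
    ∫⁻ t in Set.Ioc 0 a, ENNReal.ofReal (t ^ r) = ENNReal.ofReal (a ^ (r + 1) / (r + 1)) := by
  have hi : IntervalIntegrable (fun t : ℝ => t ^ r) volume 0 a :=
    intervalIntegral.intervalIntegrable_rpow' hr
  rw [intervalIntegrable_iff_integrableOn_Ioc_of_le ha] at hi
  rw [← ofReal_integral_eq_lintegral_ofReal hi]
  · rw [← intervalIntegral.integral_of_le ha, integral_rpow (Or.inl hr),
      Real.zero_rpow (by linarith), sub_zero]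
  · filter_upwards [ae_restrict_mem measurableSet_Ioc] with t ht
    exact Real.rpow_nonneg ht.1.le _

lemma lint_high {r a : ℝ} (hr : r < -1) (ha : 0 < a) :
    ∫⁻ t in Set.Ioi a, ENNReal.ofReal (t ^ r) = ENNReal.ofReal (-a ^ (r + 1) / (r + 1)) := by
  rw [← ofReal_integral_eq_lintegral_ofReal (integrableOn_Ioi_rpow_of_lt hr ha)]
  · rw [integral_Ioi_rpow_of_lt hr ha]
  · filter_upwards [ae_restrict_mem measurableSet_Ioi] with t ht
    exact Real.rpow_nonneg (ha.trans ht).le _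

lemma inner6 {p a : ℝ} (h2 : 2 < p) (h6 : p < 6) (ha : 0 ≤ a) :
    ∫⁻ t in Set.Ioi 0, ENNReal.ofReal (t ^ (p - 7) * (min a (2 * t)) ^ 6)
      ≤ ENNReal.ofReal ((64 / p + 1 / (6 - p)) * a ^ p) := by
  rcases ha.eq_or_lt with rfl | ha'
  · refine le_trans (le_of_eq ?_) zero_le
    rw [lintegral_eq_zero_iff']
    · filter_upwards [ae_restrict_mem measurableSet_Ioi] with t ht
      have : min 0 (2 * t) = 0 := min_eq_left (by have : 0 < t := ht; linarith)
      simp [this]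
    · fun_prop
  rw [← Set.Ioc_union_Ioi_eq_Ioi ha, lintegral_union measurableSet_Ioi (Set.Ioc_disjoint_Ioi le_rfl)]
  have e1 : ∫⁻ t in Set.Ioc 0 a, ENNReal.ofReal (t ^ (p - 7) * (min a (2 * t)) ^ 6)
      ≤ ENNReal.ofReal (64 * (a ^ p / p)) := by
    calc _ ≤ ∫⁻ t in Set.Ioc 0 a, ENNReal.ofReal 64 * ENNReal.ofReal (t ^ (p - 1)) := by
          apply setLIntegral_mono' measurableSet_Ioc
          intro t ht
          rw [← ENNReal.ofReal_mul (by norm_num)]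
          apply ENNReal.ofReal_le_ofReal
          have ht0 : 0 < t := ht.1
          have : t ^ (p - 1) = t ^ (p - 7) * t ^ 6 := by
            rw [← Real.rpow_natCast, ← Real.rpow_add ht0]; norm_num; ring_nf
          rw [this]
          have h3 : (min a (2 * t)) ^ 6 ≤ (2 * t) ^ 6 := by
            have : 0 ≤ min a (2 * t) := le_min ha (by linarith)
            gcongr; exact min_le_right _ _
          have h4 : 0 ≤ t ^ (p - 7) := Real.rpow_nonneg ht0.le _
          nlinarith
      _ = _ := by
          rw [lintegral_const_mul _ (by fun_prop), lint_low (by linarith) ha,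
            ← ENNReal.ofReal_mul (by norm_num)]
          congr 3 <;> ring_nf
  have e2 : ∫⁻ t in Set.Ioi a, ENNReal.ofReal (t ^ (p - 7) * (min a (2 * t)) ^ 6)
      ≤ ENNReal.ofReal (1 / (6 - p) * a ^ p) := by
    calc _ ≤ ∫⁻ t in Set.Ioi a, ENNReal.ofReal (a ^ 6) * ENNReal.ofReal (t ^ (p - 7)) := by
          apply setLIntegral_mono' measurableSet_Ioi
          intro t ht
          rw [← ENNReal.ofReal_mul (by positivity)]
          apply ENNReal.ofReal_le_ofReal
          have ht0 : 0 < t := ha'.trans ht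
          have h3 : (min a (2 * t)) ^ 6 ≤ a ^ 6 := by
            have : 0 ≤ min a (2 * t) := le_min ha (by linarith)
            gcongr; exact min_le_left _ _
          have h4 : 0 ≤ t ^ (p - 7) := Real.rpow_nonneg ht0.le _
          nlinarith
      _ = _ := by
          rw [lintegral_const_mul _ (by fun_prop), lint_high (by linarith) ha',
            ← ENNReal.ofReal_mul (by positivity)]
          congr 1
          have : a ^ p = a ^ 6 * a ^ (p - 7 + 1) := by
            rw [← Real.rpow_natCast, ← Real.rpow_add ha']; norm_num; ring_nf
          rw [this]
          have h1 : p - 7 + 1 ≠ 0 := by linarith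
          have h2 : 6 - p ≠ 0 := by linarith
          have h3 : p - 7 + 1 = -(6 - p) := by ring
          rw [h3]
          field_simp
  refine (add_le_add e1 e2).trans ?_
  have : 0 ≤ 6 - p := by linarith
  have := Real.rpow_nonneg ha p
  rw [← ENNReal.ofReal_add (by positivity) (by positivity)]
  apply ENNReal.ofReal_le_ofReal
  apply le_of_eq; ring

lemma inner2 {p a : ℝ} (h2 : 2 < p) (ha : 0 ≤ a) :
    ∫⁻ t in Set.Ioi 0, ENNReal.ofReal (t ^ (p - 3) * (if t < a then a ^ 2 else 0))
      ≤ ENNReal.ofReal (1 / (p - 2) * a ^ p) := by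
  rcases ha.eq_or_lt with rfl | ha'
  · refine le_trans (le_of_eq ?_) zero_le
    simp
  rw [← Set.Ioc_union_Ioi_eq_Ioi ha, lintegral_union measurableSet_Ioi (Set.Ioc_disjoint_Ioi le_rfl)]
  have e1 : ∫⁻ t in Set.Ioc 0 a, ENNReal.ofReal (t ^ (p - 3) * (if t < a then a ^ 2 else 0))
      ≤ ENNReal.ofReal (1 / (p - 2) * a ^ p) := by
    calc _ ≤ ∫⁻ t in Set.Ioc 0 a, ENNReal.ofReal (a ^ 2) * ENNReal.ofReal (t ^ (p - 3)) := by
          apply setLIntegral_mono' measurableSet_Ioc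
          intro t ht
          rw [← ENNReal.ofReal_mul (by positivity)]
          apply ENNReal.ofReal_le_ofReal
          have ht0 : 0 < t := ht.1
          have h4 : 0 ≤ t ^ (p - 3) := Real.rpow_nonneg ht0.le _
          split_ifs
          · exact le_of_eq (by ring)
          · rw [mul_zero]; positivity
      _ = _ := by
          rw [lintegral_const_mul _ (by fun_prop), lint_low (by linarith) ha,
            ← ENNReal.ofReal_mul (by positivity)]
          congr 1
          have : a ^ p = a ^ 2 * a ^ (p - 3 + 1) := by
            rw [← Real.rpow_natCast, ← Real.rpow_add ha']; norm_num; ring_nf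
          rw [this]
          have h2 : p - 2 ≠ 0 := by linarith
          have h3 : p - 3 + 1 = p - 2 := by ring
          rw [h3]
          field_simp
  have e2 : ∫⁻ t in Set.Ioi a, ENNReal.ofReal (t ^ (p - 3) * (if t < a then a ^ 2 else 0)) = 0 := by
    rw [setLIntegral_congr_fun measurableSet_Ioi (g := fun _ => 0)]
    · simp
    · intro t ht
      simp [not_lt.2 (le_of_lt (show a < t from ht))]
  rw [e2, add_zero]; exact e1

lemma exists_trunc : ∃ G : ℝ → ℝ, ContDiff ℝ ∞ G ∧ G 0 = 0 ∧ (∀ t, |t| ≤ 1 → G t = t) ∧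
    (∀ t, |G t| ≤ |t|) ∧ (∀ t, |G t| ≤ 2) ∧ (∀ t, |t - G t| ≤ |t|) := by
  let b : ContDiffBump (0:ℝ) := ⟨1, 2, by norm_num, by norm_num⟩
  refine ⟨fun t => t * b t, contDiff_id.mul b.contDiff, by simp, ?_, ?_, ?_, ?_⟩
  · intro t ht
    have : b t = 1 := b.one_of_mem_closedBall (by simpa [b] using ht)
    simp [this]
  · intro t
    rw [abs_mul, abs_of_nonneg b.nonneg]
    exact mul_le_of_le_one_right (abs_nonneg _) b.le_one
  · intro t
    rw [abs_mul, abs_of_nonneg b.nonneg]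
    by_cases h : |t| ≤ 2
    · exact (mul_le_of_le_one_right (abs_nonneg _) b.le_one).trans h
    · have : b t = 0 := b.zero_of_le_dist (by simp only [b, dist_zero_right, Real.norm_eq_abs]; linarith)
      simp [this]
  · intro t
    have : t - t * b t = t * (1 - b t) := by ring
    rw [this, abs_mul, abs_of_nonneg (sub_nonneg.2 b.le_one)]
    apply mul_le_of_le_one_right (abs_nonneg _)
    have := b.nonneg (x := t)
    linarith

lemma cheb {h : R3 → ℝ} (hm : Measurable h) {t : ℝ} (ht : 0 < t) (n : ℕ) :
    volume {x | t / 2 < |h x|} ≤ ENNReal.ofReal ((2 / t) ^ n) * ∫⁻ x, ENNReal.ofReal (|h x| ^ n) := by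
  have h1 := mul_meas_ge_le_lintegral₀ (μ := volume) (f := fun x => ENNReal.ofReal (|h x| ^ n))
    (by fun_prop) (ENNReal.ofReal ((t / 2) ^ n))
  have h2 : volume {x | t / 2 < |h x|}
      ≤ volume {x | ENNReal.ofReal ((t / 2) ^ n) ≤ ENNReal.ofReal (|h x| ^ n)} := by
    apply measure_mono
    intro x hx
    apply ENNReal.ofReal_le_ofReal
    have : t / 2 < |h x| := hx
    gcongr
  calc _ = ENNReal.ofReal ((2 / t) ^ n) * (ENNReal.ofReal ((t / 2) ^ n) * volume {x | t / 2 < |h x|}) := by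
        rw [← mul_assoc, ← ENNReal.ofReal_mul (by positivity), ← mul_pow]
        have : 2 / t * (t / 2) = 1 := by field_simp
        simp [this]
    _ ≤ _ := by
        gcongr
        exact (mul_le_mul_right h2 _).trans h1

lemma marcin {p : ℝ} (h2 : 2 < p) (h6 : p < 6) (C : ℝ) (hC : 0 ≤ C) : ∃ D : ℝ, 0 ≤ D ∧
    ∀ T : (R3 → ℝ) → (R3 → ℝ),
    (∀ f g, CcS f → CcS g → ∀ x, |T (fun x => f x + g x) x| ≤ |T f x| + |T g x|) →
    (∀ f, CcS f → Measurable (T f)) →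
    (∀ f, CcS f → ∫⁻ x, ENNReal.ofReal (|T f x| ^ 2) ≤ ∫⁻ x, ENNReal.ofReal (|f x| ^ 2)) →
    (∀ f, CcS f → ∫⁻ x, ENNReal.ofReal (|T f x| ^ 6) ≤
      ENNReal.ofReal C * ∫⁻ x, ENNReal.ofReal (|f x| ^ 6)) →
    ∀ f, CcS f → ∫⁻ x, ENNReal.ofReal (|T f x| ^ p)
      ≤ ENNReal.ofReal D * ∫⁻ x, ENNReal.ofReal (|f x| ^ p) := by
  obtain ⟨G, Gs, G0, G1, Gle, G2, Gsub⟩ := exists_trunc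
  have K6 : 0 ≤ 64 / p + 1 / (6 - p) := by
    have : 0 < 6 - p := by linarith
    positivity
  have K2 : 0 ≤ 1 / (p - 2) := by
    have : 0 < p - 2 := by linarith
    positivity
  refine ⟨p * (64 * C * (64 / p + 1 / (6 - p)) + 4 * (1 / (p - 2))), by positivity, ?_⟩
  intro T Tadd Tm T2 T6 f hf
  have fm : Measurable f := hf.1.continuous.measurable
  rw [lintegral_rpow_eq_lintegral_meas_lt_mul volume (f := fun x => |T f x|)
    (Eventually.of_forall fun _ => abs_nonneg _)
    ((Tm f hf).abs.aemeasurable) (by linarith : 0 < p)]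
  have step : ∀ t ∈ Set.Ioi (0:ℝ), volume {x | t < |T f x|} * ENNReal.ofReal (t ^ (p - 1))
      ≤ ENNReal.ofReal (64 * C) * (∫⁻ x, ENNReal.ofReal (t ^ (p - 7) * (min |f x| (2 * t)) ^ 6))
       + ENNReal.ofReal 4 * (∫⁻ x, ENNReal.ofReal (t ^ (p - 3) * (if t < |f x| then |f x| ^ 2 else 0))) := by
    intro t ht
    have ht0 : 0 < t := ht
    set f1 : R3 → ℝ := fun x => t * G (f x / t) with hf1
    set f2 : R3 → ℝ := fun x => f x - f1 x with hf2
    have cf1 : CcS f1 := by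
      refine ⟨contDiff_const.mul (Gs.comp (hf.1.div_const t)), ?_⟩
      exact hf.2.comp_left (g := fun s => t * G (s / t)) (by simp [G0])
    have cf2 : CcS f2 := by
      refine ⟨hf.1.sub cf1.1, ?_⟩
      exact hf.2.comp_left (g := fun s => s - t * G (s / t)) (by simp [G0])
    have ef : (fun x => f1 x + f2 x) = f := by ext x; simp [hf2]
    have b1 : ∀ x, |f1 x| ≤ min |f x| (2 * t) := by
      intro x
      have e : |f1 x| = t * |G (f x / t)| := by
        simp only [hf1, abs_mul, abs_of_pos ht0]
      rw [e]
      refine le_min ?_ ?_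
      · have := Gle (f x / t)
        calc _ ≤ t * |f x / t| := by gcongr
          _ = |f x| := by rw [abs_div, abs_of_pos ht0]; field_simp
      · have := G2 (f x / t)
        nlinarith
    have b2 : ∀ x, |f2 x| ^ 2 ≤ if t < |f x| then |f x| ^ 2 else 0 := by
      intro x
      have e : f2 x = t * (f x / t - G (f x / t)) := by
        simp only [hf2, hf1]; field_simp
      split_ifs with h
      · have h1 : |f2 x| ≤ |f x| := by
          rw [e, abs_mul, abs_of_pos ht0]
          calc _ ≤ t * |f x / t| := mul_le_mul_of_nonneg_left (Gsub _) ht0.le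
            _ = |f x| := by rw [abs_div, abs_of_pos ht0]; field_simp
        gcongr
      · have : G (f x / t) = f x / t := by
          apply G1
          rw [abs_div, abs_of_pos ht0]
          exact div_le_one_of_le₀ (not_lt.1 h) ht0.le
        rw [e, this]; simp
    have hset : {x | t < |T f x|} ⊆ {x | t / 2 < |T f1 x|} ∪ {x | t / 2 < |T f2 x|} := by
      intro x hx
      have h1 := Tadd f1 f2 cf1 cf2 x
      rw [ef] at h1
      have h2 : t < |T f x| := hx
      by_contra hcon
      simp only [Set.mem_union, Set.mem_setOf_eq, not_or, not_lt] at hcon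
      linarith [hcon.1, hcon.2]
    have hmeas : volume {x | t < |T f x|} ≤
        ENNReal.ofReal ((2 / t) ^ 6) * (ENNReal.ofReal C * ∫⁻ x, ENNReal.ofReal ((min |f x| (2 * t)) ^ 6)) +
        ENNReal.ofReal ((2 / t) ^ 2) * (∫⁻ x, ENNReal.ofReal (if t < |f x| then |f x| ^ 2 else 0)) := by
      refine (measure_mono hset).trans ((measure_union_le _ _).trans (add_le_add ?_ ?_))
      · refine (cheb (Tm f1 cf1) ht0 6).trans ?_
        gcongr
        refine (T6 f1 cf1).trans ?_
        gcongr with x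
        exact b1 x
      · refine (cheb (Tm f2 cf2) ht0 2).trans ?_
        refine mul_le_mul_right ((T2 f2 cf2).trans ?_) _
        gcongr with x
        exact b2 x
    have htp : 0 ≤ t ^ (p - 1) := Real.rpow_nonneg ht0.le _
    calc _ ≤ _ := mul_le_mul_left hmeas _
      _ = _ := by
        rw [add_mul]
        congr 1
        · have e : ∀ x, ENNReal.ofReal (t ^ (p - 7) * (min |f x| (2 * t)) ^ 6)
              = ENNReal.ofReal (t ^ (p - 7)) * ENNReal.ofReal ((min |f x| (2 * t)) ^ 6) := fun x =>
            ENNReal.ofReal_mul (Real.rpow_nonneg ht0.le _)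
          simp only [e]
          rw [lintegral_const_mul _ (by fun_prop)]
          generalize ∫⁻ x, ENNReal.ofReal ((min |f x| (2 * t)) ^ 6) = J
          have : ENNReal.ofReal (64 * C) * ENNReal.ofReal (t ^ (p - 7))
              = ENNReal.ofReal ((2 / t) ^ 6) * ENNReal.ofReal C * ENNReal.ofReal (t ^ (p - 1)) := by
            rw [← ENNReal.ofReal_mul (by positivity), ← ENNReal.ofReal_mul (by positivity),
              ← ENNReal.ofReal_mul (by positivity)]
            congr 1
            have : t ^ (p - 1) = t ^ (p - 7) * t ^ 6 := by
              rw [← Real.rpow_natCast, ← Real.rpow_add ht0]; norm_num; ring_nf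
            rw [this]; field_simp; ring
          rw [← mul_assoc (ENNReal.ofReal (64 * C)), this]; ring
        · have e : ∀ x, ENNReal.ofReal (t ^ (p - 3) * (if t < |f x| then |f x| ^ 2 else 0))
              = ENNReal.ofReal (t ^ (p - 3)) * ENNReal.ofReal (if t < |f x| then |f x| ^ 2 else 0) := fun x =>
            ENNReal.ofReal_mul (Real.rpow_nonneg ht0.le _)
          simp only [e]
          rw [lintegral_const_mul' _ _ ENNReal.ofReal_ne_top]
          generalize ∫⁻ x, ENNReal.ofReal (if t < |f x| then |f x| ^ 2 else 0) = J
          have : ENNReal.ofReal 4 * ENNReal.ofReal (t ^ (p - 3))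
              = ENNReal.ofReal ((2 / t) ^ 2) * ENNReal.ofReal (t ^ (p - 1)) := by
            rw [← ENNReal.ofReal_mul (by positivity), ← ENNReal.ofReal_mul (by positivity)]
            congr 1
            have : t ^ (p - 1) = t ^ (p - 3) * t ^ 2 := by
              rw [← Real.rpow_natCast, ← Real.rpow_add ht0]; norm_num; ring_nf
            rw [this]; field_simp; ring
          rw [← mul_assoc (ENNReal.ofReal 4), this]; ring
  have hmeas6 : Measurable (Function.uncurry fun (t : ℝ) (x : R3) =>
      ENNReal.ofReal (t ^ (p - 7) * (min |f x| (2 * t)) ^ 6)) := by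
    unfold Function.uncurry
    fun_prop
  have hmeas2 : Measurable (Function.uncurry fun (t : ℝ) (x : R3) =>
      ENNReal.ofReal (t ^ (p - 3) * (if t < |f x| then |f x| ^ 2 else 0))) := by
    unfold Function.uncurry
    apply ENNReal.measurable_ofReal.comp
    refine Measurable.mul (by fun_prop) (Measurable.ite ?_ (by fun_prop) measurable_const)
    exact measurableSet_lt (by fun_prop) (by fun_prop)
  have main : ∫⁻ t in Set.Ioi (0:ℝ), volume {x | t < |T f x|} * ENNReal.ofReal (t ^ (p - 1))
      ≤ ENNReal.ofReal (64 * C) * (ENNReal.ofReal (64 / p + 1 / (6 - p)) * ∫⁻ x, ENNReal.ofReal (|f x| ^ p))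
       + ENNReal.ofReal 4 * (ENNReal.ofReal (1 / (p - 2)) * ∫⁻ x, ENNReal.ofReal (|f x| ^ p)) := by
    refine (setLIntegral_mono' measurableSet_Ioi step).trans ?_
    rw [lintegral_add_left (by
      apply Measurable.const_mul
      exact hmeas6.lintegral_prod_right)]
    rw [lintegral_const_mul _ hmeas6.lintegral_prod_right, lintegral_const_mul _ hmeas2.lintegral_prod_right]
    rw [lintegral_lintegral_swap hmeas6.aemeasurable, lintegral_lintegral_swap hmeas2.aemeasurable]
    have fpm : Measurable fun x => ENNReal.ofReal (|f x| ^ p) := by fun_prop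
    refine add_le_add (mul_le_mul_right ?_ _) (mul_le_mul_right ?_ _)
    · rw [← lintegral_const_mul _ fpm]
      refine lintegral_mono fun x => (inner6 h2 h6 (abs_nonneg _)).trans ?_
      rw [ENNReal.ofReal_mul K6]
    · rw [← lintegral_const_mul _ fpm]
      refine lintegral_mono fun x => (inner2 h2 (abs_nonneg _)).trans ?_
      rw [ENNReal.ofReal_mul K2]
  refine (mul_le_mul_right main _).trans (le_of_eq ?_)
  generalize ∫⁻ x, ENNReal.ofReal (|f x| ^ p) = J
  generalize 64 / p + 1 / (6 - p) = k6 at *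
  generalize 1 / (p - 2) = k2 at *
  have : ENNReal.ofReal (p * (64 * C * k6 + 4 * k2)) = ENNReal.ofReal p *
      (ENNReal.ofReal (64 * C) * ENNReal.ofReal k6 + ENNReal.ofReal 4 * ENNReal.ofReal k2) := by
    rw [ENNReal.ofReal_mul (by linarith), ENNReal.ofReal_add (by positivity) (by positivity),
      ENNReal.ofReal_mul (by positivity : 0 ≤ 64 * C), ENNReal.ofReal_mul (by norm_num : (0:ℝ) ≤ 4)]
  rw [this]
  ring

end Marcin

section GhPart
open scoped FourierTransform SchwartzMap ComplexConjugate ContDiff LineDeriv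
open Complex

def gh (f : R3 → ℝ) : R3 → ℂ := 𝓕⁻ (fun x => (f x : ℂ))

lemma CcS.cplx {f : R3 → ℝ} (hf : CcS f) : ∃ s : 𝓢(R3, ℂ), ∀ x, s x = (f x : ℂ) := by
  have h1 : HasCompactSupport (fun x => (f x : ℂ)) := hf.2.comp_left (g := fun t : ℝ => (t : ℂ)) (by simp)
  have h2 : ContDiff ℝ ∞ (fun x => (f x : ℂ)) := Complex.ofRealCLM.contDiff.comp hf.1
  exact ⟨h1.toSchwartzMap h2, fun x => rfl⟩

lemma gh_schwartz {f : R3 → ℝ} (hf : CcS f) : ∃ s : 𝓢(R3, ℂ), ∀ x, s x = gh f x := by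
  obtain ⟨s, hs⟩ := hf.cplx
  refine ⟨𝓕⁻ s, fun x => ?_⟩
  have := congrFun (SchwartzMap.fourierInv_coe s) x
  rw [this, gh, funext hs]

lemma gh_good {f : R3 → ℝ} (hf : CcS f) : Good (gh f) := by
  obtain ⟨s, hs⟩ := gh_schwartz hf
  have e : gh f = s := (funext hs).symm
  rw [e]
  exact ⟨s.integrable, s.memLp 2⟩

lemma gh_bdd {f : R3 → ℝ} (hf : CcS f) : ∃ C, ∀ ξ, ‖gh f ξ‖ ≤ C := by
  obtain ⟨s, hs⟩ := gh_schwartz hf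
  obtain ⟨C, hC⟩ := s.decay 0 0
  exact ⟨C, fun ξ => by simpa [hs] using hC.2 ξ⟩

lemma gh_cont {f : R3 → ℝ} (hf : CcS f) : Continuous (gh f) := by
  obtain ⟨s, hs⟩ := gh_schwartz hf
  have e : gh f = s := (funext hs).symm
  rw [e]; exact s.continuous

lemma CcS.int {f : R3 → ℝ} (hf : CcS f) : Integrable (fun x => (f x : ℂ)) := by
  obtain ⟨s, hs⟩ := hf.cplx
  rw [← funext hs]; exact s.integrable

lemma gh_inv {f : R3 → ℝ} (hf : CcS f) (x : R3) : 𝓕 (gh f) x = (f x : ℂ) := by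
  obtain ⟨s, hs⟩ := hf.cplx
  have h : Continuous (fun x => (f x : ℂ)) := by rw [← funext hs]; exact s.continuous
  have h1 : Integrable (𝓕 (fun x => (f x : ℂ))) := by
    rw [← funext hs, ← SchwartzMap.fourier_coe]; exact (𝓕 s).integrable
  exact congrFun (Continuous.fourier_fourierInv_eq h hf.int h1) x

lemma gh_herm {f : R3 → ℝ} (hf : CcS f) : Herm (gh f) := by
  intro ξ
  unfold gh
  rw [Real.fourierInv_eq', Real.fourierInv_eq', ← integral_conj]
  congr 1
  ext x
  have e2 : (starRingEnd ℂ) 2 = 2 := Complex.conj_ofNat 2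
  simp [← Complex.exp_conj, inner_neg_right, e2]

lemma gh_add {f g : R3 → ℝ} (hf : CcS f) (hg : CcS g) (ξ : R3) :
    gh (fun x => f x + g x) ξ = gh f ξ + gh g ξ := by
  unfold gh
  rw [Real.fourierInv_eq', Real.fourierInv_eq', Real.fourierInv_eq', ← integral_add]
  · congr 1; ext x; push_cast; simp [mul_add]
  · have := (Real.fourierIntegral_convergent_iff (f := fun x => (f x : ℂ)) (-ξ)).2 hf.int
    simpa [Circle.smul_def, Real.fourierChar_apply] using this
  · have := (Real.fourierIntegral_convergent_iff (f := fun x => (g x : ℂ)) (-ξ)).2 hg.int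
    simpa [Circle.smul_def, Real.fourierChar_apply] using this

lemma gh_pd {f : R3 → ℝ} (hf : CcS f) (k : Fin 3) (ξ : R3) :
    gh (pd f k) ξ = -(2 * Real.pi * I) * ((ξ k : ℝ) : ℂ) * gh f ξ := by
  obtain ⟨s, hs⟩ := hf.cplx
  have h1 : ∀ x, (∂_{(EuclideanSpace.single k (1:ℝ) : R3)} s) x = (pd f k x : ℂ) := by
    intro x
    rw [SchwartzMap.lineDerivOp_apply]
    have e : (s : R3 → ℂ) = fun x => Complex.ofRealCLM (f x) := funext hs
    have hd : HasFDerivAt (s : R3 → ℂ) (Complex.ofRealCLM.comp (fderiv ℝ f x)) x := by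
      rw [e]
      exact Complex.ofRealCLM.hasFDerivAt.comp x (hf.1.differentiable (by simp) x).hasFDerivAt
    rw [hd.hasLineDerivAt _ |>.lineDeriv]
    rfl
  have h2 := congrArg (fun g : 𝓢(R3, ℂ) => g ξ) (SchwartzMap.fourierInv_lineDerivOp_eq s (EuclideanSpace.single k (1:ℝ)))
  simp only [SchwartzMap.fourierInv_coe] at h2
  rw [funext h1] at h2
  unfold gh
  rw [h2]
  have ht : (fun x : R3 => inner ℝ x (EuclideanSpace.single k (1:ℝ))).HasTemperateGrowth := by fun_prop
  rw [SchwartzMap.smul_apply, SchwartzMap.smulLeftCLM_apply_apply ht, SchwartzMap.fourierInv_coe, funext hs]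
  simp [EuclideanSpace.inner_single_right, mul_assoc]

def Trr (i j : Fin 3) (f : R3 → ℝ) (x : R3) : ℝ := (𝓕 (fun ξ => rr i j ξ * gh f ξ) x).re

lemma rrgh_good (i j : Fin 3) {f : R3 → ℝ} (hf : CcS f) : Good (fun ξ => rr i j ξ * gh f ξ) :=
  (gh_good hf).mul (rr_meas i j) (rr_norm i j)

lemma rrgh_herm (i j : Fin 3) {f : R3 → ℝ} (hf : CcS f) : Herm (fun ξ => rr i j ξ * gh f ξ) :=
  (gh_herm hf).mul (rr_herm i j)

lemma Trr_cont (i j : Fin 3) {f : R3 → ℝ} (hf : CcS f) : Continuous (Trr i j f) :=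
  Complex.continuous_re.comp (fourier_cont (rrgh_good i j hf).int)

lemma gh_inv_re {f : R3 → ℝ} (hf : CcS f) (x : R3) : (𝓕 (gh f) x).re = f x := by
  rw [gh_inv hf, Complex.ofReal_re]

lemma int_re2 {k : R3 → ℂ} (hk : Good k) : Integrable (fun x => ((𝓕 k x).re) ^ 2) := by
  refine (hk.int_pow 2 le_rfl).norm.mono' ?_ (Eventually.of_forall fun x => ?_)
  · exact ((Complex.continuous_re.comp (fourier_cont hk.int)).pow 2).aestronglyMeasurable
  · rw [norm_pow, norm_pow]
    have := Complex.abs_re_le_norm (𝓕 k x)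
    rw [Real.norm_eq_abs]
    gcongr

lemma Trr_two (i j : Fin 3) {f : R3 → ℝ} (hf : CcS f) :
    ∫⁻ x, ENNReal.ofReal (|Trr i j f x| ^ 2) ≤ ∫⁻ x, ENNReal.ofReal (|f x| ^ 2) := by
  have h := rr2 i j (gh_good hf) (gh_herm hf)
  simp only [gh_inv_re hf] at h
  simp only [sq_abs]
  rw [← ofReal_integral_eq_lintegral_ofReal, ← ofReal_integral_eq_lintegral_ofReal]
  · exact ENNReal.ofReal_le_ofReal h
  · have := int_re2 (gh_good hf)
    simpa only [gh_inv_re hf] using this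
  · exact Eventually.of_forall fun x => by positivity
  · exact int_re2 (rrgh_good i j hf)
  · exact Eventually.of_forall fun x => by positivity

lemma Trr_six : ∃ C : ℝ, 0 ≤ C ∧ ∀ (i j : Fin 3) (f : R3 → ℝ), CcS f →
    ∫⁻ x, ENNReal.ofReal (|Trr i j f x| ^ 6) ≤ ENNReal.ofReal C * ∫⁻ x, ENNReal.ofReal (|f x| ^ 6) := by
  obtain ⟨C, hC, h⟩ := rr6
  refine ⟨C, hC, fun i j f hf => ?_⟩
  have h := h i j (gh f) (gh_good hf) (gh_herm hf)
  simp only [gh_inv_re hf] at h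
  have e : ∀ t : ℝ, |t| ^ 6 = t ^ 6 := fun t => Even.pow_abs (by decide) t
  simp only [e]
  rw [← ofReal_integral_eq_lintegral_ofReal, ← ofReal_integral_eq_lintegral_ofReal,
    ← ENNReal.ofReal_mul hC]
  · exact ENNReal.ofReal_le_ofReal h
  · have := int_re6 (gh_good hf) (gh_herm hf)
    simpa only [gh_inv_re hf] using this
  · exact Eventually.of_forall fun x => by positivity
  · exact int_re6 (rrgh_good i j hf) (rrgh_herm i j hf)
  · exact Eventually.of_forall fun x => by positivity

lemma Trr_add (i j : Fin 3) {f g : R3 → ℝ} (hf : CcS f) (hg : CcS g) (x : R3) :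
    Trr i j (fun x => f x + g x) x = Trr i j f x + Trr i j g x := by
  have e : (fun ξ => rr i j ξ * gh (fun x => f x + g x) ξ) =
      (fun ξ => rr i j ξ * gh f ξ) + (fun ξ => rr i j ξ * gh g ξ) := by
    ext ξ
    rw [gh_add hf hg, Pi.add_apply, mul_add]
  unfold Trr
  have h1 := (rrgh_good i j hf).int
  have h2 := (rrgh_good i j hg).int
  rw [e]
  generalize (fun ξ => rr i j ξ * gh f ξ) = A at *
  generalize (fun ξ => rr i j ξ * gh g ξ) = B at *
  rw [← Complex.add_re]
  congr 1
  rw [Real.fourier_eq, Real.fourier_eq, Real.fourier_eq, ← integral_add]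
  · congr 1; ext x; simp
  · exact (Real.fourierIntegral_convergent_iff x).2 h1
  · exact (Real.fourierIntegral_convergent_iff x).2 h2

lemma Trr_p {p : ℝ} (h2 : 2 < p) (h6 : p < 6) : ∃ D : ℝ, 0 ≤ D ∧ ∀ (i j : Fin 3) (f : R3 → ℝ), CcS f →
    ∫⁻ x, ENNReal.ofReal (|Trr i j f x| ^ p) ≤ ENNReal.ofReal D * ∫⁻ x, ENNReal.ofReal (|f x| ^ p) := by
  obtain ⟨C, hC, h⟩ := Trr_six
  obtain ⟨D, hD, hh⟩ := marcin h2 h6 C hC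
  refine ⟨D, hD, fun i j => hh (Trr i j) ?_ ?_ ?_ ?_⟩
  · intro f g hf hg x
    rw [Trr_add i j hf hg]
    exact abs_add_le _ _
  · exact fun f hf => (Trr_cont i j hf).measurable
  · exact fun f hf => Trr_two i j hf
  · exact fun f hf => h i j f hf
end GhPart

section PotPart
open scoped FourierTransform ComplexConjugate ContDiff
open Complex

lemma loc_int (k : ℕ) (hk : k ≤ 2) : IntegrableOn (fun ξ : R3 => (‖ξ‖⁻¹) ^ k) (ball 0 1) := by
  rw [← integrable_indicator_iff measurableSet_ball]
  have e : (ball (0:R3) 1).indicator (fun ξ : R3 => (‖ξ‖⁻¹) ^ k) =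
      fun ξ : R3 => (Set.Iio (1:ℝ)).indicator (fun t : ℝ => (t⁻¹) ^ k) ‖ξ‖ := by
    ext ξ
    by_cases h : ‖ξ‖ < 1 <;> simp [h, Set.indicator]
  rw [e, integrable_fun_norm_addHaar volume (f := (Set.Iio (1:ℝ)).indicator (fun t : ℝ => (t⁻¹) ^ k))]
  have e2 : IntegrableOn (fun y : ℝ => (Set.Ioo (0:ℝ) 1).indicator (fun _ => (1:ℝ)) y) (Set.Ioi 0) :=
    ((integrable_indicator_iff measurableSet_Ioo).2 (integrableOn_const (by simp) )).integrableOn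
  refine e2.mono' ?_ ?_
  · refine AEStronglyMeasurable.smul (f := fun y : ℝ => y ^ (Module.finrank ℝ R3 - 1)) (by fun_prop) ?_
    · apply Measurable.aestronglyMeasurable
      apply Measurable.indicator _ measurableSet_Iio
      fun_prop
  · filter_upwards [ae_restrict_mem measurableSet_Ioi] with y hy
    have hy : 0 < y := hy
    by_cases h : y < 1
    · have : y ∈ Set.Ioo (0:ℝ) 1 := ⟨hy, h⟩
      simp only [this, Set.indicator_of_mem, Set.mem_Iio, h]
      simp only [finrank_euclideanSpace, Fintype.card_fin, norm_smul, norm_pow, norm_inv, Real.norm_eq_abs, abs_of_pos hy]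
      interval_cases k
      · simp; rw [abs_of_pos hy]; exact h.le
      · simp; field_simp; linarith
      · simp; field_simp; rfl
    · have h1 : y ∉ Set.Iio (1:ℝ) := h
      have h2 : y ∉ Set.Ioo (0:ℝ) 1 := fun h' => h h'.2
      simp [h1, h2]

def pm (m : Fin 3) (ξ : R3) : ℂ := -I * ((ξ m / (2 * Real.pi * ‖ξ‖ ^ 2) : ℝ) : ℂ)

lemma pm_meas (m : Fin 3) : Measurable (pm m) := by
  unfold pm
  apply Measurable.const_mul
  apply Complex.measurable_ofReal.comp
  fun_prop

lemma pm_norm (m : Fin 3) (ξ : R3) : ‖pm m ξ‖ ≤ ‖ξ‖⁻¹ := by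
  unfold pm
  rw [norm_mul, norm_neg, Complex.norm_I, one_mul, Complex.norm_real, Real.norm_eq_abs, abs_div]
  rcases eq_or_ne ξ 0 with h | h
  · simp [h]
  have h0 : 0 < ‖ξ‖ := norm_pos_iff.2 h
  have := coord_le ξ m
  rw [abs_of_nonneg (by positivity : 0 ≤ 2 * Real.pi * ‖ξ‖ ^ 2), div_le_iff₀ (by positivity)]
  have hpi := Real.pi_gt_three
  field_simp
  nlinarith

def pa (m : Fin 3) (f : R3 → ℝ) (ξ : R3) : ℂ := pm m ξ * gh f ξ

lemma pa_good (m : Fin 3) {f : R3 → ℝ} (hf : CcS f) : Good (pa m f) := by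
  obtain ⟨C, hC⟩ := gh_bdd hf
  have C0 : 0 ≤ C := (norm_nonneg _).trans (hC 0)
  have hm : AEStronglyMeasurable (pa m f) volume :=
    ((pm_meas m).mul (gh_cont hf).measurable).aestronglyMeasurable
  have key : ∀ k : ℕ, 1 ≤ k → k ≤ 2 → Integrable (fun ξ => ‖gh f ξ‖ ^ k) →
      Integrable (fun ξ => ‖pa m f ξ‖ ^ k) := by
    intro k hk1 hk hg
    have h1 : Integrable ((ball (0:R3) 1).indicator fun ξ : R3 => C ^ k * (‖ξ‖⁻¹) ^ k) := by
      rw [integrable_indicator_iff measurableSet_ball]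
      exact (loc_int k hk).const_mul _
    refine (h1.add hg).mono' (hm.norm.pow k) (Eventually.of_forall fun ξ => ?_)
    rw [norm_pow, norm_norm, pa, norm_mul, mul_pow, Pi.add_apply]
    have hp := pm_norm m ξ
    by_cases h : ξ ∈ ball (0:R3) 1
    · rw [Set.indicator_of_mem h, mul_comm]
      have : ‖gh f ξ‖ ^ k * ‖pm m ξ‖ ^ k ≤ C ^ k * ‖ξ‖⁻¹ ^ k := by
        gcongr
        exact hC ξ
      have : 0 ≤ ‖gh f ξ‖ ^ k := by positivity
      linarith
    · rw [Set.indicator_of_notMem h, zero_add]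
      have h' : 1 ≤ ‖ξ‖ := by simpa using h
      have : ‖pm m ξ‖ ^ k ≤ 1 := pow_le_one₀ (norm_nonneg _) (hp.trans (inv_le_one_of_one_le₀ h'))
      have h0 : 0 ≤ ‖gh f ξ‖ ^ k := by positivity
      nlinarith
  constructor
  · have := key 1 le_rfl (by norm_num) (by simpa using (gh_good hf).int.norm)
    simp only [pow_one] at this
    exact (integrable_norm_iff hm).1 this
  · refine (memLp_two_iff_integrable_sq_norm hm).2 (key 2 (by norm_num) le_rfl ?_)
    exact (memLp_two_iff_integrable_sq_norm (gh_cont hf).aestronglyMeasurable).1 (gh_good hf).l2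

lemma pa_int1 (m : Fin 3) {f : R3 → ℝ} (hf : CcS f) : Integrable (fun ξ => ‖ξ‖ * ‖pa m f ξ‖) := by
  refine (gh_good hf).int.norm.mono' ?_ (Eventually.of_forall fun ξ => ?_)
  · exact (continuous_norm.aestronglyMeasurable).mul (pa_good m hf).int.1.norm
  · rw [norm_mul, norm_norm, norm_norm, pa, norm_mul, ← mul_assoc]
    have hp := pm_norm m ξ
    have : ‖ξ‖ * ‖pm m ξ‖ ≤ 1 := by
      rcases eq_or_ne ξ 0 with h | h
      · simp [h]
      have h0 : 0 < ‖ξ‖ := norm_pos_iff.2 h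
      calc ‖ξ‖ * ‖pm m ξ‖ ≤ ‖ξ‖ * ‖ξ‖⁻¹ := by gcongr
        _ = 1 := by field_simp
    have h0 : 0 ≤ ‖gh f ξ‖ := by positivity
    nlinarith

def pot (m : Fin 3) (f : R3 → ℝ) (x : R3) : ℝ := (𝓕 (pa m f) x).re

lemma pot_C1 (m : Fin 3) {f : R3 → ℝ} (hf : CcS f) : ContDiff ℝ 1 (pot m f) := by
  have h : ContDiff ℝ ((1:ℕ∞) : WithTop ℕ∞) (𝓕 (pa m f)) := by
    apply Real.contDiff_fourier
    intro n hn
    have : n ≤ 1 := by exact_mod_cast hn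
    interval_cases n
    · simpa using (pa_good m hf).int.norm
    · simpa using pa_int1 m hf
  exact Complex.reCLM.contDiff.comp h

lemma pot_pd (m k : Fin 3) {f : R3 → ℝ} (hf : CcS f) (x : R3) : pd (pot m f) k x = Trr k m f x := by
  have h := Real.hasFDerivAt_fourier (pa_good m hf).int (pa_int1 m hf) x
  have h2 : HasFDerivAt (pot m f) _ x := Complex.reCLM.hasFDerivAt.comp x h
  unfold pd
  rw [h2.fderiv]
  simp only [ContinuousLinearMap.comp_apply, Complex.reCLM_apply, Trr]
  congr 1
  have e : (fun ξ => rr k m ξ * gh f ξ) = fun ξ => (VectorFourier.fourierSMulRight (innerSL ℝ) (pa m f)) ξ (EuclideanSpace.single k (1:ℝ)) := by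
    ext ξ
    rw [VectorFourier.fourierSMulRight_apply, rr_eq, pa, pm]
    simp only [innerSL_apply_apply, EuclideanSpace.inner_single_right, smul_eq_mul]
    simp only [Complex.real_smul]
    rcases eq_or_ne ξ 0 with h | h
    · simp [h]
    have h0 : (‖ξ‖ : ℂ) ≠ 0 := by exact_mod_cast (norm_pos_iff.2 h).ne'
    have hpi : (Real.pi : ℂ) ≠ 0 := by exact_mod_cast Real.pi_ne_zero
    push_cast
    have hin : (innerSL ℝ ξ) (EuclideanSpace.single k (1:ℝ)) = ξ k := by
      rw [innerSL_apply_apply]; simp [EuclideanSpace.inner_single_right]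
    rw [hin]
    field_simp
    rw [show I ^ 2 = -1 from Complex.I_sq]
    ring
  rw [e]
  rw [Real.fourier_eq, Real.fourier_eq]
  rw [ContinuousLinearMap.integral_apply]
  · simp [Circle.smul_def]
  · rw [Real.fourierIntegral_convergent_iff]
    refine ((pa_int1 m hf).const_mul (2 * Real.pi * ‖(innerSL ℝ : R3 →L[ℝ] R3 →L[ℝ] ℝ)‖)).mono'
      (pa_good m hf).int.1.fourierSMulRight (Eventually.of_forall fun ξ => ?_)
    refine (VectorFourier.norm_fourierSMulRight_le _ _ _).trans (le_of_eq ?_)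
    ring

lemma sum_rr {ξ : R3} (h : ξ ≠ 0) : ∑ j, rr j j ξ = -1 := by
  simp only [rr_eq]
  rw [Finset.sum_neg_distrib, ← Complex.ofReal_sum, ← Finset.sum_div]
  have e : ∑ i, ξ i * ξ i = ‖ξ‖ ^ 2 := by
    rw [EuclideanSpace.norm_sq_eq]
    simp [sq]
  rw [e, div_self (by have := norm_pos_iff.2 h; positivity)]
  simp

lemma four_re_sum3 {a b c : R3 → ℂ} (ha : Integrable a) (hb : Integrable b) (hc : Integrable c) (x : R3) :
    (𝓕 a x).re + (𝓕 b x).re + (𝓕 c x).re = (𝓕 (fun ξ => a ξ + b ξ + c ξ) x).re := by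
  rw [← Complex.add_re, ← Complex.add_re]
  congr 1
  simp only [Real.fourier_eq]
  have ha' := (Real.fourierIntegral_convergent_iff x).2 ha
  have hb' := (Real.fourierIntegral_convergent_iff x).2 hb
  have hc' := (Real.fourierIntegral_convergent_iff x).2 hc
  have hab : Integrable (fun v => Real.fourierChar (-inner ℝ v x) • a v + Real.fourierChar (-inner ℝ v x) • b v) := ha'.add hb'
  rw [← integral_add ha' hb', ← integral_add hab hc']
  congr 1; ext y; simp

lemma four_congr {a b : R3 → ℂ} (h : ∀ ξ, ξ ≠ 0 → a ξ = b ξ) (x : R3) : 𝓕 a x = 𝓕 b x := by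
  rw [Real.fourier_eq, Real.fourier_eq]
  apply integral_congr_ae
  have : ∀ᵐ ξ : R3, ξ ≠ 0 := by
    simp [ae_iff]
  filter_upwards [this] with ξ hξ
  rw [h ξ hξ]

lemma Trr_trace {f : R3 → ℝ} (hf : CcS f) (x : R3) :
    Trr 0 0 f x + Trr 1 1 f x + Trr 2 2 f x = - f x := by
  unfold Trr
  rw [four_re_sum3 (rrgh_good _ _ hf).int (rrgh_good _ _ hf).int (rrgh_good _ _ hf).int,
    four_congr (b := fun ξ => - gh f ξ), ← gh_inv_re hf x]
  · rw [← Complex.neg_re]; congr 1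
    rw [Real.fourier_eq, Real.fourier_eq, ← integral_neg]
    congr 1; ext y; simp
  · intro ξ h
    have := sum_rr h
    rw [Fin.sum_univ_three] at this
    rw [← add_mul, ← add_mul, this]; ring

lemma Trr_div {F : Fin 3 → R3 → ℝ} (hF : ∀ i, CcS (F i)) (hd : ∀ x, ∑ j, pd (F j) j x = 0) (i : Fin 3) (x : R3) :
    Trr 0 i (F 0) x + Trr 1 i (F 1) x + Trr 2 i (F 2) x = 0 := by
  have hc : ∀ j, CcS (pd (F j) j) := fun j => by
    refine ⟨?_, ?_⟩
    · have : ContDiff ℝ ∞ (fderiv ℝ (F j)) := (hF j).1.fderiv_right (by simp)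
      exact this.clm_apply contDiff_const
    · have := (hF j).2.fderiv (𝕜 := ℝ)
      exact this.comp_left (g := fun L : R3 →L[ℝ] ℝ => L (EuclideanSpace.single j 1)) (by simp)
  have hc01 : CcS (fun x => pd (F 0) 0 x + pd (F 1) 1 x) := ⟨(hc 0).1.add (hc 1).1, (hc 0).2.add (hc 1).2⟩
  have key : ∀ ξ : R3, (ξ 0 : ℂ) * gh (F 0) ξ + (ξ 1 : ℂ) * gh (F 1) ξ + (ξ 2 : ℂ) * gh (F 2) ξ = 0 := by
    intro ξ
    have h1 := gh_add hc01 (hc 2) ξ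
    rw [gh_add (hc 0) (hc 1), gh_pd (hF 0), gh_pd (hF 1), gh_pd (hF 2)] at h1
    have h2 : (fun x => pd (F 0) 0 x + pd (F 1) 1 x + pd (F 2) 2 x) = fun x => (0:ℝ) := by
      ext x
      rw [← hd x, Fin.sum_univ_three]
    rw [h2] at h1
    have h3 : gh (fun x => (0:ℝ)) ξ = 0 := by
      unfold gh
      rw [Real.fourierInv_eq']
      simp
    rw [h3] at h1
    have hne : -(2 * Real.pi * I) ≠ 0 := by
      simp [Real.pi_ne_zero]
    have h4 : -(2 * Real.pi * I) * ((ξ 0 : ℂ) * gh (F 0) ξ + (ξ 1 : ℂ) * gh (F 1) ξ + (ξ 2 : ℂ) * gh (F 2) ξ) = 0 := by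
      rw [h1]; ring
    exact (mul_eq_zero.1 h4).resolve_left hne
  unfold Trr
  rw [four_re_sum3 (rrgh_good _ _ (hF 0)).int (rrgh_good _ _ (hF 1)).int (rrgh_good _ _ (hF 2)).int,
    four_congr (b := fun ξ => 0)]
  · rw [Real.fourier_eq]; simp
  · intro ξ h
    have h0 : (‖ξ‖ : ℂ) ≠ 0 := by exact_mod_cast (norm_pos_iff.2 h).ne'
    simp only [rr_eq]
    have : -((ξ 0 * ξ i / ‖ξ‖ ^ 2 : ℝ) : ℂ) * gh (F 0) ξ + -((ξ 1 * ξ i / ‖ξ‖ ^ 2 : ℝ) : ℂ) * gh (F 1) ξ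
       + -((ξ 2 * ξ i / ‖ξ‖ ^ 2 : ℝ) : ℂ) * gh (F 2) ξ = -((ξ i / ‖ξ‖ ^ 2 : ℝ) : ℂ) *
       ((ξ 0 : ℂ) * gh (F 0) ξ + (ξ 1 : ℂ) * gh (F 1) ξ + (ξ 2 : ℂ) * gh (F 2) ξ) := by
      push_cast; ring
    rw [this, key, mul_zero]

end PotPart

section GNSPart
open scoped ContDiff ENNReal

lemma clm_le_sum (L : R3 →L[ℝ] ℝ) : ‖L‖ ≤ ∑ j, |L (EuclideanSpace.single j 1)| := by
  refine ContinuousLinearMap.opNorm_le_bound _ (by positivity) fun x => ?_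
  have e : x = ∑ j, x j • (EuclideanSpace.single j (1:ℝ) : R3) := by
    ext i
    simp [Finset.sum_apply, Pi.single_apply]
  conv_lhs => rw [e]
  rw [map_sum, Finset.sum_mul]
  refine (norm_sum_le _ _).trans (Finset.sum_le_sum fun j _ => ?_)
  rw [map_smul, norm_smul, mul_comm]
  have := coord_le x j
  rw [Real.norm_eq_abs, Real.norm_eq_abs]
  gcongr

lemma gns : ∃ C : ℝ, 0 ≤ C ∧ ∀ f : R3 → ℝ, ContDiff ℝ 1 f → HasCompactSupport f →
    ∫⁻ x, ENNReal.ofReal (|f x| ^ 6) ≤ ENNReal.ofReal C * (∫⁻ x, ENNReal.ofReal (∑ j, (pd f j x) ^ 2)) ^ 3 := by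
  set K := eLpNormLESNormFDerivOfEqInnerConst (volume : Measure R3) (2:ℝ) with hK
  refine ⟨(K:ℝ) ^ 6 * 27, by positivity, fun f hf hs => ?_⟩
  have h := eLpNorm_le_eLpNorm_fderiv_of_eq_inner (F' := ℝ) (volume : Measure R3) hf hs (p := 2) (p' := 6) (by norm_num) (by simp) (by simp; norm_num)
  have e1 : ∫⁻ x, ENNReal.ofReal (|f x| ^ 6) = eLpNorm f 6 volume ^ 6 := by
    rw [eLpNorm_eq_lintegral_rpow_enorm_toReal (by simp) (by simp), ← ENNReal.rpow_natCast, ← ENNReal.rpow_mul]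
    simp
    apply lintegral_congr fun x => ?_
    rw [← Real.enorm_eq_ofReal_abs]
  have e2 : eLpNorm (fderiv ℝ f) 2 volume ^ 2 ≤ 3 * ∫⁻ x, ENNReal.ofReal (∑ j, (pd f j x) ^ 2) := by
    rw [eLpNorm_eq_lintegral_rpow_enorm_toReal (by simp) (by simp), ← ENNReal.rpow_natCast, ← ENNReal.rpow_mul]
    simp only [ENNReal.toReal_ofNat, Nat.cast_ofNat, one_div, ne_eq, OfNat.ofNat_ne_zero, not_false_eq_true, inv_mul_cancel₀, ENNReal.rpow_one]
    rw [← lintegral_const_mul' _ _ (by simp)]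
    refine lintegral_mono fun x => ?_
    rw [← ofReal_norm, ENNReal.ofReal_rpow_of_nonneg (norm_nonneg _) (by norm_num), show (3:ℝ≥0∞) = ENNReal.ofReal 3 by simp, ← ENNReal.ofReal_mul (by norm_num)]
    apply ENNReal.ofReal_le_ofReal
    have := clm_le_sum (fderiv ℝ f x)
    rw [show (2:ℝ) = ((2:ℕ):ℝ) by norm_num, Real.rpow_natCast]
    calc _ ≤ (∑ j, |pd f j x|) ^ 2 := by gcongr; exact this
      _ ≤ _ := by
        have := sq_sum_le_card_mul_sum_sq (s := Finset.univ) (f := fun j => |pd f j x|)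
        simpa using this
  rw [e1]
  calc eLpNorm f 6 volume ^ 6 ≤ (K * eLpNorm (fderiv ℝ f) 2 volume) ^ 6 := by
        gcongr
        exact_mod_cast h
    _ = K ^ 6 * (eLpNorm (fderiv ℝ f) 2 volume ^ 2) ^ 3 := by ring
    _ ≤ K ^ 6 * (3 * ∫⁻ x, ENNReal.ofReal (∑ j, (pd f j x) ^ 2)) ^ 3 := by gcongr
    _ = _ := by
      rw [ENNReal.ofReal_mul (by positivity), ENNReal.ofReal_pow (by positivity), mul_pow]
      simp
      ring

lemma pd_add {f g : R3 → ℝ} {x : R3} (hf : DifferentiableAt ℝ f x) (hg : DifferentiableAt ℝ g x) (j : Fin 3) :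
    pd (fun y => f y + g y) j x = pd f j x + pd g j x := by
  unfold pd; rw [fderiv_fun_add hf hg]; rfl

lemma pd_sub {f g : R3 → ℝ} {x : R3} (hf : DifferentiableAt ℝ f x) (hg : DifferentiableAt ℝ g x) (j : Fin 3) :
    pd (fun y => f y - g y) j x = pd f j x - pd g j x := by
  unfold pd; rw [fderiv_fun_sub hf hg]; rfl

lemma pd_mul {f g : R3 → ℝ} {x : R3} (hf : DifferentiableAt ℝ f x) (hg : DifferentiableAt ℝ g x) (j : Fin 3) :
    pd (fun y => f y * g y) j x = pd f j x * g x + f x * pd g j x := by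
  unfold pd; rw [fderiv_fun_mul hf hg]; simp; ring

lemma pd_const_mul {f : R3 → ℝ} {x : R3} (c : ℝ) (hf : DifferentiableAt ℝ f x) (j : Fin 3) :
    pd (fun y => c * f y) j x = c * pd f j x := by
  unfold pd; rw [fderiv_const_mul hf]; rfl

lemma pd_scale {f : R3 → ℝ} (c : ℝ) (x : R3) (hf : DifferentiableAt ℝ f (c • x)) (j : Fin 3) :
    pd (fun y => f (c • y)) j x = c * pd f j (c • x) := by
  unfold pd
  have h1 : HasFDerivAt (fun y : R3 => c • y) (c • ContinuousLinearMap.id ℝ R3) x :=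
    (hasFDerivAt_id x).const_smul c
  have := hf.hasFDerivAt.comp x h1
  rw [show (fun y => f (c • y)) = f ∘ (fun y : R3 => c • y) from rfl, this.fderiv]
  simp

lemma pd_contDiff {f : R3 → ℝ} (hf : ContDiff ℝ ∞ f) (j : Fin 3) : ContDiff ℝ ∞ (pd f j) := by
  have : ContDiff ℝ ∞ (fderiv ℝ f) := hf.fderiv_right (by simp)
  exact this.clm_apply contDiff_const

lemma pd_cont {f : R3 → ℝ} (hf : ContDiff ℝ 1 f) (j : Fin 3) : Continuous (pd f j) :=
  (hf.continuous_fderiv (by simp)).clm_apply continuous_const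

lemma pd_cs {f : R3 → ℝ} (hf : HasCompactSupport f) (j : Fin 3) : HasCompactSupport (pd f j) := by
  have := hf.fderiv (𝕜 := ℝ)
  exact this.comp_left (g := fun L : R3 →L[ℝ] ℝ => L (EuclideanSpace.single j 1)) (by simp)

lemma pd_congr {f g : R3 → ℝ} {x : R3} (h : f =ᶠ[nhds x] g) (j : Fin 3) : pd f j x = pd g j x := by
  unfold pd; rw [h.fderiv_eq]

lemma pd_eq_zero {f : R3 → ℝ} {x : R3} {c : ℝ} (h : ∀ᶠ y in nhds x, f y = c) (j : Fin 3) : pd f j x = 0 := by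
  rw [pd_congr (g := fun _ => c) h]; simp [pd]

lemma cutoff {a b : ℝ} (ha : 0 < a) (hab : a < b) : ∃ χ : R3 → ℝ, ContDiff ℝ ∞ χ ∧ HasCompactSupport χ ∧
    (∀ x, 0 ≤ χ x) ∧ (∀ x, χ x ≤ 1) ∧ (∀ x, ‖x‖ ≤ a → χ x = 1) ∧ (∀ x, b ≤ ‖x‖ → χ x = 0) := by
  let B : ContDiffBump (0:R3) := ⟨a, b, ha, hab⟩
  refine ⟨B, B.contDiff, B.hasCompactSupport, fun x => B.nonneg, fun x => B.le_one, fun x hx => ?_, fun x hx => ?_⟩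
  · exact B.one_of_mem_closedBall (by simpa [B] using hx)
  · exact B.zero_of_le_dist (by simpa [B] using hx)

lemma bdd_of_cs {f : R3 → ℝ} (hf : Continuous f) (hs : HasCompactSupport f) : ∃ K, 0 ≤ K ∧ ∀ x, |f x| ≤ K := by
  obtain ⟨K, hK⟩ := hs.exists_bound_of_continuous hf
  exact ⟨K, (norm_nonneg _).trans (hK 0), hK⟩

lemma gns' : ∃ C : ℝ, 0 ≤ C ∧ ∀ f : R3 → ℝ, ContDiff ℝ 1 f → ∫⁻ x, ENNReal.ofReal (f x ^ 2) ≠ ⊤ →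
    ∫⁻ x, ENNReal.ofReal (|f x| ^ 6) ≤ ENNReal.ofReal C * (∫⁻ x, ENNReal.ofReal (∑ j, (pd f j x) ^ 2)) ^ 3 := by
  obtain ⟨C, hC, h⟩ := gns
  obtain ⟨χ, hχ, hχs, χ0, χ1, χone, χz⟩ := cutoff one_pos one_lt_two
  have hb : ∀ j, ∃ K, 0 ≤ K ∧ ∀ x, |pd χ j x| ≤ K := fun j =>
    bdd_of_cs (pd_contDiff hχ j).continuous (pd_cs hχs j)
  choose K hK0 hK using hb
  set M := ∑ j, 2 * (K j) ^ 2 with hM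
  refine ⟨C * 2 ^ 3, by positivity, fun f hf h2 => ?_⟩
  set G := ∫⁻ x, ENNReal.ofReal (∑ j, (pd f j x) ^ 2) with hG
  set N := ∫⁻ x, ENNReal.ofReal (f x ^ 2) with hN
  have step : ∀ n : ℕ, 0 < n → ∫⁻ x in ball (0:R3) n, ENNReal.ofReal (|f x| ^ 6) ≤
      ENNReal.ofReal C * (ENNReal.ofReal 2 * G + ENNReal.ofReal (M * ((n:ℝ)⁻¹) ^ 2) * N) ^ 3 := by
    intro n hn
    have hn' : (0:ℝ) < n := by exact_mod_cast hn
    set c : ℝ := (n:ℝ)⁻¹ with hc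
    have c0 : 0 < c := by positivity
    have hχc : ContDiff ℝ ∞ (fun x : R3 => χ (c • x)) := hχ.comp (contDiff_const_smul c)
    have hg : ContDiff ℝ 1 (fun x => χ (c • x) * f x) := (hχc.of_le (by simp)).mul hf
    have hgs : HasCompactSupport (fun x => χ (c • x) * f x) :=
      (hχs.comp_smul c0.ne').mul_right
    have h3 := h _ hg hgs
    calc ∫⁻ x in ball (0:R3) n, ENNReal.ofReal (|f x| ^ 6) ≤ ∫⁻ x in ball (0:R3) n, ENNReal.ofReal (|χ (c • x) * f x| ^ 6) := by
          apply setLIntegral_mono' measurableSet_ball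
          intro x hx
          rw [χone, one_mul]
          have : ‖x‖ < n := by simpa using hx
          rw [norm_smul, Real.norm_eq_abs, abs_of_pos c0, hc, inv_mul_le_iff₀ hn']
          linarith
      _ ≤ ∫⁻ x, ENNReal.ofReal (|χ (c • x) * f x| ^ 6) := setLIntegral_le_lintegral _ _
      _ ≤ _ := h3
      _ ≤ _ := by
        gcongr
        rw [hG, hN, ← lintegral_const_mul' _ _ (by simp), ← lintegral_const_mul' _ _ (by simp),
          ← lintegral_add_left']
        · refine lintegral_mono fun x => ?_
          rw [← ENNReal.ofReal_mul (by norm_num), ← ENNReal.ofReal_mul (by positivity), ← ENNReal.ofReal_add (by positivity) (by positivity)]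
          apply ENNReal.ofReal_le_ofReal
          rw [hM, Finset.mul_sum, Finset.sum_mul, Finset.sum_mul, ← Finset.sum_add_distrib]
          refine Finset.sum_le_sum fun j _ => ?_
          rw [pd_mul (hχc.differentiable (by simp) x) (hf.differentiable (by simp) x),
            pd_scale c x (hχ.differentiable (by simp) _)]
          have h5 := hK j (c • x)
          have h6 : (pd χ j (c • x)) ^ 2 ≤ (K j) ^ 2 := by
            rw [← sq_abs]; gcongr
          have h7 : (χ (c • x)) ^ 2 ≤ 1 := by
            have := χ0 (c • x); have := χ1 (c • x); nlinarith
          have h8 : (c * pd χ j (c • x) * f x) ^ 2 ≤ (K j) ^ 2 * (c ^ 2 * f x ^ 2) := by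
            rw [mul_pow, mul_pow]
            have : 0 ≤ c ^ 2 * f x ^ 2 := by positivity
            nlinarith
          have h9 : (χ (c • x) * pd f j x) ^ 2 ≤ (pd f j x) ^ 2 := by
            rw [mul_pow]
            have : 0 ≤ (pd f j x) ^ 2 := by positivity
            nlinarith
          nlinarith [sq_nonneg (c * pd χ j (c • x) * f x - χ (c • x) * pd f j x)]
        · apply Measurable.aemeasurable
          apply Measurable.const_mul
          apply ENNReal.measurable_ofReal.comp
          apply Continuous.measurable
          have := fun j => pd_cont hf j
          fun_prop
  have t1 : Tendsto (fun n : ℕ => ∫⁻ x in ball (0:R3) n, ENNReal.ofReal (|f x| ^ 6)) atTop (nhds (∫⁻ x, ENNReal.ofReal (|f x| ^ 6))) := by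
    apply (aecover_ball (x := (0:R3)) (μ := volume) tendsto_natCast_atTop_atTop).lintegral_tendsto_of_countably_generated
    have := hf.continuous
    apply Measurable.aemeasurable
    apply ENNReal.measurable_ofReal.comp
    fun_prop
  have t2 : Tendsto (fun n : ℕ => ENNReal.ofReal C * (ENNReal.ofReal 2 * G + ENNReal.ofReal (M * ((n:ℝ)⁻¹) ^ 2) * N) ^ 3) atTop
      (nhds (ENNReal.ofReal C * (ENNReal.ofReal 2 * G + ENNReal.ofReal (M * 0 ^ 2) * N) ^ 3)) := by
    have a1 : Tendsto (fun n : ℕ => ((n:ℝ)⁻¹)) atTop (nhds 0) := tendsto_inv_atTop_nhds_zero_nat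
    have a2 := ENNReal.tendsto_ofReal ((a1.pow 2).const_mul M)
    have a3 := ENNReal.Tendsto.mul_const a2 (Or.inr h2)
    have a4 := (a3.const_add (ENNReal.ofReal 2 * G))
    have a5 := ((ENNReal.continuous_pow 3).tendsto _).comp a4
    exact ENNReal.Tendsto.const_mul a5 (Or.inr (by simp))
  have := le_of_tendsto_of_tendsto t1 t2 (by
    filter_upwards [eventually_gt_atTop 0] with n hn using step n hn)
  refine this.trans (le_of_eq ?_)
  rw [ENNReal.ofReal_mul hC]
  simp
  ring

end GNSPart

section PotThm
open scoped ContDiff ENNReal FourierTransform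

lemma abs_add_rpow {p : ℝ} (hp : 0 ≤ p) (a b : ℝ) : |a + b| ^ p ≤ 2 ^ p * (|a| ^ p + |b| ^ p) := by
  have h1 : |a + b| ≤ 2 * max |a| |b| := by
    have := abs_add_le a b
    have := le_max_left |a| |b|
    have := le_max_right |a| |b|
    linarith
  calc |a + b| ^ p ≤ (2 * max |a| |b|) ^ p := by gcongr
    _ = 2 ^ p * (max |a| |b|) ^ p := Real.mul_rpow (by norm_num) (by positivity)
    _ ≤ _ := by
      gcongr
      rcases max_cases |a| |b| with h | h <;> rw [h.1]
      · have : 0 ≤ |b| ^ p := by positivity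
        linarith
      · have : 0 ≤ |a| ^ p := by positivity
        linarith

lemma lint_add_rpow {p : ℝ} (hp : 0 ≤ p) {f g : R3 → ℝ} (hf : Measurable f) (s : Set R3) :
    ∫⁻ x in s, ENNReal.ofReal (|f x + g x| ^ p) ≤ ENNReal.ofReal (2 ^ p) *
      ((∫⁻ x in s, ENNReal.ofReal (|f x| ^ p)) + ∫⁻ x in s, ENNReal.ofReal (|g x| ^ p)) := by
  rw [← lintegral_add_left (by fun_prop), ← lintegral_const_mul' _ _ (by simp)]
  refine lintegral_mono fun x => ?_
  rw [← ENNReal.ofReal_add (by positivity) (by positivity), ← ENNReal.ofReal_mul (by positivity)]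
  exact ENNReal.ofReal_le_ofReal (abs_add_rpow hp _ _)

lemma lint_sub_rpow {p : ℝ} (hp : 0 ≤ p) {f g : R3 → ℝ} (hf : Measurable f) (s : Set R3) :
    ∫⁻ x in s, ENNReal.ofReal (|f x - g x| ^ p) ≤ ENNReal.ofReal (2 ^ p) *
      ((∫⁻ x in s, ENNReal.ofReal (|f x| ^ p)) + ∫⁻ x in s, ENNReal.ofReal (|g x| ^ p)) := by
  have := lint_add_rpow hp (g := fun x => - g x) hf s
  simpa only [abs_neg, ← sub_eq_add_neg] using this

lemma pot_L2 (m : Fin 3) {f : R3 → ℝ} (hf : CcS f) : ∫⁻ x, ENNReal.ofReal (pot m f x ^ 2) ≠ ⊤ := by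
  have := (int_re2 (pa_good m hf)).lintegral_lt_top
  exact this.ne

lemma pot_six : ∃ C : ℝ, 0 ≤ C ∧ ∀ (m : Fin 3) (f : R3 → ℝ), CcS f →
    ∫⁻ x, ENNReal.ofReal (|pot m f x| ^ 6) ≤ ENNReal.ofReal C * (∫⁻ x, ENNReal.ofReal (|f x| ^ 2)) ^ 3 := by
  obtain ⟨C, hC, h⟩ := gns'
  refine ⟨C * 3 ^ 3, by positivity, fun m f hf => ?_⟩
  refine (h _ (pot_C1 m hf) (pot_L2 m hf)).trans ?_
  rw [ENNReal.ofReal_mul hC, mul_assoc]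
  refine mul_le_mul_right ?_ _
  rw [ENNReal.ofReal_pow (by norm_num), ← mul_pow]
  gcongr
  have : ∀ x, ENNReal.ofReal (∑ j, (pd (pot m f) j x) ^ 2) = ∑ j, ENNReal.ofReal (|Trr j m f x| ^ 2) := by
    intro x
    rw [ENNReal.ofReal_sum_of_nonneg (fun _ _ => by positivity)]
    simp only [pot_pd m _ hf, sq_abs]
  rw [lintegral_congr this, lintegral_finsetSum]
  · refine (Finset.sum_le_sum fun j _ => Trr_two j m hf).trans ?_
    simp
  · intro j _
    have := (Trr_cont j m hf).measurable
    fun_prop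

def IsCurl (A F : Fin 3 → R3 → ℝ) (x : R3) : Prop :=
  pd (A 2) 1 x - pd (A 1) 2 x = F 0 x ∧ pd (A 0) 2 x - pd (A 2) 0 x = F 1 x ∧
  pd (A 1) 0 x - pd (A 0) 1 x = F 2 x

def vpot (F : Fin 3 → R3 → ℝ) (l : Fin 3) (x : R3) : ℝ :=
  pot (l + 1) (F (l + 2)) x - pot (l + 2) (F (l + 1)) x

lemma vpot_C1 {F : Fin 3 → R3 → ℝ} (hF : ∀ i, CcS (F i)) (l : Fin 3) : ContDiff ℝ 1 (vpot F l) :=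
  (pot_C1 _ (hF _)).sub (pot_C1 _ (hF _))

lemma vpot_pd {F : Fin 3 → R3 → ℝ} (hF : ∀ i, CcS (F i)) (l k : Fin 3) (x : R3) :
    pd (vpot F l) k x = Trr k (l + 1) (F (l + 2)) x - Trr k (l + 2) (F (l + 1)) x := by
  unfold vpot
  rw [pd_sub ((pot_C1 _ (hF _)).differentiable (by simp) x) ((pot_C1 _ (hF _)).differentiable (by simp) x),
    pot_pd _ _ (hF _), pot_pd _ _ (hF _)]

lemma vpot_curl {F : Fin 3 → R3 → ℝ} (hF : ∀ i, CcS (F i)) (hd : ∀ x, ∑ j, pd (F j) j x = 0) (x : R3) :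
    IsCurl (vpot F) F x := by
  have d0 := Trr_div hF hd 0 x
  have d1 := Trr_div hF hd 1 x
  have d2 := Trr_div hF hd 2 x
  have t0 := Trr_trace (hF 0) x
  have t1 := Trr_trace (hF 1) x
  have t2 := Trr_trace (hF 2) x
  unfold IsCurl
  simp only [vpot_pd hF]
  refine ⟨?_, ?_, ?_⟩
  · show Trr 1 0 (F 1) x - Trr 1 1 (F 0) x - (Trr 2 2 (F 0) x - Trr 2 0 (F 2) x) = F 0 x
    linarith
  · show Trr 2 1 (F 2) x - Trr 2 2 (F 1) x - (Trr 0 0 (F 1) x - Trr 0 1 (F 0) x) = F 1 x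
    linarith
  · show Trr 0 2 (F 0) x - Trr 0 0 (F 2) x - (Trr 1 1 (F 2) x - Trr 1 2 (F 1) x) = F 2 x
    linarith

lemma potential {p : ℝ} (h2 : 2 < p) (h6 : p < 6) : ∃ C : ℝ, 0 ≤ C ∧ ∀ F : Fin 3 → R3 → ℝ, (∀ i, CcS (F i)) →
    (∀ x, ∑ j, pd (F j) j x = 0) → ∃ A : Fin 3 → R3 → ℝ, (∀ l, ContDiff ℝ 1 (A l)) ∧ (∀ x, IsCurl A F x) ∧
    (∀ l k, ∫⁻ x, ENNReal.ofReal (|pd (A l) k x| ^ p) ≤ ENNReal.ofReal C * ∑ n, ∫⁻ x, ENNReal.ofReal (|F n x| ^ p)) ∧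
    (∀ l, ∫⁻ x, ENNReal.ofReal (|A l x| ^ 6) ≤ ENNReal.ofReal C * (∑ n, ∫⁻ x, ENNReal.ofReal (|F n x| ^ 2)) ^ 3) := by
  obtain ⟨D, hD, h⟩ := Trr_p h2 h6
  obtain ⟨C, hC, h'⟩ := pot_six
  refine ⟨2 ^ p * (D + D) + 2 ^ 6 * (C + C), by positivity, fun F hF hd => ⟨vpot F, vpot_C1 hF, vpot_curl hF hd, ?_, ?_⟩⟩
  · intro l k
    simp only [vpot_pd hF]
    have := lint_sub_rpow (p := p) (by linarith) (f := Trr k (l + 1) (F (l + 2))) (g := Trr k (l + 2) (F (l + 1)))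
      (Trr_cont _ _ (hF _)).measurable Set.univ
    simp only [Measure.restrict_univ] at this
    refine this.trans ?_
    have s1 : ∀ m, ∫⁻ x, ENNReal.ofReal (|F m x| ^ p) ≤ ∑ n, ∫⁻ x, ENNReal.ofReal (|F n x| ^ p) := fun m =>
      Finset.single_le_sum (f := fun m => ∫⁻ x, ENNReal.ofReal (|F m x| ^ p)) (fun _ _ => zero_le) (Finset.mem_univ m)
    set S := ∑ n, ∫⁻ x, ENNReal.ofReal (|F n x| ^ p)
    calc _ ≤ ENNReal.ofReal (2 ^ p) * (ENNReal.ofReal D * S + ENNReal.ofReal D * S) := by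
          refine mul_le_mul_right (add_le_add ?_ ?_) _
          · exact (h _ _ _ (hF _)).trans (mul_le_mul_right (s1 _) _)
          · exact (h _ _ _ (hF _)).trans (mul_le_mul_right (s1 _) _)
      _ = ENNReal.ofReal (2 ^ p * (D + D)) * S := by
          rw [ENNReal.ofReal_mul (by positivity), ENNReal.ofReal_add hD hD]; ring
      _ ≤ _ := by
          refine mul_le_mul_left (ENNReal.ofReal_le_ofReal ?_) _
          have : 0 ≤ (2:ℝ) ^ 6 * (C + C) := by positivity
          linarith
  · intro l
    have := lint_sub_rpow (p := ((6:ℕ):ℝ)) (by norm_num) (f := pot (l + 1) (F (l + 2))) (g := pot (l + 2) (F (l + 1)))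
      ((pot_C1 _ (hF _)).continuous.measurable) Set.univ
    simp only [Measure.restrict_univ, Real.rpow_natCast] at this
    refine this.trans ?_
    have s1 : ∀ m, ∫⁻ x, ENNReal.ofReal (|F m x| ^ 2) ≤ ∑ n, ∫⁻ x, ENNReal.ofReal (|F n x| ^ 2) := fun m =>
      Finset.single_le_sum (f := fun m => ∫⁻ x, ENNReal.ofReal (|F m x| ^ 2)) (fun _ _ => zero_le) (Finset.mem_univ m)
    set S := ∑ n, ∫⁻ x, ENNReal.ofReal (|F n x| ^ 2)
    have s2 : ∀ m n, ∫⁻ x, ENNReal.ofReal (|pot m (F n) x| ^ 6) ≤ ENNReal.ofReal C * S ^ 3 := fun m n =>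
      (h' m _ (hF n)).trans (mul_le_mul_right (pow_le_pow_left' (s1 n) 3) _)
    calc _ ≤ ENNReal.ofReal (2 ^ 6) * (ENNReal.ofReal C * S ^ 3 + ENNReal.ofReal C * S ^ 3) :=
          mul_le_mul_right (add_le_add (s2 _ _) (s2 _ _)) _
      _ = ENNReal.ofReal (2 ^ 6 * (C + C)) * S ^ 3 := by
          rw [ENNReal.ofReal_mul (by positivity), ENNReal.ofReal_add hC hC]; ring
      _ ≤ _ := by
          refine mul_le_mul_left (ENNReal.ofReal_le_ofReal ?_) _
          have : 0 ≤ (2:ℝ) ^ p * (D + D) := by positivity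
          linarith
end PotThm

section ParamInt
open scoped ContDiff

lemma param_hasFDerivAt {F : Type} [NormedAddCommGroup F] [NormedSpace ℝ F] [CompleteSpace F]
    {H : R3 × ℝ → F} (hH : ContDiff ℝ 1 H) (a b : ℝ) (x : R3) :
    HasFDerivAt (fun x => ∫ t in a..b, H (x, t))
      (∫ t in a..b, (fderiv ℝ H (x, t)).comp (ContinuousLinearMap.inl ℝ R3 ℝ)) x := by
  have hc : Continuous fun z : R3 × ℝ => (fderiv ℝ H z).comp (ContinuousLinearMap.inl ℝ R3 ℝ) :=
    (hH.continuous_fderiv (by simp)).clm_comp continuous_const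
  obtain ⟨K, hK⟩ := ((isCompact_closedBall x 1).prod (isCompact_uIcc (a := a) (b := b))).exists_bound_of_continuousOn
    hc.continuousOn
  refine intervalIntegral.hasFDerivAt_integral_of_dominated_of_fderiv_le (F := fun x t => H (x, t)) (s := ball x 1)
    (F' := fun x t => (fderiv ℝ H (x, t)).comp (ContinuousLinearMap.inl ℝ R3 ℝ)) (bound := fun _ => K)
    (ball_mem_nhds _ one_pos) ?_ ?_ ?_ ?_ ?_ ?_
  · exact Eventually.of_forall fun y => (hH.continuous.comp (by fun_prop : Continuous fun t : ℝ => (y, t))).aestronglyMeasurable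
  · exact (hH.continuous.comp (by fun_prop : Continuous fun t : ℝ => (x, t))).intervalIntegrable _ _
  · exact (hc.comp (by fun_prop : Continuous fun t : ℝ => (x, t))).aestronglyMeasurable
  · refine Eventually.of_forall fun t ht y hy => hK (y, t) ⟨ball_subset_closedBall hy, Set.uIoc_subset_uIcc ht⟩
  · exact intervalIntegrable_const
  · refine Eventually.of_forall fun t ht y hy => ?_
    have h1 : HasFDerivAt H (fderiv ℝ H (y, t)) (y, t) := (hH.differentiable (by simp) _).hasFDerivAt
    have h2 : HasFDerivAt (fun z : R3 => (z, t)) (ContinuousLinearMap.inl ℝ R3 ℝ) y := by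
      exact hasFDerivAt_prodMk_left y t
    exact h1.comp y h2

lemma param_contDiff_nat (n : ℕ) : ∀ {F : Type} [NormedAddCommGroup F] [NormedSpace ℝ F] [CompleteSpace F]
    {H : R3 × ℝ → F} (hH : ContDiff ℝ ∞ H) (a b : ℝ), ContDiff ℝ n (fun x => ∫ t in a..b, H (x, t)) := by
  induction n with
  | zero =>
    intro F _ _ _ H hH a b
    rw [Nat.cast_zero, contDiff_zero, continuous_iff_continuousAt]
    exact fun x => (param_hasFDerivAt (hH.of_le (by exact_mod_cast le_top)) a b x).continuousAt
  | succ n ih =>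
    intro F _ _ _ H hH a b
    rw [Nat.cast_succ, contDiff_succ_iff_hasFDerivAt]
    refine ⟨fun x => ∫ t in a..b, (fderiv ℝ H (x, t)).comp (ContinuousLinearMap.inl ℝ R3 ℝ), ?_, fun x => ?_⟩
    · exact ih (H := fun z => (fderiv ℝ H z).comp (ContinuousLinearMap.inl ℝ R3 ℝ))
        ((hH.fderiv_right (by simp)).clm_comp contDiff_const) a b
    · exact param_hasFDerivAt (hH.of_le (by exact_mod_cast le_top)) a b x

lemma param_contDiff {F : Type} [NormedAddCommGroup F] [NormedSpace ℝ F] [CompleteSpace F]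
    {H : R3 × ℝ → F} (hH : ContDiff ℝ ∞ H) (a b : ℝ) : ContDiff ℝ ∞ (fun x => ∫ t in a..b, H (x, t)) :=
  contDiff_infty.2 fun n => param_contDiff_nat n hH a b

lemma param_pd {H : R3 × ℝ → ℝ} (hH : ContDiff ℝ ∞ H) (a b : ℝ) (x : R3) (j : Fin 3) :
    pd (fun x => ∫ t in a..b, H (x, t)) j x = ∫ t in a..b, pd (fun y => H (y, t)) j x := by
  unfold pd
  have hH1 : ContDiff ℝ 1 H := hH.of_le (by exact_mod_cast le_top)
  have hc : Continuous fun z : R3 × ℝ => (fderiv ℝ H z).comp (ContinuousLinearMap.inl ℝ R3 ℝ) :=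
    (hH1.continuous_fderiv (by simp)).clm_comp continuous_const
  rw [(param_hasFDerivAt hH1 a b x).fderiv, ContinuousLinearMap.intervalIntegral_apply]
  · refine intervalIntegral.integral_congr fun t _ => ?_
    have h1 : HasFDerivAt H (fderiv ℝ H (x, t)) (x, t) := (hH1.differentiable (by simp) _).hasFDerivAt
    have h2 : HasFDerivAt (fun z : R3 => (z, t)) (ContinuousLinearMap.inl ℝ R3 ℝ) x := hasFDerivAt_prodMk_left x t
    have := (h1.comp x h2).fderiv
    simp only [Function.comp_def] at this
    simp only [this]
  · exact (hc.comp (by fun_prop : Continuous fun t : ℝ => (x, t))).intervalIntegrable _ _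

def ln (j : Fin 3) (x : R3) (t : ℝ) : R3 := x + (t - x j) • EuclideanSpace.single j (1:ℝ)

lemma ln_same (j : Fin 3) (x : R3) (t : ℝ) : ln j x t j = t := by simp [ln]
lemma ln_ne {i j : Fin 3} (h : i ≠ j) (x : R3) (t : ℝ) : ln j x t i = x i := by simp [ln, h]
lemma ln_self (j : Fin 3) (x : R3) : ln j x (x j) = x := by simp [ln]
lemma ln_comm {i j : Fin 3} (h : i ≠ j) (x : R3) (s t : ℝ) : ln i (ln j x s) t = ln j (ln i x t) s := by
  ext k
  by_cases h1 : k = i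
  · subst h1; simp [ln_same, ln_ne h]
  · by_cases h2 : k = j
    · subst h2; simp [ln_same, ln_ne h1]
    · simp [ln_ne h1, ln_ne h2]
lemma ln_ln (j : Fin 3) (x : R3) (s t : ℝ) : ln j (ln j x s) t = ln j x t := by
  unfold ln; simp [add_assoc, ← add_smul]
lemma ln_contDiff (j : Fin 3) : ContDiff ℝ ∞ (fun z : R3 × ℝ => ln j z.1 z.2) := by
  unfold ln; fun_prop

def Jop (a : ℝ) (j : Fin 3) (f : R3 → ℝ) (x : R3) : ℝ := ∫ t in (-a)..a, f (ln j x t)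
def Iop (a : ℝ) (j : Fin 3) (f : R3 → ℝ) (x : R3) : ℝ := ∫ t in (-a)..(x j), f (ln j x t)

def Van (a : ℝ) (f : R3 → ℝ) : Prop := ∀ x, (∃ i, a ≤ |x i|) → f x = 0

lemma Jop_smooth {a : ℝ} {j : Fin 3} {f : R3 → ℝ} (hf : ContDiff ℝ ∞ f) : ContDiff ℝ ∞ (Jop a j f) :=
  param_contDiff (H := fun z => f (ln j z.1 z.2)) (hf.comp (ln_contDiff j)) _ _

lemma Iop_eq {a : ℝ} {j : Fin 3} {f : R3 → ℝ} (x : R3) :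
    Iop a j f x = (x j + a) * ∫ s in (0:ℝ)..1, f (ln j x ((x j + a) * s + -a)) := by
  have := intervalIntegral.smul_integral_comp_mul_add (a := 0) (b := 1) (fun t => f (ln j x t)) (x j + a) (-a)
  simp only [smul_eq_mul] at this
  rw [this, Iop]; congr 1 <;> ring

lemma Iop_smooth {a : ℝ} {j : Fin 3} {f : R3 → ℝ} (hf : ContDiff ℝ ∞ f) : ContDiff ℝ ∞ (Iop a j f) := by
  have : Iop a j f = fun x : R3 => (x j + a) * ∫ s in (0:ℝ)..1, f (ln j x ((x j + a) * s + -a)) := funext Iop_eq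
  rw [this]
  have h1 : ContDiff ℝ ∞ fun x : R3 => x j := by fun_prop
  refine (h1.add contDiff_const).mul ?_
  refine param_contDiff (H := fun z : R3 × ℝ => f (ln j z.1 ((z.1 j + a) * z.2 + -a))) ?_ _ _
  refine hf.comp ((ln_contDiff j).comp (g := fun z : R3 × ℝ => ln j z.1 z.2) (f := fun z : R3 × ℝ => (z.1, (z.1 j + a) * z.2 + -a)) ?_)
  fun_prop

lemma Jop_inv (a : ℝ) (j : Fin 3) (f : R3 → ℝ) (x : R3) (s : ℝ) : Jop a j f (ln j x s) = Jop a j f x := by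
  simp [Jop, ln_ln]

lemma pd_of_line {f : R3 → ℝ} {x : R3} {j : Fin 3} {d : ℝ} (hf : DifferentiableAt ℝ f x)
    (h : HasDerivAt (fun t => f (ln j x t)) d (x j)) : pd f j x = d := by
  have h1 : HasDerivAt (fun t => ln j x t) (EuclideanSpace.single j (1:ℝ)) (x j) := by
    unfold ln
    have := (((hasDerivAt_id (x j)).sub_const (x j)).smul_const (EuclideanSpace.single j (1:ℝ) : R3)).const_add x
    simpa using this
  have hf' : HasFDerivAt f (fderiv ℝ f x) (ln j x (x j)) := by rw [ln_self]; exact hf.hasFDerivAt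
  exact (hf'.comp_hasDerivAt (x j) h1).unique h

lemma Iop_pd {a : ℝ} {j : Fin 3} {f : R3 → ℝ} (hf : ContDiff ℝ ∞ f) (x : R3) : pd (Iop a j f) j x = f x := by
  refine pd_of_line ((Iop_smooth hf).differentiable (by simp) x) ?_
  have e : (fun t => Iop a j f (ln j x t)) = fun t => ∫ s in (-a)..t, f (ln j x s) := by
    funext t; simp [Iop, ln_ln, ln_same]
  rw [e]
  have hc : Continuous fun s => f (ln j x s) := hf.continuous.comp (by unfold ln; fun_prop)
  have := intervalIntegral.integral_hasDerivAt_right (hc.intervalIntegrable (-a) (x j)) (hc.stronglyMeasurableAtFilter _ _) hc.continuousAt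
  rwa [ln_self] at this

lemma Van_line {a : ℝ} {j i : Fin 3} {f : R3 → ℝ} (hf : Van a f) {x : R3} (hi : i ≠ j) (hx : a ≤ |x i|) (t : ℝ) :
    f (ln j x t) = 0 := hf _ ⟨i, by rwa [ln_ne hi]⟩

lemma Iop_Van {a : ℝ} (ha : 0 < a) {j : Fin 3} {f : R3 → ℝ} (hfc : Continuous f) (hf : Van a f) (hJ : ∀ x, Jop a j f x = 0) : Van a (Iop a j f) := by
  rintro x ⟨i, hi⟩
  by_cases h : i = j
  · subst h
    rcases le_abs.1 hi with h | h
    · have hc : Continuous fun s => f (ln i x s) := hfc.comp (by unfold ln; fun_prop)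
      rw [Iop, ← intervalIntegral.integral_add_adjacent_intervals (b := a) (hc.intervalIntegrable _ _) (hc.intervalIntegrable _ _)]
      have h1 := hJ x
      rw [Jop] at h1
      rw [h1, zero_add]
      refine intervalIntegral.integral_zero_ae (Eventually.of_forall fun t ht => ?_)
      rw [Set.uIoc_of_le h] at ht
      exact hf _ ⟨i, by rw [ln_same]; exact ht.1.le.trans (le_abs_self _)⟩
    · rw [Iop]
      refine intervalIntegral.integral_zero_ae (Eventually.of_forall fun t ht => ?_)
      rw [Set.uIoc_of_ge (by linarith)] at ht
      exact hf _ ⟨i, by rw [ln_same]; have := neg_abs_le t; linarith [ht.2, neg_le_abs t]⟩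
  · rw [Iop]
    simp [Van_line hf h hi]

lemma Jop_Van {a : ℝ} {j i : Fin 3} {f : R3 → ℝ} (hf : Van a f) {x : R3} (hi : i ≠ j) (hx : a ≤ |x i|) : Jop a j f x = 0 := by
  rw [Jop]; simp [Van_line hf hi hx]
end ParamInt

section BoxOp
open scoped ContDiff ENNReal

lemma jens {Ω : Type} [MeasurableSpace Ω] {μ : Measure Ω} {p : ℝ} (hp : 1 < p) {F : Ω → ℝ≥0∞} (hF : AEMeasurable F μ) :
    (∫⁻ t, F t ∂μ) ^ p ≤ (μ Set.univ) ^ (p - 1) * ∫⁻ t, F t ^ p ∂μ := by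
  have hpq : p.HolderConjugate (Real.conjExponent p) := Real.HolderConjugate.conjExponent hp
  have h := ENNReal.lintegral_mul_le_Lp_mul_Lq μ hpq hF (aemeasurable_const (b := (1:ℝ≥0∞)))
  simp only [Pi.mul_apply, mul_one, ENNReal.one_rpow, lintegral_const, one_mul] at h
  calc _ ≤ ((∫⁻ t, F t ^ p ∂μ) ^ (1 / p) * (μ Set.univ) ^ (1 / Real.conjExponent p)) ^ p := by
        refine ENNReal.rpow_le_rpow h (by linarith)
    _ = _ := by
        rw [ENNReal.mul_rpow_of_nonneg _ _ (by linarith), ← ENNReal.rpow_mul, ← ENNReal.rpow_mul, mul_comm]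
        have h0 : p ≠ 0 := by linarith
        have h1 : p - 1 ≠ 0 := by linarith
        congr 2
        · unfold Real.conjExponent; field_simp
        · rw [one_div_mul_cancel h0, ENNReal.rpow_one]

lemma line_lp {f : R3 → ℝ} (hf : Continuous f) {p b : ℝ} (hp : 1 < p) (hb : 0 < b) (e : R3) :
    ∫⁻ x, (∫⁻ s in Set.Icc (-b) b, ENNReal.ofReal |f (x + s • e)|) ^ p ≤
      ENNReal.ofReal ((2 * b) ^ p) * ∫⁻ x, ENNReal.ofReal (|f x| ^ p) := by
  have hm : Measurable fun z : R3 × ℝ => ENNReal.ofReal |f (z.1 + z.2 • e)| ^ p := by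
    have : Continuous fun z : R3 × ℝ => |f (z.1 + z.2 • e)| := (hf.comp (by fun_prop)).abs
    exact (this.measurable.ennreal_ofReal).pow_const p
  calc _ ≤ ∫⁻ x, ENNReal.ofReal ((2 * b) ^ (p - 1)) * ∫⁻ s in Set.Icc (-b) b, ENNReal.ofReal |f (x + s • e)| ^ p := by
        refine lintegral_mono fun x => ?_
        have hc : Continuous fun s : ℝ => |f (x + s • e)| := (hf.comp (by fun_prop)).abs
        refine (jens hp (hc.measurable.ennreal_ofReal.aemeasurable)).trans (le_of_eq ?_)
        congr 1
        rw [Measure.restrict_apply_univ, Real.volume_Icc, ENNReal.ofReal_rpow_of_pos (by linarith)]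
        congr 2; ring
    _ = ENNReal.ofReal ((2 * b) ^ (p - 1)) * ∫⁻ x, ∫⁻ s in Set.Icc (-b) b, ENNReal.ofReal |f (x + s • e)| ^ p := by
        rw [lintegral_const_mul' _ _ (by simp)]
    _ = ENNReal.ofReal ((2 * b) ^ (p - 1)) * ∫⁻ s in Set.Icc (-b) b, ∫⁻ x, ENNReal.ofReal |f (x + s • e)| ^ p := by
        rw [lintegral_lintegral_swap]
        exact hm.aemeasurable
    _ = ENNReal.ofReal ((2 * b) ^ (p - 1)) * ∫⁻ s in Set.Icc (-b) b, ∫⁻ x, ENNReal.ofReal (|f x| ^ p) := by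
        congr 1
        refine lintegral_congr fun s => ?_
        rw [lintegral_add_right_eq_self (fun x => ENNReal.ofReal |f x| ^ p)]
        refine lintegral_congr fun x => ?_
        rw [ENNReal.ofReal_rpow_of_nonneg (abs_nonneg _) (by linarith)]
    _ = _ := by
        rw [lintegral_const, Measure.restrict_apply_univ, Real.volume_Icc, mul_comm (∫⁻ x, _), ← mul_assoc,
          ← ENNReal.ofReal_mul (by positivity)]
        congr 2
        rw [show b - -b = (2 * b) ^ (1:ℝ) by rw [Real.rpow_one]; ring, ← Real.rpow_add (by linarith)]
        congr 1; ring

lemma Jop_lp {a : ℝ} (ha : 0 < a) {p : ℝ} (hp : 1 < p) {j : Fin 3} {f : R3 → ℝ} (hf : Continuous f) {k : R3 → ℝ} {M : ℝ} (hM : 0 ≤ M)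
    (hk : ∀ x, |x j| < a → |k x| ≤ M * Jop a j (fun y => |f y|) x) (hk0 : ∀ x, a ≤ |x j| → k x = 0) :
    ∫⁻ x, ENNReal.ofReal (|k x| ^ p) ≤ ENNReal.ofReal (M ^ p * (4 * a) ^ p) * ∫⁻ x, ENNReal.ofReal (|f x| ^ p) := by
  have key : ∀ x, ENNReal.ofReal (|k x| ^ p) ≤ ENNReal.ofReal (M ^ p) * (∫⁻ s in Set.Icc (-(2 * a)) (2 * a), ENNReal.ofReal |f (x + s • EuclideanSpace.single j (1:ℝ))|) ^ p := by
    intro x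
    by_cases h : |x j| < a
    · have hc : Continuous fun s : ℝ => |f (x + s • EuclideanSpace.single j (1:ℝ))| := (hf.comp (by fun_prop)).abs
      have hI : IntegrableOn (fun s : ℝ => |f (x + s • EuclideanSpace.single j (1:ℝ))|) (Set.Icc (-(2 * a)) (2 * a)) :=
        hc.continuousOn.integrableOn_Icc
      have h1 : Jop a j (fun y => |f y|) x ≤ ∫ s in Set.Icc (-(2 * a)) (2 * a), |f (x + s • EuclideanSpace.single j (1:ℝ))| := by
        have e1 : Jop a j (fun y => |f y|) x = ∫ s in (-a - x j)..(a - x j), |f (x + s • EuclideanSpace.single j (1:ℝ))| := by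
          rw [← intervalIntegral.integral_comp_sub_right (fun s => |f (x + s • EuclideanSpace.single j (1:ℝ))|) (x j)]
          rfl
        rw [e1, intervalIntegral.integral_of_le (by linarith)]
        refine setIntegral_mono_set hI (Eventually.of_forall fun s => abs_nonneg _) ?_
        refine Eventually.of_forall ?_
        intro s hs
        have := abs_lt.1 h
        exact ⟨by linarith [hs.1], by linarith [hs.2]⟩
      rw [← ofReal_integral_eq_lintegral_ofReal hI (Eventually.of_forall fun s => abs_nonneg _),
        ENNReal.ofReal_rpow_of_nonneg (integral_nonneg fun s => abs_nonneg _) (by linarith),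
        ← ENNReal.ofReal_mul (by positivity), ← Real.mul_rpow hM (integral_nonneg fun s => abs_nonneg _)]
      refine ENNReal.ofReal_le_ofReal (Real.rpow_le_rpow (abs_nonneg _) ?_ (by linarith))
      exact (hk x h).trans (mul_le_mul_of_nonneg_left h1 hM)
    · rw [hk0 x (not_lt.1 h), abs_zero, Real.zero_rpow (by linarith)]; simp
  calc _ ≤ _ := lintegral_mono key
    _ = ENNReal.ofReal (M ^ p) * ∫⁻ x, (∫⁻ s in Set.Icc (-(2 * a)) (2 * a), ENNReal.ofReal |f (x + s • EuclideanSpace.single j (1:ℝ))|) ^ p := by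
        rw [lintegral_const_mul' _ _ (by simp)]
    _ ≤ ENNReal.ofReal (M ^ p) * (ENNReal.ofReal ((2 * (2 * a)) ^ p) * ∫⁻ x, ENNReal.ofReal (|f x| ^ p)) :=
        mul_le_mul_right (line_lp hf hp (by linarith) _) _
    _ = _ := by
        rw [← mul_assoc, ← ENNReal.ofReal_mul (by positivity)]
        congr 4; ring

lemma int_pd_zero {f : R3 → ℝ} (hf : ContDiff ℝ 1 f) (hs : HasCompactSupport f) (j : Fin 3) : ∫ x, pd f j x = 0 := by
  obtain ⟨r, hr⟩ := hs.isCompact.isBounded.subset_closedBall 0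
  obtain ⟨χ, hχ, hχs, χ0, χ1, χone, χz⟩ := cutoff (a := |r| + 2) (b := |r| + 3) (by positivity) (by linarith)
  have hone : ∀ x, ‖x‖ < |r| + 2 → ∀ᶠ y in nhds x, χ y = 1 := by
    intro x hx
    filter_upwards [(isOpen_lt continuous_norm continuous_const).mem_nhds hx] with y hy using χone y (le_of_lt hy)
  have hz : ∀ x, |r| + 1 ≤ ‖x‖ → pd f j x = 0 ∧ f x = 0 := by
    intro x hx
    have hx' : x ∉ tsupport f := fun h => by
      have := hr h
      rw [mem_closedBall_zero_iff] at this
      linarith [le_abs_self r]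
    refine ⟨?_, image_eq_zero_of_notMem_tsupport hx'⟩
    refine pd_eq_zero (c := 0) ?_ j
    have := notMem_tsupport_iff_eventuallyEq.1 hx'
    exact this
  have h := integral_mul_fderiv_eq_neg_fderiv_mul_of_integrable (μ := (volume : Measure R3)) (f := χ) (g := f) (v := EuclideanSpace.single j (1:ℝ)) (𝕜 := ℝ) ?_ ?_ ?_ ?_ ?_
  · have e1 : ∀ x, χ x * fderiv ℝ f x (EuclideanSpace.single j 1) = pd f j x := by
      intro x
      change χ x * pd f j x = _
      by_cases hx : |r| + 1 ≤ ‖x‖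
      · rw [(hz x hx).1, mul_zero]
      · rw [χone x (by linarith), one_mul]
    have e2 : ∀ x, fderiv ℝ χ x (EuclideanSpace.single j 1) * f x = 0 := by
      intro x
      change pd χ j x * f x = _
      by_cases hx : |r| + 1 ≤ ‖x‖
      · rw [(hz x hx).2, mul_zero]
      · rw [pd_eq_zero (hone x (by linarith)), zero_mul]
    simp only [e1, e2] at h
    simpa using h
  · exact Continuous.integrable_of_hasCompactSupport (((pd_contDiff hχ j).continuous).mul hf.continuous) hs.mul_left
  · exact Continuous.integrable_of_hasCompactSupport (hχ.continuous.mul (pd_cont hf j)) hχs.mul_right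
  · exact Continuous.integrable_of_hasCompactSupport (hχ.continuous.mul hf.continuous) hχs.mul_right
  · exact fun x _ => hχ.differentiable (by simp) x
  · exact fun x _ => hf.differentiable (by simp) x

end BoxOp

section BoxThm
open scoped ContDiff ENNReal

lemma ln_cont (j : Fin 3) (x : R3) : Continuous fun t => ln j x t := by unfold ln; fun_prop

lemma norm_le_sum (x : R3) : ‖x‖ ≤ ∑ i, |x i| := by
  have e : x = ∑ j, x j • (EuclideanSpace.single j (1:ℝ) : R3) := by
    ext i
    simp [Finset.sum_apply, Pi.single_apply]
  conv_lhs => rw [e]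
  refine (norm_sum_le _ _).trans (Finset.sum_le_sum fun j _ => ?_)
  rw [norm_smul]; simp

lemma Van_cs {a : ℝ} {f : R3 → ℝ} (hf : Van a f) : HasCompactSupport f := by
  refine HasCompactSupport.of_support_subset_isCompact (isCompact_closedBall 0 (3 * a)) fun x hx => ?_
  rw [mem_closedBall_zero_iff]
  have : ∀ i, |x i| < a := fun i => by
    by_contra h
    exact hx (hf x ⟨i, not_lt.1 h⟩)
  refine (norm_le_sum x).trans ?_
  rw [Fin.sum_univ_three]
  linarith [this 0, this 1, this 2]

structure Wt (a M : ℝ) (η : ℝ → ℝ) : Prop where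
  sm : ContDiff ℝ ∞ η
  nn : ∀ t, 0 ≤ η t
  le : ∀ t, η t ≤ M
  z : ∀ t, a ≤ |t| → η t = 0
  one : ∫ t in (-a)..a, η t = 1
  pos : 0 < η 0
  M0 : 0 ≤ M

lemma exists_Wt {a : ℝ} (ha : 0 < a) : ∃ M η, Wt a M η := by
  let B : ContDiffBump (0:ℝ) := ⟨a / 2, a, by linarith, by linarith⟩
  have hs : ∀ t, a ≤ |t| → B.normed volume t = 0 := by
    intro t ht
    have : t ∉ Function.support (B.normed volume) := by
      rw [B.support_normed_eq]
      simpa [B] using ht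
    simpa using this
  obtain ⟨K, hK⟩ := (B.hasCompactSupport_normed (μ := volume)).exists_bound_of_continuous (B.continuous_normed)
  refine ⟨K, B.normed volume, B.contDiff_normed, fun t => B.nonneg_normed t, fun t => (le_abs_self _).trans (hK t), hs, ?_, ?_, (norm_nonneg _).trans (hK 0)⟩
  · rw [← B.integral_normed (μ := volume), intervalIntegral.integral_of_le (by linarith)]
    refine setIntegral_eq_integral_of_forall_compl_eq_zero fun t ht => hs t ?_
    by_contra h
    have := abs_lt.1 (not_le.1 h)
    exact ht ⟨this.1, this.2.le⟩
  · have : (0:ℝ) ∈ Function.support (B.normed volume) := by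
      rw [B.support_normed_eq]; simpa [B] using ha
    exact lt_of_le_of_ne (B.nonneg_normed 0) (Ne.symm this)

def Pop (η : ℝ → ℝ) (a : ℝ) (j : Fin 3) (f : R3 → ℝ) (x : R3) : ℝ := η (x j) * Jop a j f x

variable {a M : ℝ} {η : ℝ → ℝ}

lemma Pop_smooth (hη : Wt a M η) {j : Fin 3} {f : R3 → ℝ} (hf : ContDiff ℝ ∞ f) : ContDiff ℝ ∞ (Pop η a j f) :=
  (hη.sm.comp (by fun_prop : ContDiff ℝ ∞ fun x : R3 => x j)).mul (Jop_smooth hf)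

lemma Pop_Van (hη : Wt a M η) {j : Fin 3} {f : R3 → ℝ} (hf : Van a f) : Van a (Pop η a j f) := by
  rintro x ⟨i, hi⟩
  by_cases h : i = j
  · subst h; rw [Pop, hη.z _ hi, zero_mul]
  · rw [Pop, Jop_Van hf h hi, mul_zero]

lemma Jop_Pop (hη : Wt a M η) {j : Fin 3} (f : R3 → ℝ) (x : R3) : Jop a j (Pop η a j f) x = Jop a j f x := by
  have : ∀ t, Pop η a j f (ln j x t) = η t * Jop a j f x := fun t => by rw [Pop, ln_same, Jop_inv]
  rw [Jop]; simp only [this]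
  rw [intervalIntegral.integral_mul_const, hη.one, one_mul]

lemma Jop_sub {j : Fin 3} {f g : R3 → ℝ} (hf : Continuous f) (hg : Continuous g) (x : R3) :
    Jop a j (fun y => f y - g y) x = Jop a j f x - Jop a j g x :=
  intervalIntegral.integral_sub ((hf.comp (ln_cont j x)).intervalIntegrable _ _) ((hg.comp (ln_cont j x)).intervalIntegrable _ _)

lemma abs_Jop_le (ha : 0 < a) {j : Fin 3} {f : R3 → ℝ} (x : R3) :
    |Jop a j f x| ≤ Jop a j (fun y => |f y|) x :=
  intervalIntegral.abs_integral_le_integral_abs (by linarith)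

lemma Jop_abs_Pop (ha : 0 < a) (hη : Wt a M η) {j : Fin 3} (f : R3 → ℝ) (x : R3) :
    Jop a j (fun y => |Pop η a j f y|) x ≤ Jop a j (fun y => |f y|) x := by
  have : ∀ t, |Pop η a j f (ln j x t)| = η t * |Jop a j f x| := fun t => by
    rw [Pop, ln_same, Jop_inv, abs_mul, abs_of_nonneg (hη.nn t)]
  have e : Jop a j (fun y => |Pop η a j f y|) x = |Jop a j f x| := by
    rw [Jop]; simp only [this]
    rw [intervalIntegral.integral_mul_const, hη.one, one_mul]
  rw [e]; exact abs_Jop_le ha x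

lemma box_step (ha : 0 < a) (hη : Wt a M η) {p : ℝ} (hp : 1 < p) (j : Fin 3) {f : R3 → ℝ} (hf : ContDiff ℝ ∞ f) (hV : Van a f) :
    ContDiff ℝ ∞ (Iop a j (fun y => f y - Pop η a j f y)) ∧ Van a (Iop a j (fun y => f y - Pop η a j f y)) ∧
    (∀ x, pd (Iop a j (fun y => f y - Pop η a j f y)) j x = f x - Pop η a j f x) ∧
    ∫⁻ x, ENNReal.ofReal (|Iop a j (fun y => f y - Pop η a j f y) x| ^ p) ≤ ENNReal.ofReal (2 ^ p * (4 * a) ^ p) * ∫⁻ x, ENNReal.ofReal (|f x| ^ p) ∧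
    ∫⁻ x, ENNReal.ofReal (|Pop η a j f x| ^ p) ≤ ENNReal.ofReal (M ^ p * (4 * a) ^ p) * ∫⁻ x, ENNReal.ofReal (|f x| ^ p) := by
  have hP := Pop_smooth hη (j := j) hf
  have hg : ContDiff ℝ ∞ (fun y => f y - Pop η a j f y) := hf.sub hP
  have hgV : Van a (fun y => f y - Pop η a j f y) := fun x hx => by
    simp only [hV x hx, Pop_Van hη hV x hx, sub_zero]
  have hV2 : Van a (Iop a j (fun y => f y - Pop η a j f y)) := by
    refine Iop_Van ha hg.continuous hgV fun x => ?_
    rw [Jop_sub hf.continuous hP.continuous, Jop_Pop hη, sub_self]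
  refine ⟨Iop_smooth hg, hV2, fun x => Iop_pd hg x, ?_, ?_⟩
  · refine Jop_lp ha hp hf.continuous (j := j) (by norm_num) (fun x hx => ?_) (fun x hx => hV2 x ⟨j, hx⟩)
    have hx' := abs_lt.1 hx
    have i1 : ∀ {h : R3 → ℝ}, Continuous h → IntervalIntegrable (fun t => |h (ln j x t)|) volume (-a) a := fun hh =>
      ((hh.comp (ln_cont j x)).abs).intervalIntegrable _ _
    calc |Iop a j (fun y => f y - Pop η a j f y) x| ≤ ∫ t in (-a)..(x j), |f (ln j x t) - Pop η a j f (ln j x t)| :=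
          intervalIntegral.abs_integral_le_integral_abs (by linarith)
      _ ≤ ∫ t in (-a)..a, |f (ln j x t) - Pop η a j f (ln j x t)| := by
          refine intervalIntegral.integral_mono_interval le_rfl (by linarith) (by linarith) (Eventually.of_forall fun t => abs_nonneg _) (i1 hg.continuous)
      _ ≤ ∫ t in (-a)..a, (|f (ln j x t)| + |Pop η a j f (ln j x t)|) := by
          refine intervalIntegral.integral_mono_on (by linarith) (i1 hg.continuous) ((i1 hf.continuous).add (i1 hP.continuous)) fun t _ => abs_sub _ _
      _ = Jop a j (fun y => |f y|) x + Jop a j (fun y => |Pop η a j f y|) x :=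
          intervalIntegral.integral_add (i1 hf.continuous) (i1 hP.continuous)
      _ ≤ _ := by linarith [Jop_abs_Pop ha hη (j := j) f x]
  · refine Jop_lp ha hp hf.continuous (j := j) hη.M0 (fun x hx => ?_) (fun x hx => by rw [Pop, hη.z _ hx, zero_mul])
    rw [Pop, abs_mul, abs_of_nonneg (hη.nn _)]
    exact mul_le_mul (hη.le _) (abs_Jop_le ha x) (abs_nonneg _) hη.M0

lemma Jop_inv_ne {i j : Fin 3} (h : i ≠ j) {f : R3 → ℝ} (hf : ∀ x s, f (ln i x s) = f x) (x : R3) (s : ℝ) :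
    Jop a j f (ln i x s) = Jop a j f x := by
  unfold Jop
  refine intervalIntegral.integral_congr fun t _ => ?_
  rw [ln_comm h.symm, hf]

lemma Jop_mul_ne {i j : Fin 3} (h : i ≠ j) (f : R3 → ℝ) (x : R3) :
    Jop a j (fun y => η (y i) * f y) x = η (x i) * Jop a j f x := by
  unfold Jop
  simp only [ln_ne h]
  rw [intervalIntegral.integral_const_mul]

lemma g3_eq (f : R3 → ℝ) : ∃ c, ∀ x, Pop η a 2 (Pop η a 1 (Pop η a 0 f)) x = η (x 0) * η (x 1) * η (x 2) * c := by
  refine ⟨Jop a 2 (Jop a 1 (Jop a 0 f)) 0, fun x => ?_⟩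
  have e1 : ∀ x, Jop a 1 (Pop η a 0 f) x = η (x 0) * Jop a 1 (Jop a 0 f) x := fun x =>
    Jop_mul_ne (by decide) _ x
  have e2 : Pop η a 1 (Pop η a 0 f) = fun x => η (x 1) * (η (x 0) * Jop a 1 (Jop a 0 f) x) := by
    funext x; rw [Pop, e1]
  have e3 : ∀ x, Jop a 2 (Pop η a 1 (Pop η a 0 f)) x = η (x 1) * (η (x 0) * Jop a 2 (Jop a 1 (Jop a 0 f)) x) := by
    intro x
    rw [e2, Jop_mul_ne (by decide), Jop_mul_ne (by decide)]
  rw [Pop, e3]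
  have inv0 : ∀ x s, Jop a 2 (Jop a 1 (Jop a 0 f)) (ln 0 x s) = Jop a 2 (Jop a 1 (Jop a 0 f)) x :=
    Jop_inv_ne (by decide) (Jop_inv_ne (by decide) (Jop_inv a 0 f))
  have inv1 : ∀ x s, Jop a 2 (Jop a 1 (Jop a 0 f)) (ln 1 x s) = Jop a 2 (Jop a 1 (Jop a 0 f)) x :=
    Jop_inv_ne (by decide) (Jop_inv a 1 _)
  have inv2 := Jop_inv a 2 (Jop a 1 (Jop a 0 f))
  have hx : ln 0 (ln 1 (ln 2 x 0) 0) 0 = 0 := by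
    ext i; fin_cases i <;> simp [ln]
  have : Jop a 2 (Jop a 1 (Jop a 0 f)) x = Jop a 2 (Jop a 1 (Jop a 0 f)) 0 := by
    rw [← hx, inv0, inv1, inv2]
  rw [this]; ring

lemma box_op (ha : 0 < a) {p : ℝ} (hp : 1 < p) : ∃ C : ℝ, 0 ≤ C ∧ ∀ f : R3 → ℝ, ContDiff ℝ ∞ f → Van a f → ∫ x, f x = 0 →
    ∃ w : Fin 3 → R3 → ℝ, (∀ i, ContDiff ℝ ∞ (w i)) ∧ (∀ i, Van a (w i)) ∧ (∀ x, ∑ j, pd (w j) j x = f x) ∧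
      ∀ i, ∫⁻ x, ENNReal.ofReal (|w i x| ^ p) ≤ ENNReal.ofReal C * ∫⁻ x, ENNReal.ofReal (|f x| ^ p) := by
  obtain ⟨M, η, hη⟩ := exists_Wt ha
  set D := 2 ^ p * (4 * a) ^ p with hD
  set E := M ^ p * (4 * a) ^ p with hE
  have hM := hη.M0
  have D0 : 0 ≤ D := by positivity
  have E0 : 0 ≤ E := by positivity
  refine ⟨D + D * E + D * E * E, by positivity, fun f hf hV h0 => ?_⟩
  obtain ⟨s0, v0, d0, b0, c0⟩ := box_step ha hη hp 0 hf hV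
  obtain ⟨s1, v1, d1, b1, c1⟩ := box_step ha hη hp 1 (Pop_smooth hη (j := 0) hf) (Pop_Van hη (j := 0) hV)
  obtain ⟨s2, v2, d2, b2, c2⟩ := box_step ha hη hp 2 (Pop_smooth hη (j := 1) (Pop_smooth hη (j := 0) hf)) (Pop_Van hη (j := 1) (Pop_Van hη (j := 0) hV))
  set f1 := Pop η a 0 f
  set f2 := Pop η a 1 f1
  set w0 := Iop a 0 (fun y => f y - f1 y)
  set w1 := Iop a 1 (fun y => f1 y - f2 y)
  set w2 := Iop a 2 (fun y => f2 y - Pop η a 2 f2 y)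
  obtain ⟨c, hc⟩ := g3_eq (η := η) (a := a) f
  have hc' : ∀ x, Pop η a 2 f2 x = η (x 0) * η (x 1) * η (x 2) * c := hc
  have hcz : c = 0 := by
    have hηc : Continuous fun x : R3 => η (x 0) * η (x 1) * η (x 2) := by
      have := hη.sm.continuous
      fun_prop
    have hηV : Van a fun x : R3 => η (x 0) * η (x 1) * η (x 2) := by
      rintro x ⟨i, hi⟩
      have := hη.z _ hi
      fin_cases i <;> simp_all
    have hpos : 0 < ∫ x : R3, η (x 0) * η (x 1) * η (x 2) := by
      refine hηc.integral_pos_of_hasCompactSupport_nonneg_nonzero (x := 0) (Van_cs hηV) (fun x => ?_) ?_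
      · have := hη.nn; exact mul_nonneg (mul_nonneg (this _) (this _)) (this _)
      · have := hη.pos; simp; exact this.ne'
    have hi : ∀ {w : R3 → ℝ} (hw : ContDiff ℝ ∞ w) (hv : Van a w) (j), Integrable (pd w j) := fun hw hv j =>
      (pd_contDiff hw j).continuous.integrable_of_hasCompactSupport (pd_cs (Van_cs hv) j)
    have e : ∀ x, f x = pd w0 0 x + pd w1 1 x + pd w2 2 x + η (x 0) * η (x 1) * η (x 2) * c := by
      intro x; rw [d0, d1, d2, ← hc']; ring
    have hgi : Integrable (fun x : R3 => η (x 0) * η (x 1) * η (x 2) * c) := (hηc.integrable_of_hasCompactSupport (Van_cs hηV)).mul_const c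
    have : ∫ x, f x = (∫ x, pd w0 0 x) + (∫ x, pd w1 1 x) + (∫ x, pd w2 2 x) + ∫ x : R3, η (x 0) * η (x 1) * η (x 2) * c := by
      have a1 := integral_add (((hi s0 v0 0).add (hi s1 v1 1)).add (hi s2 v2 2)) hgi
      have a2 := integral_add ((hi s0 v0 0).add (hi s1 v1 1)) (hi s2 v2 2)
      have a3 := integral_add (hi s0 v0 0) (hi s1 v1 1)
      simp only [Pi.add_apply] at a1 a2 a3
      rw [← a3, ← a2, ← a1]
      exact integral_congr_ae (Eventually.of_forall e)
    have l : ∀ {w : R3 → ℝ} (hw : ContDiff ℝ ∞ w) (hv : Van a w) (j), ∫ x, pd w j x = 0 := fun hw hv j =>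
      int_pd_zero (hw.of_le (by exact_mod_cast le_top)) (Van_cs hv) j
    rw [h0, l s0 v0, l s1 v1, l s2 v2, integral_mul_const] at this
    have h3 : (∫ x : R3, η (x 0) * η (x 1) * η (x 2)) * c = 0 := by linarith
    exact (mul_eq_zero.1 h3).resolve_left hpos.ne'
  refine ⟨![w0, w1, w2], ?_, ?_, ?_, ?_⟩
  · intro i; fin_cases i
    exacts [s0, s1, s2]
  · intro i; fin_cases i
    exacts [v0, v1, v2]
  · intro x
    rw [Fin.sum_univ_three]
    change pd w0 0 x + pd w1 1 x + pd w2 2 x = f x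
    rw [d0, d1, d2, hc', hcz]; ring
  · have k1 : ∀ K, K ≤ D + D * E + D * E * E → ENNReal.ofReal K * ∫⁻ x, ENNReal.ofReal (|f x| ^ p) ≤ ENNReal.ofReal (D + D * E + D * E * E) * ∫⁻ x, ENNReal.ofReal (|f x| ^ p) :=
      fun K hK => mul_le_mul_left (ENNReal.ofReal_le_ofReal hK) _
    have p1 : 0 ≤ D * E := by positivity
    have p2 : 0 ≤ D * E * E := by positivity
    intro i; fin_cases i
    · exact b0.trans (k1 D (by linarith))
    · refine (b1.trans (mul_le_mul_right c0 _)).trans ?_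
      rw [← mul_assoc, ← ENNReal.ofReal_mul D0]
      exact k1 _ (by linarith)
    · refine (b2.trans (mul_le_mul_right (c1.trans (mul_le_mul_right c0 _)) _)).trans ?_
      rw [← mul_assoc, ← mul_assoc, ← ENNReal.ofReal_mul D0, ← ENNReal.ofReal_mul p1]
      exact k1 _ (by linarith)
end BoxThm

section Poinc
open scoped ContDiff ENNReal

lemma lp_dom {ι : Type} [Fintype ι] {p : ℝ} (hp : 1 ≤ p) {s : Set R3} (hs : MeasurableSet s) {g : R3 → ℝ} {h : ι → R3 → ℝ}
    (hm : ∀ n, Measurable (h n)) {K c : ℝ} (hK : 0 ≤ K) (hc : 0 ≤ c) {S : ℝ≥0∞}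
    (hg : ∀ x ∈ s, |g x| ≤ K * ∑ n, |h n x|) (hb : ∀ n, ∫⁻ x in s, ENNReal.ofReal (|h n x| ^ p) ≤ ENNReal.ofReal c * S) :
    ∫⁻ x in s, ENNReal.ofReal (|g x| ^ p) ≤ ENNReal.ofReal (K ^ p * (Fintype.card ι) ^ p * c) * S := by
  have key : ∀ x ∈ s, ENNReal.ofReal (|g x| ^ p) ≤ ENNReal.ofReal (K ^ p * (Fintype.card ι : ℝ) ^ (p - 1)) * ∑ n, ENNReal.ofReal (|h n x| ^ p) := by
    intro x hx
    rw [← ENNReal.ofReal_sum_of_nonneg (fun n _ => by positivity), ← ENNReal.ofReal_mul (by positivity)]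
    refine ENNReal.ofReal_le_ofReal ?_
    calc |g x| ^ p ≤ (K * ∑ n, |h n x|) ^ p := Real.rpow_le_rpow (abs_nonneg _) (hg x hx) (by linarith)
      _ = K ^ p * (∑ n, |h n x|) ^ p := Real.mul_rpow hK (Finset.sum_nonneg fun _ _ => abs_nonneg _)
      _ ≤ K ^ p * ((Fintype.card ι : ℝ) ^ (p - 1) * ∑ n, |h n x| ^ p) := by
          have := Real.rpow_sum_le_const_mul_sum_rpow (Finset.univ) (fun n => h n x) hp
          rw [Finset.card_univ] at this
          exact mul_le_mul_of_nonneg_left this (by positivity)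
      _ = _ := by ring
  calc _ ≤ ∫⁻ x in s, ENNReal.ofReal (K ^ p * (Fintype.card ι : ℝ) ^ (p - 1)) * ∑ n, ENNReal.ofReal (|h n x| ^ p) := setLIntegral_mono' hs key
    _ = ENNReal.ofReal (K ^ p * (Fintype.card ι : ℝ) ^ (p - 1)) * ∑ n, ∫⁻ x in s, ENNReal.ofReal (|h n x| ^ p) := by
        rw [lintegral_const_mul' _ _ (by simp), lintegral_finsetSum]
        exact fun n _ => ((hm n).abs.pow_const p).ennreal_ofReal
    _ ≤ ENNReal.ofReal (K ^ p * (Fintype.card ι : ℝ) ^ (p - 1)) * ∑ n : ι, ENNReal.ofReal c * S :=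
        mul_le_mul_right (Finset.sum_le_sum fun n _ => hb n) _
    _ = _ := by
        rw [Finset.sum_const, Finset.card_univ, nsmul_eq_mul, ← mul_assoc, ← mul_assoc,
          show ((Fintype.card ι : ℕ) : ℝ≥0∞) = ENNReal.ofReal (Fintype.card ι : ℝ) by simp, ← ENNReal.ofReal_mul (by positivity), ← ENNReal.ofReal_mul (by positivity)]
        congr 2
        have : ((Fintype.card ι : ℝ)) ^ (p - 1) * (Fintype.card ι : ℝ) = (Fintype.card ι : ℝ) ^ p := by
          rcases Nat.eq_zero_or_pos (Fintype.card ι) with h0 | h0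
          · rw [h0]; simp; rw [Real.zero_rpow (by linarith)]
          · have : (0:ℝ) < Fintype.card ι := by exact_mod_cast h0
            conv_lhs => rw [← Real.rpow_one ((Fintype.card ι : ℝ)), ← Real.rpow_mul this.le, ← Real.rpow_add this]
            congr 1; ring
        rw [← this]; ring

def Hp (u : Fin 3 → R3 → ℝ) (l : Fin 3) (z : R3 × ℝ) : ℝ :=
  z.2 * (u (l + 1) (z.2 • z.1) * z.1 (l + 2) - u (l + 2) (z.2 • z.1) * z.1 (l + 1))

def Apo (u : Fin 3 → R3 → ℝ) (l : Fin 3) (x : R3) : ℝ := ∫ t in (0:ℝ)..1, Hp u l (x, t)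

lemma Hp_smooth {u : Fin 3 → R3 → ℝ} (hu : ∀ i, ContDiff ℝ ∞ (u i)) (l : Fin 3) : ContDiff ℝ ∞ (Hp u l) := by
  unfold Hp
  have h : ∀ i, ContDiff ℝ ∞ fun z : R3 × ℝ => u i (z.2 • z.1) := fun i => (hu i).comp (by fun_prop)
  have h' : ∀ i, ContDiff ℝ ∞ fun z : R3 × ℝ => z.1 i := fun i => by fun_prop
  exact contDiff_snd.mul (((h _).mul (h' _)).sub ((h _).mul (h' _)))

lemma Apo_smooth {u : Fin 3 → R3 → ℝ} (hu : ∀ i, ContDiff ℝ ∞ (u i)) (l : Fin 3) : ContDiff ℝ ∞ (Apo u l) :=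
  param_contDiff (Hp_smooth hu l) _ _

lemma pd_coord (i k : Fin 3) (x : R3) : pd (fun y : R3 => y i) k x = if i = k then 1 else 0 := by
  unfold pd
  have : (fun y : R3 => y i) = (EuclideanSpace.proj i : R3 →L[ℝ] ℝ) := rfl
  rw [this, ContinuousLinearMap.fderiv]
  simp [Pi.single_apply]

lemma Hp_pd {u : Fin 3 → R3 → ℝ} (hu : ∀ i, ContDiff ℝ ∞ (u i)) (l k : Fin 3) (t : ℝ) (x : R3) :
    pd (fun y => Hp u l (y, t)) k x = t * (t * pd (u (l + 1)) k (t • x) * x (l + 2) + u (l + 1) (t • x) * (if l + 2 = k then 1 else 0)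
      - (t * pd (u (l + 2)) k (t • x) * x (l + 1) + u (l + 2) (t • x) * (if l + 1 = k then 1 else 0))) := by
  unfold Hp
  have d1 : ∀ i, DifferentiableAt ℝ (u i) (t • x) := fun i => (hu i).differentiable (by simp) _
  have d2 : ∀ i, DifferentiableAt ℝ (fun y : R3 => u i (t • y)) x := fun i =>
    ((hu i).comp (by fun_prop : ContDiff ℝ ∞ fun y : R3 => t • y)).differentiable (by simp) x
  have d3 : ∀ i, DifferentiableAt ℝ (fun y : R3 => y i) x := fun i => by fun_prop
  simp only
  rw [pd_const_mul t (((d2 _).fun_mul (d3 _)).fun_sub ((d2 _).fun_mul (d3 _))), pd_sub ((d2 _).fun_mul (d3 _)) ((d2 _).fun_mul (d3 _)),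
    pd_mul (d2 _) (d3 _), pd_mul (d2 _) (d3 _), pd_scale t x (d1 _), pd_scale t x (d1 _), pd_coord, pd_coord]

lemma sum_pd_coord {f : R3 → ℝ} {x y : R3} (hf : DifferentiableAt ℝ f x) : fderiv ℝ f x y = ∑ k, pd f k x * y k := by
  have e : y = ∑ j, y j • (EuclideanSpace.single j (1:ℝ) : R3) := by
    ext i
    simp [Finset.sum_apply, Pi.single_apply]
  conv_lhs => rw [e]
  rw [map_sum]
  refine Finset.sum_congr rfl fun k _ => ?_
  rw [map_smul, smul_eq_mul, mul_comm]; rfl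

lemma Apo_curl_aux {u : Fin 3 → R3 → ℝ} (hu : ∀ i, ContDiff ℝ ∞ (u i)) (m k l : Fin 3) (x : R3)
    (h : ∀ t, pd (fun y => Hp u l (y, t)) k x - pd (fun y => Hp u k (y, t)) l x = 2 * t * u m (t • x) + t ^ 2 * ∑ k, pd (u m) k (t • x) * x k) :
    pd (Apo u l) k x - pd (Apo u k) l x = u m x := by
  have hc : ∀ l k, Continuous fun t => pd (fun y => Hp u l (y, t)) k x := by
    intro l k
    simp only [Hp_pd hu]
    have h1 : ∀ i, Continuous fun t : ℝ => u i (t • x) := fun i => (hu i).continuous.comp (by fun_prop)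
    have h2 : ∀ i, Continuous fun t : ℝ => pd (u i) k (t • x) := fun i => (pd_contDiff (hu i) k).continuous.comp (by fun_prop)
    have := h1 (l+1)
    have := h1 (l+2)
    have := h2 (l+1)
    have := h2 (l+2)
    fun_prop
  have e : ∀ l k, pd (Apo u l) k x = ∫ t in (0:ℝ)..1, pd (fun y => Hp u l (y, t)) k x := fun l k =>
    param_pd (Hp_smooth hu l) 0 1 x k
  rw [e, e, ← intervalIntegral.integral_sub ((hc _ _).intervalIntegrable _ _) ((hc _ _).intervalIntegrable _ _)]
  have hd : ∀ t, HasDerivAt (fun t : ℝ => t ^ 2 * u m (t • x)) (pd (fun y => Hp u l (y, t)) k x - pd (fun y => Hp u k (y, t)) l x) t := by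
    intro t
    rw [h t]
    have h1 : HasDerivAt (fun t : ℝ => t • x) x t := by simpa using (hasDerivAt_id t).smul_const x
    have h2 := (((hu m).differentiable (by simp) (t • x)).hasFDerivAt).comp_hasDerivAt t h1
    rw [sum_pd_coord ((hu m).differentiable (by simp) (t • x))] at h2
    have h3 : HasDerivAt (fun t : ℝ => t ^ 2 * u m (t • x)) _ t := (hasDerivAt_pow 2 t).mul h2
    refine h3.congr_deriv ?_
    simp
  rw [intervalIntegral.integral_eq_sub_of_hasDerivAt (fun t _ => hd t) (((hc _ _).sub (hc _ _)).intervalIntegrable _ _)]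
  simp

lemma Apo_curl {u : Fin 3 → R3 → ℝ} (hu : ∀ i, ContDiff ℝ ∞ (u i)) (hd : ∀ x, ∑ j, pd (u j) j x = 0) (x : R3) :
    IsCurl (Apo u) u x := by
  refine ⟨Apo_curl_aux hu 0 1 2 x fun t => ?_, Apo_curl_aux hu 1 2 0 x fun t => ?_, Apo_curl_aux hu 2 0 1 x fun t => ?_⟩
  all_goals
    have h := hd (t • x)
    simp only [Hp_pd hu, Fin.sum_univ_three] at h ⊢
  · have : pd (u 0) 0 (t • x) = - pd (u 1) 1 (t • x) - pd (u 2) 2 (t • x) := by linarith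
    simp [show (2:Fin 3) + 1 = 0 by decide, show (2:Fin 3) + 2 = 1 by decide, show (1:Fin 3) + 1 = 2 by decide, show (1:Fin 3) + 2 = 0 by decide, this]; ring
  · have : pd (u 0) 0 (t • x) = - pd (u 1) 1 (t • x) - pd (u 2) 2 (t • x) := by linarith
    simp [show (2:Fin 3) + 1 = 0 by decide, show (2:Fin 3) + 2 = 1 by decide, show (1:Fin 3) + 1 = 2 by decide, show (1:Fin 3) + 2 = 0 by decide, this]; ring
  · have : pd (u 0) 0 (t • x) = - pd (u 1) 1 (t • x) - pd (u 2) 2 (t • x) := by linarith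
    simp [show (2:Fin 3) + 1 = 0 by decide, show (2:Fin 3) + 2 = 1 by decide, show (1:Fin 3) + 1 = 2 by decide, show (1:Fin 3) + 2 = 0 by decide, this]; ring

lemma lint_scale {h : R3 → ℝ≥0∞} (hm : Measurable h) {t : ℝ} (ht : 0 < t) : ∫⁻ x, h (t • x) = ENNReal.ofReal ((t ^ 3)⁻¹) * ∫⁻ x, h x := by
  have h1 : ∫⁻ x, h (t • x) = ∫⁻ x, h x ∂(Measure.map (t • ·) volume) :=
    (lintegral_map hm (measurable_const_smul t)).symm
  rw [h1, Measure.map_addHaar_smul volume ht.ne', lintegral_smul_measure]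
  simp [abs_of_pos ht]

lemma Apo_lp {u : Fin 3 → R3 → ℝ} (hu : ∀ i, ContDiff ℝ ∞ (u i)) {p : ℝ} (hp : 3 ≤ p) (l : Fin 3) {c : ℝ} (hc : 0 ≤ c) {S : ℝ≥0∞}
    (hb : ∀ n, ∫⁻ x in ball (0:R3) 2, ENNReal.ofReal (|u n x| ^ p) ≤ ENNReal.ofReal c * S) :
    ∫⁻ x in ball (0:R3) 2, ENNReal.ofReal (|Apo u l x| ^ p) ≤ ENNReal.ofReal (6 ^ p * c) * S := by
  set G : R3 → ℝ := fun x => 2 * ∑ n, |u n x| with hG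
  have hGc : Continuous G := by
    have := fun i => (hu i).continuous
    fun_prop
  have hG0 : ∀ x, 0 ≤ G x := fun x => by positivity
  set h : R3 → ℝ≥0∞ := (ball (0:R3) 2).indicator fun x => ENNReal.ofReal (|G x| ^ p) with hh
  have hmG : Measurable fun x => ENNReal.ofReal (|G x| ^ p) := (hGc.measurable.abs.pow_const p).ennreal_ofReal
  have hhm : Measurable h := hmG.indicator measurableSet_ball
  have hi : ∫⁻ x, h x ≤ ENNReal.ofReal (6 ^ p * c) * S := by
    rw [hh, lintegral_indicator measurableSet_ball]
    have := lp_dom (p := p) (by linarith) measurableSet_ball (g := G) (h := u) (fun n => (hu n).continuous.measurable) (K := 2) (by norm_num) hc (S := S) (s := ball (0:R3) 2)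
      (fun x _ => by rw [abs_of_nonneg (hG0 x)]) hb
    refine this.trans (le_of_eq ?_)
    rw [← Real.mul_rpow (by norm_num) (by positivity)]
    norm_num
  have pw : ∀ x ∈ ball (0:R3) 2, ENNReal.ofReal (|Apo u l x| ^ p) ≤ ∫⁻ t in Set.Ioc (0:ℝ) 1, ENNReal.ofReal (t ^ p) * h (t • x) := by
    intro x hx
    rw [mem_ball_zero_iff] at hx
    have hcl : Continuous fun t : ℝ => t * G (t • x) := by
      have := hGc.comp (by fun_prop : Continuous fun t : ℝ => t • x)
      exact continuous_id.mul this
    have hI : IntegrableOn (fun t : ℝ => t * G (t • x)) (Set.Ioc 0 1) := hcl.integrableOn_Icc.mono_set Set.Ioc_subset_Icc_self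
    have h1 : |Apo u l x| ≤ ∫ t in Set.Ioc (0:ℝ) 1, t * G (t • x) := by
      unfold Apo
      rw [intervalIntegral.integral_of_le zero_le_one, ← Real.norm_eq_abs]
      refine norm_integral_le_of_norm_le hI ?_
      refine (ae_restrict_iff' measurableSet_Ioc).2 (Eventually.of_forall fun t ht => ?_)
      have ht0 := ht.1
      unfold Hp
      simp only [norm_mul, Real.norm_eq_abs]
      rw [abs_of_pos ht0]
      refine mul_le_mul_of_nonneg_left ?_ ht0.le
      have a1 := coord_le x (l + 1)
      have a2 := coord_le x (l + 2)
      have s1 : |u (l+1) (t • x)| + |u (l+2) (t • x)| ≤ ∑ n, |u n (t • x)| := by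
        rw [Fin.sum_univ_three]
        have := abs_nonneg (u 0 (t • x))
        have := abs_nonneg (u 1 (t • x))
        have := abs_nonneg (u 2 (t • x))
        fin_cases l
        · change |u 1 (t • x)| + |u 2 (t • x)| ≤ _; linarith
        · change |u 2 (t • x)| + |u 0 (t • x)| ≤ _; linarith
        · change |u 0 (t • x)| + |u 1 (t • x)| ≤ _; linarith
      calc _ ≤ |u (l+1) (t • x) * x (l+2)| + |u (l+2) (t • x) * x (l+1)| := abs_sub _ _
        _ ≤ |u (l+1) (t • x)| * 2 + |u (l+2) (t • x)| * 2 := by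
            rw [abs_mul, abs_mul]
            gcongr
            · linarith
            · linarith
        _ ≤ _ := by simp only [hG]; linarith
    have hnn : 0 ≤ᵐ[volume.restrict (Set.Ioc (0:ℝ) 1)] fun t : ℝ => t * G (t • x) :=
      (ae_restrict_iff' measurableSet_Ioc).2 (Eventually.of_forall fun t ht => mul_nonneg ht.1.le (hG0 _))
    have h2 := jens (μ := volume.restrict (Set.Ioc (0:ℝ) 1)) (p := p) (by linarith) (F := fun t => ENNReal.ofReal (t * G (t • x)))
      hcl.measurable.ennreal_ofReal.aemeasurable
    rw [← ofReal_integral_eq_lintegral_ofReal hI hnn, Measure.restrict_apply_univ, Real.volume_Ioc, ENNReal.ofReal_rpow_of_nonneg (integral_nonneg_of_ae hnn) (by linarith)] at h2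
    simp only [sub_zero, ENNReal.ofReal_one, ENNReal.one_rpow, one_mul] at h2
    refine (ENNReal.ofReal_le_ofReal (Real.rpow_le_rpow (abs_nonneg _) h1 (by linarith))).trans (h2.trans (le_of_eq ?_))
    refine setLIntegral_congr_fun measurableSet_Ioc fun t ht => ?_
    have hmem : t • x ∈ ball (0:R3) 2 := by
      rw [mem_ball_zero_iff, norm_smul, Real.norm_eq_abs, abs_of_pos ht.1]
      have : t * ‖x‖ ≤ 1 * ‖x‖ := mul_le_mul_of_nonneg_right ht.2 (norm_nonneg _)
      linarith
    simp only [hh, Set.indicator_of_mem hmem]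
    rw [ENNReal.ofReal_rpow_of_nonneg (mul_nonneg ht.1.le (hG0 _)) (by linarith), ← ENNReal.ofReal_mul (Real.rpow_nonneg ht.1.le _),
      abs_of_nonneg (hG0 _), Real.mul_rpow ht.1.le (hG0 _)]
  calc _ ≤ ∫⁻ x in ball (0:R3) 2, ∫⁻ t in Set.Ioc (0:ℝ) 1, ENNReal.ofReal (t ^ p) * h (t • x) := setLIntegral_mono' measurableSet_ball pw
    _ ≤ ∫⁻ x, ∫⁻ t in Set.Ioc (0:ℝ) 1, ENNReal.ofReal (t ^ p) * h (t • x) := setLIntegral_le_lintegral _ _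
    _ = ∫⁻ t in Set.Ioc (0:ℝ) 1, ∫⁻ x, ENNReal.ofReal (t ^ p) * h (t • x) := by
        rw [lintegral_lintegral_swap]
        refine Measurable.aemeasurable ?_
        refine Measurable.mul ?_ ?_
        · exact (measurable_snd.pow_const p).ennreal_ofReal
        · exact hhm.comp (by fun_prop : Continuous fun z : R3 × ℝ => z.2 • z.1).measurable
    _ ≤ ∫⁻ t in Set.Ioc (0:ℝ) 1, ∫⁻ x, h x := by
        refine setLIntegral_mono' measurableSet_Ioc fun t ht => ?_
        rw [lintegral_const_mul' _ _ (by simp), lint_scale hhm ht.1, ← mul_assoc, ← ENNReal.ofReal_mul (Real.rpow_nonneg ht.1.le _)]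
        have : t ^ p * (t ^ 3)⁻¹ ≤ 1 := by
          rw [← div_eq_mul_inv, div_le_one (pow_pos ht.1 3), ← Real.rpow_natCast]
          exact Real.rpow_le_rpow_of_exponent_ge ht.1 ht.2 (by exact_mod_cast hp)
        calc _ ≤ ENNReal.ofReal 1 * ∫⁻ x, h x := mul_le_mul_left (ENNReal.ofReal_le_ofReal this) _
          _ = _ := by simp
    _ = ∫⁻ x, h x := by simp
    _ ≤ _ := hi
end Poinc

section Ext
open scoped ContDiff ENNReal

lemma pd_comm {f : R3 → ℝ} (hf : ContDiff ℝ ∞ f) (j k : Fin 3) (x : R3) : pd (pd f j) k x = pd (pd f k) j x := by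
  have hd : DifferentiableAt ℝ (fderiv ℝ f) x := (hf.fderiv_right (m := ∞) (by simp)).differentiable (by simp) x
  have e : ∀ j k, pd (pd f j) k x = fderiv ℝ (fderiv ℝ f) x (EuclideanSpace.single k 1) (EuclideanSpace.single j 1) := by
    intro j k
    have h1 : HasFDerivAt (fun y => fderiv ℝ f y (EuclideanSpace.single j (1:ℝ))) _ x :=
      hd.hasFDerivAt.clm_apply (hasFDerivAt_const (EuclideanSpace.single j (1:ℝ) : R3) x)
    have : fderiv ℝ (pd f j) x = _ := h1.fderiv
    rw [pd, this]; simp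
  rw [e, e]
  have := (hf.contDiffAt (x := x)).isSymmSndFDerivAt (by rw [minSmoothness_of_isRCLikeNormedField]; exact WithTop.coe_le_coe.2 (le_top : (2:ℕ∞) ≤ ⊤))
  exact this.eq _ _

lemma ann_mem {x : R3} {R : ℝ} : x ∈ annulus R ↔ ‖x‖ < 2 * R ∧ R ≤ ‖x‖ := by
  simp [annulus]

lemma ann_meas (R : ℝ) : MeasurableSet (annulus R) := measurableSet_ball.diff measurableSet_ball

lemma lint_eq_set {p : ℝ} (hp : 0 < p) {g : R3 → ℝ} {s : Set R3} (hs : MeasurableSet s) (h : ∀ x ∉ s, g x = 0) :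
    ∫⁻ x, ENNReal.ofReal (|g x| ^ p) = ∫⁻ x in s, ENNReal.ofReal (|g x| ^ p) := by
  rw [← lintegral_indicator hs]
  refine lintegral_congr fun x => ?_
  by_cases hx : x ∈ s
  · rw [Set.indicator_of_mem hx]
  · rw [Set.indicator_of_notMem hx, h x hx, abs_zero, Real.zero_rpow hp.ne', ENNReal.ofReal_zero]

lemma ext_in {p : ℝ} (hp : 3 ≤ p) : ∃ C : ℝ, 0 ≤ C ∧ ∀ u : Fin 3 → R3 → ℝ, (∀ i, ContDiff ℝ ∞ (u i)) → (∀ x, ∑ j, pd (u j) j x = 0) →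
    ∃ F : Fin 3 → R3 → ℝ, (∀ i, ContDiff ℝ ∞ (F i)) ∧ (∀ x, ∑ j, pd (F j) j x = 0) ∧ (∀ x, (1.91:ℝ) ≤ ‖x‖ → ∀ i, F i x = u i x) ∧
    ∀ i, ∫⁻ x in ball (0:R3) 2, ENNReal.ofReal (|F i x| ^ p) ≤ ENNReal.ofReal C * ∑ n, ∫⁻ x in annulus 1, ENNReal.ofReal (|u n x| ^ p) := by
  obtain ⟨χ, hχ, hχs, χ0, χ1, χone, χz⟩ := cutoff (a := 1.05) (b := 1.1) (by norm_num) (by norm_num)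
  have hb : ∀ j, ∃ K, 0 ≤ K ∧ ∀ x, |pd χ j x| ≤ K := fun j =>
    bdd_of_cs (pd_contDiff hχ j).continuous (pd_cs hχs j)
  choose K' hK0' hK' using hb
  set K := ∑ j, K' j with hKdef
  have hK0 : 0 ≤ K := Finset.sum_nonneg fun j _ => hK0' j
  have hK : ∀ j x, |pd χ j x| ≤ K := fun j x => (hK' j x).trans (Finset.single_le_sum (f := K') (fun j _ => hK0' j) (Finset.mem_univ j))
  obtain ⟨D, hD, box⟩ := box_op (a := 1.101) (by norm_num) (p := p) (by linarith)
  set D1 := D * (K ^ p * (Fintype.card (Fin 3) : ℝ) ^ p * 1) with hD1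
  have D10 : 0 ≤ D1 := by positivity
  refine ⟨1 ^ p * (Fintype.card (Fin 2) : ℝ) ^ p * (1 + D1), by positivity, fun u hu hd => ?_⟩
  set S := ∑ n, ∫⁻ x in annulus 1, ENNReal.ofReal (|u n x| ^ p) with hS
  have hSn : ∀ n, ∫⁻ x in annulus 1, ENNReal.ofReal (|u n x| ^ p) ≤ S := fun n =>
    Finset.single_le_sum (f := fun n => ∫⁻ x in annulus 1, ENNReal.ofReal (|u n x| ^ p)) (fun _ _ => zero_le) (Finset.mem_univ n)
  have zin : ∀ x j, ‖x‖ < 1.05 → pd χ j x = 0 := by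
    intro x j hx
    refine pd_eq_zero (c := 1) ?_ j
    filter_upwards [(isOpen_lt continuous_norm continuous_const).mem_nhds hx] with y hy using χone y (le_of_lt hy)
  have zout : ∀ x j, 1.1 < ‖x‖ → pd χ j x = 0 := by
    intro x j hx
    refine pd_eq_zero (c := 0) ?_ j
    filter_upwards [(isOpen_lt continuous_const continuous_norm).mem_nhds hx] with y hy using χz y (le_of_lt hy)
  set f : R3 → ℝ := fun x => ∑ j, pd χ j x * u j x with hf
  have fs : ContDiff ℝ ∞ f := ContDiff.sum fun j _ => (pd_contDiff hχ j).mul (hu j)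
  have fv : Van 1.101 f := by
    rintro x ⟨i, hi⟩
    have : 1.1 < ‖x‖ := by have := coord_le x i; norm_num at hi this ⊢; linarith
    simp [hf, zout x _ this]
  have hdu : ∀ j x, DifferentiableAt ℝ (u j) x := fun j x => (hu j).differentiable (by simp) x
  have hdχ : ∀ x, DifferentiableAt ℝ χ x := fun x => hχ.differentiable (by simp) x
  have fdiv : ∀ x, ∑ j, pd (fun y => χ y * u j y) j x = f x := by
    intro x
    have : ∀ j, pd (fun y => χ y * u j y) j x = pd χ j x * u j x + χ x * pd (u j) j x := fun j => pd_mul (hdχ x) (hdu j x) j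
    simp only [this, Finset.sum_add_distrib, ← Finset.mul_sum, hd x, mul_zero, add_zero, hf]
  have f0 : ∫ x, f x = 0 := by
    have i1 : ∀ j, Integrable (pd (fun y => χ y * u j y) j) := fun j =>
      (pd_contDiff (hχ.mul (hu j)) j).continuous.integrable_of_hasCompactSupport (pd_cs hχs.mul_right j)
    calc ∫ x, f x = ∫ x, ∑ j, pd (fun y => χ y * u j y) j x := integral_congr_ae (Eventually.of_forall fun x => (fdiv x).symm)
      _ = ∑ j, ∫ x, pd (fun y => χ y * u j y) j x := integral_finset_sum _ fun j _ => i1 j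
      _ = 0 := Finset.sum_eq_zero fun j _ => int_pd_zero ((hχ.mul (hu j)).of_le (by exact_mod_cast le_top)) hχs.mul_right j
  obtain ⟨w, ws, wv, wd, wb⟩ := box f fs fv f0
  have fb : ∫⁻ x, ENNReal.ofReal (|f x| ^ p) ≤ ENNReal.ofReal (K ^ p * (Fintype.card (Fin 3) : ℝ) ^ p * 1) * S := by
    rw [lint_eq_set (by linarith) (ann_meas 1)]
    · refine lp_dom (by linarith) (ann_meas 1) (h := u) (fun n => (hu n).continuous.measurable) hK0 zero_le_one (fun x _ => ?_) (fun n => by simpa using hSn n)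
      refine (Finset.abs_sum_le_sum_abs _ _).trans ?_
      rw [Finset.mul_sum]
      refine Finset.sum_le_sum fun j _ => ?_
      rw [abs_mul]
      exact mul_le_mul_of_nonneg_right (hK j x) (abs_nonneg _)
    · intro x hx
      rw [ann_mem, not_and_or] at hx
      have : ∀ j, pd χ j x = 0 := fun j => by
        rcases hx with hx | hx
        · exact zout x j (by norm_num at hx ⊢; linarith)
        · exact zin x j (by norm_num at hx ⊢; linarith)
      simp [hf, this]
  refine ⟨fun j x => (1 - χ x) * u j x + w j x, fun j => ((contDiff_const.sub hχ).mul (hu j)).add (ws j), fun x => ?_, fun x hx i => ?_, fun i => ?_⟩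
  · have h1 : ∀ j, pd (fun x => (1 - χ x) * u j x + w j x) j x = - (pd χ j x * u j x) + (1 - χ x) * pd (u j) j x + pd (w j) j x := by
      intro j
      have dc : DifferentiableAt ℝ (fun x => 1 - χ x) x := (hdχ x).const_sub 1
      rw [pd_add (dc.fun_mul (hdu j x)) ((ws j).differentiable (by simp) x), pd_mul dc (hdu j x)]
      have : pd (fun x => 1 - χ x) j x = - pd χ j x := by
        rw [pd_sub (differentiableAt_const _) (hdχ x)]; simp [pd]
      rw [this]; ring
    simp only [h1, Finset.sum_add_distrib, ← Finset.mul_sum, hd x, mul_zero, add_zero, Finset.sum_neg_distrib, wd x, hf]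
    ring
  · have hz : w i x = 0 := by
      refine wv i x ?_
      by_contra hcon
      push Not at hcon
      have e : ‖x‖ ^ 2 = x 0 ^ 2 + x 1 ^ 2 + x 2 ^ 2 := by
        rw [EuclideanSpace.norm_sq_eq, Fin.sum_univ_three]; simp
      have q : ∀ k, x k ^ 2 ≤ 1.101 ^ 2 := fun k => by
        rw [← sq_abs]; exact pow_le_pow_left₀ (abs_nonneg _) (hcon k).le 2
      have : (1.91:ℝ) ^ 2 ≤ ‖x‖ ^ 2 := pow_le_pow_left₀ (by norm_num) hx 2
      have q0 := q 0
      have q1 := q 1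
      have q2 := q 2
      norm_num at this q0 q1 q2
      linarith
    simp only
    rw [hz, χz x (by norm_num at hx ⊢; linarith)]; ring
  · refine lp_dom (ι := Fin 2) (by linarith) measurableSet_ball (h := ![fun x => (1 - χ x) * u i x, w i]) ?_ zero_le_one (by positivity) ?_ ?_
    · intro n; fin_cases n
      · exact ((continuous_const.sub hχ.continuous).mul (hu i).continuous).measurable
      · exact (ws i).continuous.measurable
    · intro x _
      rw [one_mul, Fin.sum_univ_two]
      exact abs_add_le _ _
    · intro n; fin_cases n
      · change ∫⁻ x in ball (0:R3) 2, ENNReal.ofReal (|(1 - χ x) * u i x| ^ p) ≤ _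
        calc _ ≤ ∫⁻ x in ball (0:R3) 2, (annulus 1).indicator (fun x => ENNReal.ofReal (|u i x| ^ p)) x := by
              refine setLIntegral_mono' measurableSet_ball fun x hx => ?_
              rw [mem_ball_zero_iff] at hx
              by_cases h : x ∈ annulus 1
              · rw [Set.indicator_of_mem h]
                refine ENNReal.ofReal_le_ofReal (Real.rpow_le_rpow (abs_nonneg _) ?_ (by linarith))
                rw [abs_mul]
                have : |1 - χ x| ≤ 1 := abs_le.2 ⟨by linarith [χ1 x], by linarith [χ0 x]⟩
                exact mul_le_of_le_one_left (abs_nonneg _) this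
              · rw [ann_mem, not_and_or] at h
                have : χ x = 1 := χone x (by
                  rcases h with h | h
                  · norm_num at h; linarith
                  · norm_num at h ⊢; linarith)
                rw [this]; simp
                rw [Real.zero_rpow (by linarith)]; simp
          _ ≤ ∫⁻ x, (annulus 1).indicator (fun x => ENNReal.ofReal (|u i x| ^ p)) x := setLIntegral_le_lintegral _ _
          _ = ∫⁻ x in annulus 1, ENNReal.ofReal (|u i x| ^ p) := lintegral_indicator (ann_meas 1) _
          _ ≤ S := hSn i
          _ = ENNReal.ofReal 1 * S := by simp
          _ ≤ _ := mul_le_mul_left (ENNReal.ofReal_le_ofReal (by linarith)) _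
      · change ∫⁻ x in ball (0:R3) 2, ENNReal.ofReal (|w i x| ^ p) ≤ _
        calc _ ≤ ∫⁻ x, ENNReal.ofReal (|w i x| ^ p) := setLIntegral_le_lintegral _ _
          _ ≤ ENNReal.ofReal D * (ENNReal.ofReal (K ^ p * (Fintype.card (Fin 3) : ℝ) ^ p * 1) * S) := (wb i).trans (mul_le_mul_right fb _)
          _ = ENNReal.ofReal D1 * S := by rw [← mul_assoc, ← ENNReal.ofReal_mul hD]
          _ ≤ _ := mul_le_mul_left (ENNReal.ofReal_le_ofReal (by linarith)) _

def curlF (A : Fin 3 → R3 → ℝ) (m : Fin 3) (x : R3) : ℝ := pd (A (m + 2)) (m + 1) x - pd (A (m + 1)) (m + 2) x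

lemma IsCurl_iff {A F : Fin 3 → R3 → ℝ} {x : R3} : IsCurl A F x ↔ ∀ m, curlF A m x = F m x := by
  unfold IsCurl curlF
  constructor
  · rintro ⟨h0, h1, h2⟩ m
    fin_cases m
    exacts [h0, h1, h2]
  · exact fun h => ⟨h 0, h 1, h 2⟩

lemma ext1 {p : ℝ} (hp : 3 ≤ p) : ∃ C : ℝ, 0 ≤ C ∧ ∀ u : Fin 3 → R3 → ℝ, (∀ i, ContDiff ℝ ∞ (u i)) → (∀ x, ∑ j, pd (u j) j x = 0) →
    ∃ F : Fin 3 → R3 → ℝ, (∀ i, CcS (F i)) ∧ (∀ x, ∑ j, pd (F j) j x = 0) ∧ (∀ x, (1.91:ℝ) ≤ ‖x‖ → ‖x‖ ≤ 1.95 → ∀ i, F i x = u i x) ∧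
    (∀ x, 2 ≤ ‖x‖ → ∀ i, F i x = 0) ∧
    ∀ i, ∫⁻ x, ENNReal.ofReal (|F i x| ^ p) ≤ ENNReal.ofReal C * ∑ n, ∫⁻ x in annulus 1, ENNReal.ofReal (|u n x| ^ p) := by
  obtain ⟨C1, hC1, hin⟩ := ext_in hp
  obtain ⟨χ, hχ, hχs, χ0, χ1, χone, χz⟩ := cutoff (a := 1.96) (b := 1.99) (by norm_num) (by norm_num)
  have hb : ∀ j, ∃ K, 0 ≤ K ∧ ∀ x, |pd χ j x| ≤ K := fun j =>
    bdd_of_cs (pd_contDiff hχ j).continuous (pd_cs hχs j)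
  choose K' hK0' hK' using hb
  set K := ∑ j, K' j with hKdef
  have hK0 : 0 ≤ K := Finset.sum_nonneg fun j _ => hK0' j
  have hK : ∀ j x, |pd χ j x| ≤ K := fun j x => (hK' j x).trans (Finset.single_le_sum (f := K') (fun j _ => hK0' j) (Finset.mem_univ j))
  refine ⟨(K + 1) ^ p * (Fintype.card (Fin 3) : ℝ) ^ p * (6 ^ p * C1 + C1), by positivity, fun u hu hd => ?_⟩
  obtain ⟨u1, us, ud, ue, ub⟩ := hin u hu hd
  have cur := fun x => IsCurl_iff.1 (Apo_curl us ud x)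
  have As := fun l => Apo_smooth us l
  have Ab := fun l => Apo_lp us hp l hC1 ub
  set A := Apo u1 with hA
  have zin : ∀ x j, ‖x‖ < 1.96 → pd χ j x = 0 := by
    intro x j hx
    refine pd_eq_zero (c := 1) ?_ j
    filter_upwards [(isOpen_lt continuous_norm continuous_const).mem_nhds hx] with y hy using χone y (le_of_lt hy)
  have zout : ∀ x j, 1.99 < ‖x‖ → pd χ j x = 0 := by
    intro x j hx
    refine pd_eq_zero (c := 0) ?_ j
    filter_upwards [(isOpen_lt continuous_const continuous_norm).mem_nhds hx] with y hy using χz y (le_of_lt hy)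
  set F := curlF (fun l x => χ x * A l x) with hF
  have dχ : ∀ x, DifferentiableAt ℝ χ x := fun x => hχ.differentiable (by simp) x
  have dA : ∀ l x, DifferentiableAt ℝ (A l) x := fun l x => (As l).differentiable (by simp) x
  have Fe : ∀ m x, F m x = pd χ (m + 1) x * A (m + 2) x - pd χ (m + 2) x * A (m + 1) x + χ x * u1 m x := by
    intro m x
    rw [hF, curlF, pd_mul (dχ x) (dA _ x), pd_mul (dχ x) (dA _ x), ← cur x m, curlF]; ring
  have sA : ∀ l, ContDiff ℝ ∞ fun x => χ x * A l x := fun l => hχ.mul (As l)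
  have Fz : ∀ x, 2 ≤ ‖x‖ → ∀ i, F i x = 0 := by
    intro x hx i
    rw [Fe, χz x (by norm_num; linarith), zout x _ (by norm_num; linarith), zout x _ (by norm_num; linarith)]; ring
  refine ⟨F, fun i => ⟨?_, ?_⟩, fun x => ?_, fun x h1 h2 i => ?_, Fz, fun i => ?_⟩
  · exact (pd_contDiff (sA _) _).sub (pd_contDiff (sA _) _)
  · exact (pd_cs hχs.mul_right _).sub (pd_cs hχs.mul_right _)
  · have h : ∀ m, pd (F m) m x = pd (pd (fun x => χ x * A (m + 2) x) (m + 1)) m x - pd (pd (fun x => χ x * A (m + 1) x) (m + 2)) m x := fun m =>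
      pd_sub ((pd_contDiff (sA _) _).differentiable (by simp) x) ((pd_contDiff (sA _) _).differentiable (by simp) x) m
    rw [Fin.sum_univ_three, h, h, h]
    simp only [show (2:Fin 3) + 1 = 0 by decide, show (2:Fin 3) + 2 = 1 by decide, show (1:Fin 3) + 1 = 2 by decide, show (1:Fin 3) + 2 = 0 by decide, zero_add]
    rw [pd_comm (sA 2) 1 0, pd_comm (sA 1) 2 0, pd_comm (sA 0) 2 1]; ring
  · rw [Fe, χone x (by norm_num at h2 ⊢; linarith), zin x _ (by norm_num at h2 ⊢; linarith), zin x _ (by norm_num at h2 ⊢; linarith), ue x h1]; ring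
  · rw [lint_eq_set (by linarith) (measurableSet_ball (x := (0:R3)) (ε := 2))]
    swap
    · intro x hx; rw [mem_ball_zero_iff, not_lt] at hx; exact Fz x hx i
    refine lp_dom (ι := Fin 3) (by linarith) measurableSet_ball (h := ![A (i + 2), A (i + 1), u1 i]) ?_ (by positivity) (by positivity) ?_ ?_
    · intro n; fin_cases n
      · exact (As _).continuous.measurable
      · exact (As _).continuous.measurable
      · exact (us _).continuous.measurable
    · intro x _
      rw [Fe, Fin.sum_univ_three]
      change _ ≤ (K + 1) * (|A (i + 2) x| + |A (i + 1) x| + |u1 i x|)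
      calc _ ≤ |pd χ (i + 1) x * A (i + 2) x - pd χ (i + 2) x * A (i + 1) x| + |χ x * u1 i x| := abs_add_le _ _
        _ ≤ |pd χ (i + 1) x * A (i + 2) x| + |pd χ (i + 2) x * A (i + 1) x| + |χ x * u1 i x| := by gcongr; exact abs_sub _ _
        _ ≤ K * |A (i + 2) x| + K * |A (i + 1) x| + 1 * |u1 i x| := by
            rw [abs_mul, abs_mul, abs_mul]
            gcongr
            · exact hK _ _
            · exact hK _ _
            · rw [abs_of_nonneg (χ0 x)]; exact χ1 x
        _ ≤ _ := by
            have := abs_nonneg (A (i + 2) x)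
            have := abs_nonneg (A (i + 1) x)
            have := mul_nonneg hK0 (abs_nonneg (u1 i x))
            linarith
    · have i6 : 0 ≤ (6:ℝ) ^ p * C1 := by positivity
      intro n; fin_cases n
      · exact (Ab _).trans (mul_le_mul_left (ENNReal.ofReal_le_ofReal (by linarith)) _)
      · exact (Ab _).trans (mul_le_mul_left (ENNReal.ofReal_le_ofReal (by linarith)) _)
      · exact (ub _).trans (mul_le_mul_left (ENNReal.ofReal_le_ofReal (by linarith)) _)
end Ext

section VecPot
open scoped ContDiff ENNReal

def LI (p : ℝ) (s : Set R3) (g : R3 → ℝ) : ℝ≥0∞ := ∫⁻ x in s, ENNReal.ofReal (|g x| ^ p)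

def Shell (R : ℝ) : Set R3 := {x | 1.91 * R ≤ ‖x‖ ∧ ‖x‖ ≤ 1.95 * R}

lemma Shell_meas (R : ℝ) : MeasurableSet (Shell R) :=
  ((isClosed_le continuous_const continuous_norm).inter (isClosed_le continuous_norm continuous_const)).measurableSet

lemma LI_meas {p : ℝ} {g : R3 → ℝ} (hg : Measurable g) : Measurable fun x => ENNReal.ofReal (|g x| ^ p) :=
  (hg.abs.pow_const p).ennreal_ofReal

lemma LI_scale {p : ℝ} {g : R3 → ℝ} (hg : Measurable g) {s t : Set R3} (hs : MeasurableSet s) (ht : MeasurableSet t) {R : ℝ} (hR : 0 < R)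
    (h : ∀ x, R • x ∈ t ↔ x ∈ s) : LI p s (fun x => g (R • x)) = ENNReal.ofReal ((R ^ 3)⁻¹) * LI p t g := by
  unfold LI
  rw [← lintegral_indicator ht, ← lint_scale ((LI_meas hg).indicator ht) hR, ← lintegral_indicator hs]
  refine lintegral_congr fun x => ?_
  by_cases hx : x ∈ s
  · rw [Set.indicator_of_mem hx, Set.indicator_of_mem ((h x).2 hx)]
  · rw [Set.indicator_of_notMem hx, Set.indicator_of_notMem (fun h' => hx ((h x).1 h'))]

lemma LI_jens {p q : ℝ} (hp : 0 < p) (hpq : p < q) {s : Set R3} {g : R3 → ℝ} (hg : Measurable g) :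
    (LI p s g) ^ (q / p) ≤ (volume s) ^ (q / p - 1) * LI q s g := by
  have := jens (μ := volume.restrict s) (p := q / p) (by rwa [one_lt_div hp]) (F := fun x => ENNReal.ofReal (|g x| ^ p)) (LI_meas hg).aemeasurable
  rw [Measure.restrict_apply_univ] at this
  refine this.trans (le_of_eq ?_)
  congr 1
  refine lintegral_congr fun x => ?_
  rw [ENNReal.ofReal_rpow_of_nonneg (by positivity) (div_nonneg (by linarith) hp.le), ← Real.rpow_mul (abs_nonneg _)]
  congr 2; field_simp

lemma vecpot1 {p : ℝ} (hp : 3 ≤ p) (hp6 : p < 6) : ∃ C : ℝ≥0∞, C ≠ ⊤ ∧ ∀ u : Fin 3 → R3 → ℝ, (∀ i, ContDiff ℝ ∞ (u i)) → (∀ x, ∑ j, pd (u j) j x = 0) →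
    ∃ A : Fin 3 → R3 → ℝ, (∀ i, ContDiff ℝ 1 (A i)) ∧ (∀ x ∈ Shell 1, ∀ m, curlF A m x = u m x) ∧
    (∀ l k, LI p (Shell 1) (pd (A l) k) ≤ C * ∑ n, LI p (annulus 1) (u n)) ∧ (∀ l, LI p (Shell 1) (A l) ≤ C * ∑ n, LI p (annulus 1) (u n)) := by
  obtain ⟨C1, hC1, ext⟩ := ext1 hp
  obtain ⟨C2, hC2, pot⟩ := potential (p := p) (by linarith) hp6
  set B := ball (0:R3) 2
  set V := volume B with hV
  have hVt : V ≠ ⊤ := measure_ball_lt_top.ne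
  have hp0 : 0 < p := by linarith
  set k1 : ℝ≥0∞ := ENNReal.ofReal C2 * (3 * ENNReal.ofReal C1) with hk1
  set c2 : ℝ≥0∞ := (V ^ (p / 2 - 1) * ENNReal.ofReal C1) ^ (2 / p) with hc2
  set c : ℝ≥0∞ := V ^ (6 / p - 1) * (ENNReal.ofReal C2 * (3 * c2) ^ 3) with hc
  have t1 : k1 ≠ ⊤ := by
    rw [hk1]; exact ENNReal.mul_ne_top ENNReal.ofReal_ne_top (ENNReal.mul_ne_top (by simp) ENNReal.ofReal_ne_top)
  have t2 : c2 ≠ ⊤ := ENNReal.rpow_ne_top_of_nonneg (by positivity) (ENNReal.mul_ne_top (ENNReal.rpow_ne_top_of_nonneg (by linarith) hVt) ENNReal.ofReal_ne_top)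
  have h6p : 0 ≤ 6 / p - 1 := by rw [sub_nonneg, one_le_div hp0]; linarith
  have t3 : c ≠ ⊤ := ENNReal.mul_ne_top (ENNReal.rpow_ne_top_of_nonneg h6p hVt) (ENNReal.mul_ne_top ENNReal.ofReal_ne_top (ENNReal.pow_ne_top (ENNReal.mul_ne_top (by simp) t2)))
  refine ⟨k1 + c ^ (p / 6), ENNReal.add_ne_top.2 ⟨t1, ENNReal.rpow_ne_top_of_nonneg (by positivity) t3⟩, fun u hu hd => ?_⟩
  obtain ⟨F, Fc, Fd, Fe, Fz, Fb⟩ := ext u hu hd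
  obtain ⟨A, As, Ac, Ad, A6⟩ := pot F Fc Fd
  set S := ∑ n, LI p (annulus 1) (u n) with hS
  have Fb' : ∀ i, ∫⁻ x, ENNReal.ofReal (|F i x| ^ p) ≤ ENNReal.ofReal C1 * S := Fb
  refine ⟨A, As, fun x hx m => ?_, fun l k => ?_, fun l => ?_⟩
  · rw [IsCurl_iff.1 (Ac x) m]
    have h1 := hx.1
    have h2 := hx.2
    rw [mul_one] at h1 h2
    exact Fe x h1 h2 m
  · calc _ ≤ ∫⁻ x, ENNReal.ofReal (|pd (A l) k x| ^ p) := setLIntegral_le_lintegral _ _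
      _ ≤ ENNReal.ofReal C2 * ∑ n : Fin 3, ENNReal.ofReal C1 * S := (Ad l k).trans (mul_le_mul_right (Finset.sum_le_sum fun n _ => Fb' n) _)
      _ = k1 * S := by rw [Finset.sum_const]; simp [hk1]; ring
      _ ≤ _ := mul_le_mul_left (le_add_right le_rfl) _
  · have mA := (As l).continuous.measurable
    have sub : Shell 1 ⊆ B := fun x hx => by
      rw [mem_ball_zero_iff]; have := hx.2; norm_num at this; linarith
    have f2 : ∀ n, ∫⁻ x, ENNReal.ofReal (|F n x| ^ 2) ≤ c2 * S ^ (2 / p) := by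
      intro n
      have e : ∫⁻ x, ENNReal.ofReal (|F n x| ^ 2) = LI 2 B (F n) := by
        rw [LI, ← lint_eq_set (by norm_num) measurableSet_ball (fun x hx => Fz x (by rwa [mem_ball_zero_iff, not_lt] at hx) n)]
        simp
      have h1 := LI_jens (p := 2) (q := p) (by norm_num) (by linarith) (s := B) (Fc n).1.continuous.measurable
      have h2 : LI p B (F n) ≤ ENNReal.ofReal C1 * S := (setLIntegral_le_lintegral _ _).trans (Fb' n)
      rw [e]
      calc LI 2 B (F n) = (LI 2 B (F n) ^ (p / 2)) ^ (2 / p) := by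
            rw [← ENNReal.rpow_mul, show p / 2 * (2 / p) = 1 by field_simp, ENNReal.rpow_one]
        _ ≤ (V ^ (p / 2 - 1) * (ENNReal.ofReal C1 * S)) ^ (2 / p) := ENNReal.rpow_le_rpow (h1.trans (mul_le_mul_right h2 _)) (by positivity)
        _ = _ := by rw [← mul_assoc, ENNReal.mul_rpow_of_nonneg _ _ (by positivity)]
    have a6 : LI 6 B (A l) ≤ ENNReal.ofReal C2 * (3 * c2) ^ 3 * S ^ (6 / p) := by
      calc LI 6 B (A l) ≤ ∫⁻ x, ENNReal.ofReal (|A l x| ^ (6:ℝ)) := setLIntegral_le_lintegral _ _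
        _ = ∫⁻ x, ENNReal.ofReal (|A l x| ^ 6) := by norm_cast
        _ ≤ ENNReal.ofReal C2 * (∑ n : Fin 3, c2 * S ^ (2 / p)) ^ 3 := (A6 l).trans (mul_le_mul_right (pow_le_pow_left' (Finset.sum_le_sum fun n _ => f2 n) 3) _)
        _ = ENNReal.ofReal C2 * (3 * c2) ^ 3 * (S ^ (2 / p)) ^ 3 := by rw [Finset.sum_const]; simp; ring
        _ = _ := by
            congr 1
            rw [← ENNReal.rpow_natCast, ← ENNReal.rpow_mul]
            congr 1; push_cast; ring
    have h3 := (LI_jens (p := p) (q := 6) hp0 hp6 (s := B) mA).trans (mul_le_mul_right a6 _)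
    calc LI p (Shell 1) (A l) ≤ LI p B (A l) := lintegral_mono_set sub
      _ = (LI p B (A l) ^ (6 / p)) ^ (p / 6) := by
          rw [← ENNReal.rpow_mul, show 6 / p * (p / 6) = 1 by field_simp, ENNReal.rpow_one]
      _ ≤ (c * S ^ (6 / p)) ^ (p / 6) := by
          refine ENNReal.rpow_le_rpow (h3.trans (le_of_eq ?_)) (by positivity)
          rw [hc]; ring
      _ = c ^ (p / 6) * S := by
          rw [ENNReal.mul_rpow_of_nonneg _ _ (by positivity), ← ENNReal.rpow_mul, show 6 / p * (p / 6) = 1 by field_simp, ENNReal.rpow_one]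
      _ ≤ _ := mul_le_mul_left (le_add_left le_rfl) _

lemma vecpot {p : ℝ} (hp : 3 ≤ p) (hp6 : p < 6) : ∃ C : ℝ≥0∞, C ≠ ⊤ ∧ ∀ u : Fin 3 → R3 → ℝ, (∀ i, ContDiff ℝ ∞ (u i)) → (∀ x, ∑ j, pd (u j) j x = 0) →
    ∀ R : ℝ, 0 < R → ∃ A : Fin 3 → R3 → ℝ, (∀ i, ContDiff ℝ 1 (A i)) ∧ (∀ x ∈ Shell R, ∀ m, curlF A m x = u m x) ∧
    (∀ l k, LI p (Shell R) (pd (A l) k) ≤ C * ∑ n, LI p (annulus R) (u n)) ∧ (∀ l, LI p (Shell R) (fun x => R⁻¹ * A l x) ≤ C * ∑ n, LI p (annulus R) (u n)) := by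
  obtain ⟨C, hC, H⟩ := vecpot1 hp hp6
  refine ⟨C, hC, fun u hu hd R hR => ?_⟩
  obtain ⟨A, As, Ac, Ad, A0⟩ := H (fun n x => u n (R • x)) (fun n => (hu n).comp (by fun_prop)) (fun x => by
    have : ∀ j, pd (fun y => u j (R • y)) j x = R * pd (u j) j (R • x) := fun j => pd_scale R x ((hu j).differentiable (by simp) _) j
    simp only [this, ← Finset.mul_sum, hd, mul_zero])
  have hRi : 0 < R⁻¹ := inv_pos.2 hR
  have dA : ∀ l x, DifferentiableAt ℝ (A l) x := fun l x => (As l).differentiable (by simp) x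
  have hcomp : ∀ l, ContDiff ℝ 1 fun x : R3 => A l (R⁻¹ • x) := fun l => (As l).comp (by fun_prop)
  have epd : ∀ l k, pd (fun x => R * A l (R⁻¹ • x)) k = fun x => pd (A l) k (R⁻¹ • x) := by
    intro l k; funext x
    rw [pd_const_mul R ((hcomp l).differentiable (by simp) x), pd_scale R⁻¹ x (dA l _), ← mul_assoc, mul_inv_cancel₀ hR.ne', one_mul]
  have nS : ∀ x : R3, ‖R⁻¹ • x‖ = R⁻¹ * ‖x‖ := fun x => by rw [norm_smul, Real.norm_eq_abs, abs_of_pos hRi]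
  have mS : ∀ x, R⁻¹ • x ∈ Shell 1 ↔ x ∈ Shell R := fun x => by
    simp only [Shell, Set.mem_setOf_eq, nS, mul_one]
    rw [inv_mul_eq_div, le_div_iff₀ hR, div_le_iff₀ hR]
  have mA : ∀ x, R • x ∈ annulus R ↔ x ∈ annulus 1 := fun x => by
    simp only [ann_mem, norm_smul, Real.norm_eq_abs, abs_of_pos hR]
    rw [show (2:ℝ) * R = R * (2 * 1) by ring, mul_lt_mul_iff_right₀ hR, le_mul_iff_one_le_right hR]
  have eS : ∑ n, LI p (annulus 1) (fun x => u n (R • x)) = ENNReal.ofReal ((R ^ 3)⁻¹) * ∑ n, LI p (annulus R) (u n) := by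
    rw [Finset.mul_sum]
    exact Finset.sum_congr rfl fun n _ => LI_scale (hu n).continuous.measurable (ann_meas 1) (ann_meas R) hR mA
  have fin : ∀ g : R3 → ℝ, Measurable g → LI p (Shell 1) g ≤ C * ∑ n, LI p (annulus 1) (fun x => u n (R • x)) →
      LI p (Shell R) (fun x => g (R⁻¹ • x)) ≤ C * ∑ n, LI p (annulus R) (u n) := by
    intro g hg h
    rw [LI_scale hg (Shell_meas R) (Shell_meas 1) hRi mS]
    refine (mul_le_mul_right h _).trans (le_of_eq ?_)
    rw [eS, mul_left_comm, ← mul_assoc (ENNReal.ofReal _) (ENNReal.ofReal _), ← ENNReal.ofReal_mul (by positivity)]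
    rw [show ((R⁻¹ ^ 3)⁻¹ * (R ^ 3)⁻¹) = 1 by field_simp]; simp
  refine ⟨fun l x => R * A l (R⁻¹ • x), fun l => contDiff_const.mul (hcomp l), fun x hx m => ?_, fun l k => ?_, fun l => ?_⟩
  · have := Ac _ ((mS x).2 hx) m
    unfold curlF at this ⊢
    simp only [epd]
    rw [this, smul_smul, mul_inv_cancel₀ hR.ne', one_smul]
  · rw [epd]; exact fin _ (pd_cont (As l) k).measurable (Ad l k)
  · have := fin _ (As l).continuous.measurable (A0 l)
    simpa only [← mul_assoc, inv_mul_cancel₀ hR.ne', one_mul] using this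
end VecPot

section Energy
open scoped ContDiff ENNReal

structure Sol (u v : Fin 3 → R3 → ℝ) (pr θ : R3 → ℝ) : Prop where
  su : ∀ i, ContDiff ℝ ∞ (u i)
  sv : ∀ i, ContDiff ℝ ∞ (v i)
  sp : ContDiff ℝ ∞ pr
  st : ContDiff ℝ ∞ θ
  e1 : ∀ i x, -lap (u i) x + (∑ j, u j x * pd (u i) j x) + pd pr i x + (∑ j, pd (fun y => v j y * v i y) j x) = 0
  e2 : ∀ i x, -lap (v i) x + (∑ j, u j x * pd (v i) j x) + pd θ i x + (∑ j, v j x * pd (u i) j x) = 0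
  e3 : ∀ x, -lap θ x + (∑ j, u j x * pd θ j x) + (∑ j, pd (v j) j x) = 0
  e4 : ∀ x, (∑ j, pd (u j) j x) = 0

def GG (u v : Fin 3 → R3 → ℝ) (θ : R3 → ℝ) (x : R3) : ℝ :=
  ∑ j, (∑ i, ((pd (u i) j x) ^ 2 + (pd (v i) j x) ^ 2) + (pd θ j x) ^ 2)

def RHS (u v : Fin 3 → R3 → ℝ) (θ φ : R3 → ℝ) (w : Fin 3 → R3 → ℝ) (x : R3) : ℝ :=
  ∑ j, (∑ i, (- (pd φ j x * (u i x * pd (u i) j x + v i x * pd (v i) j x)) + pd φ j x * v j x * (v i x * u i x)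
    + 1 / 2 * (u i x ^ 2 + v i x ^ 2) * (u j x * pd φ j x)
    - pd (u i) j x * pd (w i) j x + (u j x * u i x + v j x * v i x) * pd (w i) j x)
    - pd φ j x * (θ x * pd θ j x) + 1 / 2 * θ x ^ 2 * (u j x * pd φ j x) + θ x * v j x * pd φ j x)

lemma int_prod_zero {f g : R3 → ℝ} (hf : ContDiff ℝ 1 f) (hg : ContDiff ℝ 1 g) (hs : HasCompactSupport g) (j : Fin 3) :
    Integrable (fun x => pd f j x * g x + f x * pd g j x) ∧ ∫ x, (pd f j x * g x + f x * pd g j x) = 0 := by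
  have h := int_pd_zero (hf.mul hg) hs.mul_left j
  have e : ∀ x, pd (fun y => f y * g y) j x = pd f j x * g x + f x * pd g j x := fun x =>
    pd_mul (hf.differentiable (by simp) x) (hg.differentiable (by simp) x) j
  have hi : Integrable (pd (fun y => f y * g y) j) :=
    (pd_cont (hf.mul hg) j).integrable_of_hasCompactSupport (pd_cs hs.mul_left j)
  have e' : pd (fun y => f y * g y) j = fun x => pd f j x * g x + f x * pd g j x := funext e
  rw [e'] at hi
  refine ⟨hi, ?_⟩
  rw [← h]; exact integral_congr_ae (Eventually.of_forall fun x => (e x).symm)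

def IZ (f : R3 → ℝ) : Prop := Integrable f ∧ ∫ x, f x = 0

lemma IZ.add {f g : R3 → ℝ} (hf : IZ f) (hg : IZ g) : IZ (fun x => f x + g x) :=
  ⟨hf.1.add hg.1, by rw [integral_add hf.1 hg.1, hf.2, hg.2, add_zero]⟩
lemma IZ.sub {f g : R3 → ℝ} (hf : IZ f) (hg : IZ g) : IZ (fun x => f x - g x) :=
  ⟨hf.1.sub hg.1, by rw [integral_sub hf.1 hg.1, hf.2, hg.2, sub_zero]⟩
lemma IZ.sum {f : Fin 3 → R3 → ℝ} (hf : ∀ i, IZ (f i)) : IZ (fun x => ∑ i, f i x) :=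
  ⟨integrable_finset_sum _ fun i _ => (hf i).1, by
    rw [integral_finset_sum _ fun i _ => (hf i).1]; exact Finset.sum_eq_zero fun i _ => (hf i).2⟩

variable {u v : Fin 3 → R3 → ℝ} {pr θ : R3 → ℝ}

lemma alg_id (ph th : ℝ) (dφ dp dt ddt U V W : Fin 3 → ℝ) (du dv dw ddu ddv : Fin 3 → Fin 3 → ℝ)
    (e1 : ∀ i, -(∑ j, ddu i j) + (∑ j, U j * du i j) + dp i + (∑ j, (dv j j * V i + V j * dv i j)) = 0)
    (e2 : ∀ i, -(∑ j, ddv i j) + (∑ j, U j * dv i j) + dt i + (∑ j, V j * du i j) = 0)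
    (e3 : -(∑ j, ddt j) + (∑ j, U j * dt j) + (∑ j, dv j j) = 0)
    (e4 : ∑ j, du j j = 0) (ew : ∑ j, dw j j = -∑ j, dφ j * U j) (P : ℝ) :
    ∑ j, (∑ i, ((ddu i j * (ph * U i + W i) + du i j * (dφ j * U i + ph * du i j + dw i j))
      + (ddv i j * (ph * V i) + dv i j * (dφ j * V i + ph * dv i j))
      - ((du j j * U i + U j * du i j) * W i + U j * U i * dw i j)
      - ((dv j j * V i + V j * dv i j) * (ph * U i + W i) + V j * V i * (dφ j * U i + ph * du i j + dw i j))
      - ((du j j * (1 / 2 * (U i ^ 2 + V i ^ 2)) + U j * (U i * du i j + V i * dv i j)) * ph + U j * (1 / 2 * (U i ^ 2 + V i ^ 2)) * dφ j))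
      + (ddt j * (ph * th) + dt j * (dφ j * th + ph * dt j))
      - ((du j j * (1 / 2 * th ^ 2) + U j * (th * dt j)) * ph + U j * (1 / 2 * th ^ 2) * dφ j)
      - (dp j * (ph * U j + W j) + P * (dφ j * U j + ph * du j j + dw j j))
      - ((dt j * V j + th * dv j j) * ph + th * V j * dφ j))
    = ph * (∑ j, (∑ i, ((du i j) ^ 2 + (dv i j) ^ 2) + (dt j) ^ 2)) -
      ∑ j, (∑ i, (- (dφ j * (U i * du i j + V i * dv i j)) + dφ j * V j * (V i * U i)
    + 1 / 2 * (U i ^ 2 + V i ^ 2) * (U j * dφ j)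
    - du i j * dw i j + (U j * U i + V j * V i) * dw i j)
    - dφ j * (th * dt j) + 1 / 2 * th ^ 2 * (U j * dφ j) + th * V j * dφ j) := by
  have a0 := e1 0
  have a1 := e1 1
  have a2 := e1 2
  have b0 := e2 0
  have b1 := e2 1
  have b2 := e2 2
  simp only [Fin.sum_univ_three] at *
  linear_combination (-(ph * U 0 + W 0)) * a0 - (ph * U 1 + W 1) * a1 - (ph * U 2 + W 2) * a2 - ph * V 0 * b0 - ph * V 1 * b1 - ph * V 2 * b2 - ph * th * e3
    - (U 0 * W 0 + U 1 * W 1 + U 2 * W 2 + 1 / 2 * ph * (U 0 ^ 2 + U 1 ^ 2 + U 2 ^ 2 + V 0 ^ 2 + V 1 ^ 2 + V 2 ^ 2 + th ^ 2) + P * ph) * e4 - P * ew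
end Energy

section Energy2
open scoped ContDiff ENNReal
variable {u v : Fin 3 → R3 → ℝ} {pr θ : R3 → ℝ}

lemma c1 {f : R3 → ℝ} (h : ContDiff ℝ ∞ f) : ContDiff ℝ 1 f := h.of_le (by exact_mod_cast le_top)
lemma c1d {f : R3 → ℝ} (h : ContDiff ℝ 1 f) (x : R3) : DifferentiableAt ℝ f x := h.differentiable (by simp) x

lemma izp {f g : R3 → ℝ} (hf : ContDiff ℝ 1 f) (hg : ContDiff ℝ 1 g) (hs : HasCompactSupport g) (j : Fin 3) :
    IZ (fun x => pd f j x * g x + f x * pd g j x) := int_prod_zero hf hg hs j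

lemma energy (S : Sol u v pr θ) {φ : R3 → ℝ} (hφ : ContDiff ℝ ∞ φ) (hc : HasCompactSupport φ)
    {w : Fin 3 → R3 → ℝ} (hw : ∀ i, ContDiff ℝ 1 (w i)) (hwc : ∀ i, HasCompactSupport (w i))
    (hd : ∀ x, ∑ j, pd (w j) j x = -∑ j, pd φ j x * u j x) :
    IZ (fun x => φ x * GG u v θ x - RHS u v θ φ w x) := by
  have su := fun i => c1 (S.su i)
  have sv := fun i => c1 (S.sv i)
  have st := c1 S.st
  have sp := c1 S.sp
  have sf := c1 hφ
  have hW : ∀ i, ContDiff ℝ 1 (fun x => φ x * u i x + w i x) := fun i => (sf.mul (su i)).add (hw i)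
  have hWc : ∀ i, HasCompactSupport (fun x => φ x * u i x + w i x) := fun i => (hc.mul_right).add (hwc i)
  have key := IZ.sum fun j => ((((IZ.sum fun i => ((((
      (izp (c1 (pd_contDiff (S.su i) j)) (hW i) (hWc i) j).add
      (izp (c1 (pd_contDiff (S.sv i) j)) (sf.mul (sv i)) hc.mul_right j)).sub
      (izp ((su j).mul (su i)) (hw i) (hwc i) j)).sub
      (izp ((sv j).mul (sv i)) (hW i) (hWc i) j)).sub
      (izp ((su j).mul (contDiff_const (c := (1/2:ℝ)).mul (((su i).pow 2).add ((sv i).pow 2)))) sf hc j))).add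
      (izp (c1 (pd_contDiff S.st j)) (sf.mul st) hc.mul_right j)).sub
      (izp ((su j).mul (contDiff_const (c := (1/2:ℝ)).mul (st.pow 2))) sf hc j)).sub
      (izp sp (hW j) (hWc j) j)).sub
      (izp (st.mul (sv j)) sf hc j)
  convert key using 2 with x
  have du := fun i => c1d (su i) x
  have dv := fun i => c1d (sv i) x
  have dt := c1d st x
  have df := c1d sf x
  have dw := fun i => c1d (hw i) x
  have sq : ∀ {f : R3 → ℝ}, DifferentiableAt ℝ f x → ∀ j, pd (fun y => f y ^ 2) j x = 2 * (f x * pd f j x) := by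
    intro f hf j
    have := pd_mul hf hf j
    have e : (fun y => f y ^ 2) = fun y => f y * f y := by ext; ring
    rw [e, this]; ring
  have p1 : ∀ i j, pd (fun y => φ y * u i y + w i y) j x = pd φ j x * u i x + φ x * pd (u i) j x + pd (w i) j x := by
    intro i j; rw [pd_add (df.fun_mul (du i)) (dw i), pd_mul df (du i)]
  have p2 : ∀ i j, pd (fun y => φ y * v i y) j x = pd φ j x * v i x + φ x * pd (v i) j x := fun i j => pd_mul df (dv i) j
  have p3 : ∀ i j k, pd (fun y => u j y * u i y) k x = pd (u j) k x * u i x + u j x * pd (u i) k x := fun i j k => pd_mul (du j) (du i) k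
  have p4 : ∀ i j k, pd (fun y => v j y * v i y) k x = pd (v j) k x * v i x + v j x * pd (v i) k x := fun i j k => pd_mul (dv j) (dv i) k
  have p5 : ∀ i j, pd (fun y => u j y * (1 / 2 * (u i y ^ 2 + v i y ^ 2))) j x = pd (u j) j x * (1 / 2 * (u i x ^ 2 + v i x ^ 2)) + u j x * (u i x * pd (u i) j x + v i x * pd (v i) j x) := by
    intro i j
    rw [pd_mul (du j) (((((du i).fun_pow 2).fun_add ((dv i).fun_pow 2))).const_mul _),
      pd_const_mul _ (((du i).fun_pow 2).fun_add ((dv i).fun_pow 2)), pd_add ((du i).fun_pow 2) ((dv i).fun_pow 2), sq (du i), sq (dv i)]; ring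
  have p6 : ∀ j, pd (fun y => φ y * θ y) j x = pd φ j x * θ x + φ x * pd θ j x := fun j => pd_mul df dt j
  have p7 : ∀ j, pd (fun y => u j y * (1 / 2 * θ y ^ 2)) j x = pd (u j) j x * (1 / 2 * θ x ^ 2) + u j x * (θ x * pd θ j x) := by
    intro j
    rw [pd_mul (du j) ((dt.fun_pow 2).const_mul _), pd_const_mul _ (dt.fun_pow 2), sq dt]; ring
  have p8 : ∀ j, pd (fun y => θ y * v j y) j x = pd θ j x * v j x + θ x * pd (v j) j x := fun j => pd_mul dt (dv j) j
  simp only [p1, p2, p3, p4, p5, p6, p7, p8]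
  refine (alg_id (φ x) (θ x) (fun j => pd φ j x) (fun j => pd pr j x) (fun j => pd θ j x) (fun j => pd (pd θ j) j x)
    (fun j => u j x) (fun j => v j x) (fun j => w j x) (fun i j => pd (u i) j x) (fun i j => pd (v i) j x)
    (fun i j => pd (w i) j x) (fun i j => pd (pd (u i) j) j x) (fun i j => pd (pd (v i) j) j x) (fun i => ?_)
    (fun i => S.e2 i x) (S.e3 x) (S.e4 x) (hd x) (pr x)).symm
  have := S.e1 i x
  simp only [p4] at this
  exact this
end Energy2

section Cut
open scoped ContDiff ENNReal

structure Cut (K R : ℝ) (ψ : R3 → ℝ) : Prop where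
  sm : ContDiff ℝ ∞ ψ
  cs : HasCompactSupport ψ
  nn : ∀ x, 0 ≤ ψ x
  le1 : ∀ x, ψ x ≤ 1
  one : ∀ x, ‖x‖ ≤ R → ψ x = 1
  d0 : ∀ x, x ∉ Shell R → ∀ j, pd ψ j x = 0
  d1 : ∀ x j, |pd ψ j x| ≤ K * R⁻¹
  d2 : ∀ x j k, |pd (pd ψ j) k x| ≤ K * R⁻¹ ^ 2

lemma Shell_closed (R : ℝ) : IsClosed (Shell R) :=
  (isClosed_le continuous_const continuous_norm).inter (isClosed_le continuous_norm continuous_const)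

lemma exists_cut : ∃ K : ℝ, 0 ≤ K ∧ ∀ R : ℝ, 0 < R → ∃ ψ, Cut K R ψ := by
  obtain ⟨χ, hχ, hχs, χ0, χ1, χone, χz⟩ := cutoff (a := 1.92) (b := 1.94) (by norm_num) (by norm_num)
  choose K1 K10 hK1 using fun j => bdd_of_cs (pd_contDiff hχ j).continuous (pd_cs hχs j)
  choose K2 K20 hK2 using fun j : Fin 3 × Fin 3 => bdd_of_cs (pd_contDiff (pd_contDiff hχ j.1) j.2).continuous (pd_cs (pd_cs hχs j.1) j.2)
  have s1 : ∀ j, K1 j ≤ ∑ j, K1 j := fun j => Finset.single_le_sum (f := K1) (fun i _ => K10 i) (Finset.mem_univ j)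
  have s2 : ∀ j, K2 j ≤ ∑ j, K2 j := fun j => Finset.single_le_sum (f := K2) (fun i _ => K20 i) (Finset.mem_univ j)
  have n1 : 0 ≤ ∑ j, K1 j := Finset.sum_nonneg fun i _ => K10 i
  have n2 : 0 ≤ ∑ j, K2 j := Finset.sum_nonneg fun i _ => K20 i
  refine ⟨∑ j, K1 j + ∑ j, K2 j, by positivity, fun R hR => ⟨fun x => χ (R⁻¹ • x), ?_⟩⟩
  have hRi : 0 < R⁻¹ := by positivity
  have hn : ∀ x : R3, ‖R⁻¹ • x‖ = R⁻¹ * ‖x‖ := fun x => by rw [norm_smul, Real.norm_eq_abs, abs_of_pos hRi]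
  have hle : ∀ (x : R3) c, ‖x‖ ≤ c * R → ‖R⁻¹ • x‖ ≤ c := fun x c h => by
    rw [hn, inv_mul_le_iff₀ hR]; linarith
  have hge : ∀ (x : R3) c, c * R ≤ ‖x‖ → c ≤ ‖R⁻¹ • x‖ := fun x c h => by
    rw [hn, le_inv_mul_iff₀ hR]; linarith
  have e1 : ∀ x j, pd (fun x => χ (R⁻¹ • x)) j x = R⁻¹ * pd χ j (R⁻¹ • x) := fun x j =>
    pd_scale _ x (c1d (c1 hχ) _) j
  refine ⟨hχ.comp (contDiff_const_smul _), hχs.comp_smul (by positivity), fun x => χ0 _, fun x => χ1 _,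
    fun x hx => χone _ (hle x _ (by linarith)), fun x hx j => ?_, fun x j => ?_, fun x j k => ?_⟩
  · by_cases h : ‖x‖ < 1.91 * R
    · apply pd_eq_zero (c := 1)
      filter_upwards [(isOpen_lt continuous_norm continuous_const).mem_nhds h] with y hy
      have hy' : ‖y‖ < 1.91 * R := hy
      exact χone _ (hle y _ (by norm_num at hy' ⊢; linarith))
    · have h2 : 1.95 * R < ‖x‖ := by
        by_contra h3; exact hx ⟨not_lt.1 h, not_lt.1 h3⟩
      apply pd_eq_zero (c := 0)
      filter_upwards [(isOpen_lt continuous_const continuous_norm).mem_nhds h2] with y hy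
      have hy' : 1.95 * R < ‖y‖ := hy
      exact χz _ (hge y _ (by norm_num at hy' ⊢; linarith))
  · rw [e1, abs_mul, abs_of_pos hRi, mul_comm]
    exact mul_le_mul_of_nonneg_right ((hK1 j _).trans (by linarith [s1 j])) hRi.le
  · have : pd (fun x => χ (R⁻¹ • x)) j = fun x => R⁻¹ * pd χ j (R⁻¹ • x) := funext fun x => e1 x j
    have hs := pd_contDiff hχ j
    have hd : DifferentiableAt ℝ (fun y : R3 => pd χ j (R⁻¹ • y)) x := c1d ((c1 hs).comp (contDiff_const_smul _)) x
    rw [this, pd_const_mul _ hd, pd_scale _ x (c1d (c1 hs) _), ← mul_assoc, abs_mul,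
      ← sq, abs_of_pos (pow_pos hRi 2), mul_comm]
    exact mul_le_mul_of_nonneg_right ((hK2 (j, k) _).trans (by linarith [s2 (j, k)])) (by positivity)

variable {K R : ℝ} {ψ : R3 → ℝ}

lemma pd_pow' {f : R3 → ℝ} {x : R3} (hf : DifferentiableAt ℝ f x) (n : ℕ) (j : Fin 3) :
    pd (fun y => f y ^ n) j x = n * f x ^ (n - 1) * pd f j x := by
  unfold pd; rw [fderiv_fun_pow _ hf]; simp

lemma Cut.p1 (c : Cut K R ψ) (n : ℕ) (x j) : pd (fun y => ψ y ^ n) j x = n * ψ x ^ (n - 1) * pd ψ j x :=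
  pd_pow' (c1d (c1 c.sm) x) n j

lemma Cut.p20 (c : Cut K R ψ) (x j) : |pd (fun y => ψ y ^ 20) j x| ≤ 20 * K * R⁻¹ * ψ x ^ 19 := by
  rw [c.p1, abs_mul, abs_of_nonneg (by have := c.nn x; positivity)]
  have := mul_le_mul_of_nonneg_left (c.d1 x j) (by have := c.nn x; positivity : 0 ≤ 20 * ψ x ^ 19)
  norm_num; linarith

lemma Cut.p20' (c : Cut K R ψ) (hK : 0 ≤ K) (hR : 0 < R) (x j k) : |pd (pd (fun y => ψ y ^ 20) j) k x| ≤ (380 * K ^ 2 + 20 * K) * R⁻¹ ^ 2 * ψ x ^ 18 := by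
  have e : pd (fun y => ψ y ^ 20) j = fun x => 20 * (ψ x ^ 19 * pd ψ j x) := by
    funext y; rw [c.p1]; norm_num; ring
  have hd := c1d (c1 c.sm) x
  have hd2 := c1d (c1 (pd_contDiff c.sm j)) x
  have h0 := c.nn x
  rw [e, pd_const_mul _ ((hd.fun_pow 19).fun_mul hd2), pd_mul (hd.fun_pow 19) hd2, c.p1]
  have a1 : |pd ψ k x * pd ψ j x| ≤ (K * R⁻¹) * (K * R⁻¹) := by
    rw [abs_mul]; exact mul_le_mul (c.d1 x k) (c.d1 x j) (abs_nonneg _) (by positivity)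
  have a2 := c.d2 x j k
  have a3 : ψ x ^ 19 ≤ ψ x ^ 18 := pow_le_pow_of_le_one h0 (c.le1 x) (by norm_num)
  have a4 : 0 ≤ ψ x ^ 18 := by positivity
  calc _ = |380 * ψ x ^ 18 * (pd ψ k x * pd ψ j x) + 20 * ψ x ^ 19 * pd (pd ψ j) k x| := by congr 1; norm_num; ring
    _ ≤ 380 * ψ x ^ 18 * |pd ψ k x * pd ψ j x| + 20 * ψ x ^ 19 * |pd (pd ψ j) k x| := by
        refine (abs_add_le _ _).trans (le_of_eq ?_)
        rw [abs_mul, abs_mul (20 * _), abs_of_nonneg (by positivity : 0 ≤ 380 * ψ x ^ 18), abs_of_nonneg (by positivity : 0 ≤ 20 * ψ x ^ 19)]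
    _ ≤ 380 * ψ x ^ 18 * ((K * R⁻¹) * (K * R⁻¹)) + 20 * ψ x ^ 18 * (K * R⁻¹ ^ 2) := by gcongr
    _ = _ := by ring

lemma Cut.z20 (c : Cut K R ψ) {x} (hx : x ∉ Shell R) (n : ℕ) (j) : pd (fun y => ψ y ^ n) j x = 0 := by
  rw [c.p1, c.d0 x hx]; ring

lemma zero_near {f : R3 → ℝ} (h : ∀ x, x ∉ Shell R → f x = 0) {x} (hx : x ∉ Shell R) (k : Fin 3) : pd f k x = 0 := by
  apply pd_eq_zero (c := 0)
  filter_upwards [(Shell_closed R).isOpen_compl.mem_nhds hx] with y hy using h y hy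

def wF (φ : R3 → ℝ) (A : Fin 3 → R3 → ℝ) (m : Fin 3) (x : R3) : ℝ :=
  pd φ (m + 1) x * A (m + 2) x - pd φ (m + 2) x * A (m + 1) x

lemma pd_wF {φ : R3 → ℝ} {A : Fin 3 → R3 → ℝ} (hφ : ContDiff ℝ ∞ φ) (hA : ∀ i, ContDiff ℝ 1 (A i)) (m j x) :
    pd (wF φ A m) j x = pd (pd φ (m + 1)) j x * A (m + 2) x + pd φ (m + 1) x * pd (A (m + 2)) j x
      - (pd (pd φ (m + 2)) j x * A (m + 1) x + pd φ (m + 2) x * pd (A (m + 1)) j x) := by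
  have d := fun k => c1d (c1 (pd_contDiff hφ k)) x
  have a := fun k => c1d (hA k) x
  unfold wF
  rw [pd_sub ((d _).fun_mul (a _)) ((d _).fun_mul (a _)), pd_mul (d _) (a _), pd_mul (d _) (a _)]

lemma div_wF {φ : R3 → ℝ} {A : Fin 3 → R3 → ℝ} (hφ : ContDiff ℝ ∞ φ) (hA : ∀ i, ContDiff ℝ 1 (A i)) (x) :
    ∑ j, pd (wF φ A j) j x = -∑ j, pd φ j x * curlF A j x := by
  simp only [pd_wF hφ hA, curlF, Fin.sum_univ_three]
  have h01 := pd_comm hφ 0 1 x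
  have h02 := pd_comm hφ 0 2 x
  have h12 := pd_comm hφ 1 2 x
  simp only [show (0:Fin 3) + 1 = 1 from rfl, show (0:Fin 3) + 2 = 2 from rfl, show (1:Fin 3) + 1 = 2 from rfl,
    show (1:Fin 3) + 2 = 0 from rfl, show (2:Fin 3) + 1 = 0 from rfl, show (2:Fin 3) + 2 = 1 from rfl, h01, h02, h12]
  ring
end Cut

section Pw
open scoped ContDiff ENNReal

def Bd (ρ s a n t : ℝ) : ℝ :=
  ρ ^ 2 * a ^ 2 + ρ * a ^ 3 + ρ * (s ^ 18 * (n ^ 2 * a)) + ρ * (s ^ 18 * (t ^ 2 * a)) + ρ ^ 2 * (s ^ 18 * n ^ 2)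
    + ρ ^ 2 * (s ^ 18 * t ^ 2) + ρ * (s ^ 18 * (t * n))

lemma am {a b A B : ℝ} (h : |a| ≤ A) (k : |b| ≤ B) : |a * b| ≤ A * B := by
  rw [abs_mul]; exact mul_le_mul h k (abs_nonneg _) ((abs_nonneg _).trans h)

lemma pw {M ρ s a n th g : ℝ} {dφ dt U V : Fin 3 → ℝ} {du dv dw : Fin 3 → Fin 3 → ℝ} (hM : 0 ≤ M) (hρ : 0 ≤ ρ)
    (hs : 0 ≤ s) (hs1 : s ≤ 1) (ha : 0 ≤ a) (hn : 0 ≤ n) (hg : 0 ≤ g)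
    (hφ : ∀ j, |dφ j| ≤ M * ρ * s ^ 19) (hw : ∀ i j, |dw i j| ≤ M * ρ * s ^ 18 * a)
    (hU : ∀ i, |U i| ≤ a) (hV : ∀ i, |V i| ≤ n) (hdu : ∀ i j, |du i j| ≤ g) (hdv : ∀ i j, |dv i j| ≤ g) (hdt : ∀ j, |dt j| ≤ g) :
    ∑ j, (∑ i, (- (dφ j * (U i * du i j + V i * dv i j)) + dφ j * V j * (V i * U i)
    + 1 / 2 * (U i ^ 2 + V i ^ 2) * (U j * dφ j)
    - du i j * dw i j + (U j * U i + V j * V i) * dw i j)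
    - dφ j * (th * dt j) + 1 / 2 * th ^ 2 * (U j * dφ j) + th * V j * dφ j) ≤
    1 / 2 * (s ^ 20 * g ^ 2) + (1000 * M ^ 2 + 100 * M) * Bd ρ s a n |th| := by
  set D := M * ρ * s ^ 19
  set E := M * ρ * s ^ 18
  set t := |th|
  have ht : 0 ≤ t := abs_nonneg _
  have hE : 0 ≤ E := by positivity
  have hDE : D ≤ E := mul_le_mul_of_nonneg_left (pow_le_pow_of_le_one hs hs1 (by norm_num)) (by positivity)
  have hD : 0 ≤ D := by positivity
  have T1 : ∀ i j, - (dφ j * (U i * du i j + V i * dv i j)) + dφ j * V j * (V i * U i)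
    + 1 / 2 * (U i ^ 2 + V i ^ 2) * (U j * dφ j) - du i j * dw i j + (U j * U i + V j * V i) * dw i j ≤
      2 * (E * a * g) + D * n * g + 2 * (E * a ^ 3) + 3 * (E * (n ^ 2 * a)) := by
    intro i j
    have b1 := (abs_le.1 (am (hφ j) (am (hU i) (hdu i j)))).1
    have b2 := (abs_le.1 (am (hφ j) (am (hV i) (hdv i j)))).1
    have b3 := (abs_le.1 (am (am (hφ j) (hV j)) (am (hV i) (hU i)))).2
    have b4 := (abs_le.1 (am (am (hU i) (hU i)) (am (hU j) (hφ j)))).2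
    have b5 := (abs_le.1 (am (am (hV i) (hV i)) (am (hU j) (hφ j)))).2
    have b6 := (abs_le.1 (am (hdu i j) (hw i j))).1
    have b7 := (abs_le.1 (am (am (hU j) (hU i)) (hw i j))).2
    have b8 := (abs_le.1 (am (am (hV j) (hV i)) (hw i j))).2
    have c1 := mul_le_mul_of_nonneg_right hDE (by positivity : 0 ≤ a * g)
    have c2 := mul_le_mul_of_nonneg_right hDE (by positivity : 0 ≤ a ^ 3)
    have c3 := mul_le_mul_of_nonneg_right hDE (by positivity : 0 ≤ n ^ 2 * a)
    have d1 : 0 ≤ E * a ^ 3 := by positivity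
    have d2 : 0 ≤ E * (n ^ 2 * a) := by positivity
    linarith only [b1, b2, b3, b4, b5, b6, b7, b8, c1, c2, c3, d1, d2]
  have T2 : ∀ j, - (dφ j * (th * dt j)) + 1 / 2 * th ^ 2 * (U j * dφ j) + th * V j * dφ j ≤ D * t * g + E * (t ^ 2 * a) + E * (t * n) := by
    intro j
    have b1 := (abs_le.1 (am (hφ j) (am le_rfl (hdt j) : |th * dt j| ≤ t * g))).1
    have b2 := (abs_le.1 (am (am le_rfl le_rfl : |th * th| ≤ t * t) (am (hU j) (hφ j)))).2
    have b3 := (abs_le.1 (am (am le_rfl (hV j) : |th * V j| ≤ t * n) (hφ j))).2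
    have c2 := mul_le_mul_of_nonneg_right hDE (by positivity : 0 ≤ t ^ 2 * a)
    have c3 := mul_le_mul_of_nonneg_right hDE (by positivity : 0 ≤ t * n)
    have d2 : 0 ≤ E * (t ^ 2 * a) := by positivity
    linarith only [b1, b2, b3, c2, c3, d2]
  have S : _ ≤ ∑ j : Fin 3, (∑ i : Fin 3, (2 * (E * a * g) + D * n * g + 2 * (E * a ^ 3) + 3 * (E * (n ^ 2 * a))) + (D * t * g + E * (t ^ 2 * a) + E * (t * n))) :=
    Finset.sum_le_sum fun j _ => add_le_add (Finset.sum_le_sum fun i _ => T1 i j) (T2 j)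
  have S' : ∑ j : Fin 3, (∑ i : Fin 3, (2 * (E * a * g) + D * n * g + 2 * (E * a ^ 3) + 3 * (E * (n ^ 2 * a))) + (D * t * g + E * (t ^ 2 * a) + E * (t * n)))
      = 18 * (E * a * g) + 9 * (D * n * g) + 18 * (E * a ^ 3) + 27 * (E * (n ^ 2 * a)) + 3 * (D * t * g) + 3 * (E * (t ^ 2 * a)) + 3 * (E * (t * n)) := by
    simp only [Fin.sum_univ_three]; ring
  rw [S'] at S
  have y1 : 18 * (E * a * g) ≤ 1 / 8 * (s ^ 20 * g ^ 2) + 648 * M ^ 2 * (ρ ^ 2 * a ^ 2) := by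
    have q := sq_nonneg (s ^ 10 * g - 72 * (M * ρ * s ^ 8 * a))
    have r : (M * ρ * a) ^ 2 * s ^ 16 ≤ (M * ρ * a) ^ 2 * 1 := mul_le_mul_of_nonneg_left (pow_le_one₀ hs hs1) (by positivity)
    simp only [E]; nlinarith only [q, r]
  have y2 : 9 * (D * n * g) ≤ 1 / 8 * (s ^ 20 * g ^ 2) + 162 * M ^ 2 * (ρ ^ 2 * (s ^ 18 * n ^ 2)) := by
    have q := sq_nonneg (s ^ 10 * g - 36 * (M * ρ * s ^ 9 * n))
    simp only [D]; nlinarith only [q]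
  have y3 : 3 * (D * t * g) ≤ 1 / 8 * (s ^ 20 * g ^ 2) + 162 * M ^ 2 * (ρ ^ 2 * (s ^ 18 * t ^ 2)) := by
    have q := sq_nonneg (s ^ 10 * g - 12 * (M * ρ * s ^ 9 * t))
    have r : 0 ≤ M ^ 2 * (ρ ^ 2 * (s ^ 18 * t ^ 2)) := by positivity
    simp only [D]; nlinarith only [q, r]
  have z1 : E * a ^ 3 ≤ M * (ρ * a ^ 3) := by
    have r : (M * ρ * a ^ 3) * s ^ 18 ≤ (M * ρ * a ^ 3) * 1 := mul_le_mul_of_nonneg_left (pow_le_one₀ hs hs1) (by positivity)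
    simp only [E]; linarith
  have g0 : 0 ≤ s ^ 20 * g ^ 2 := by positivity
  have h1 : 0 ≤ ρ ^ 2 * a ^ 2 := by positivity
  have h2 : 0 ≤ ρ * a ^ 3 := by positivity
  have h3 : 0 ≤ ρ * (s ^ 18 * (n ^ 2 * a)) := by positivity
  have h4 : 0 ≤ ρ * (s ^ 18 * (t ^ 2 * a)) := by positivity
  have h5 : 0 ≤ ρ ^ 2 * (s ^ 18 * n ^ 2) := by positivity
  have h6 : 0 ≤ ρ ^ 2 * (s ^ 18 * t ^ 2) := by positivity
  have h7 : 0 ≤ ρ * (s ^ 18 * (t * n)) := by positivity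
  have m1 := mul_nonneg (sq_nonneg M) h1
  have m2 := mul_nonneg (sq_nonneg M) h2
  have m3 := mul_nonneg (sq_nonneg M) h3
  have m4 := mul_nonneg (sq_nonneg M) h4
  have m5 := mul_nonneg (sq_nonneg M) h5
  have m6 := mul_nonneg (sq_nonneg M) h6
  have m7 := mul_nonneg (sq_nonneg M) h7
  have k1 := mul_nonneg hM h1
  have k2 := mul_nonneg hM h2
  have k3 := mul_nonneg hM h3
  have k4 := mul_nonneg hM h4
  have k5 := mul_nonneg hM h5
  have k6 := mul_nonneg hM h6
  have k7 := mul_nonneg hM h7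
  refine le_trans (le_of_eq ?_) (S.trans ?_)
  · simp only [Fin.sum_univ_three]; ring
  · unfold Bd; simp only [E] at z1 ⊢; simp only [D] at *
    nlinarith only [y1, y2, y3, z1, g0, m1, m2, m3, m4, m5, m6, m7, k1, k2, k3, k4, k5, k6, k7]
end Pw

section En
open scoped ContDiff ENNReal
variable {u v : Fin 3 → R3 → ℝ} {pr θ : R3 → ℝ} {K R : ℝ} {ψ : R3 → ℝ}

lemma GG_nonneg (x) : 0 ≤ GG u v θ x := by unfold GG; positivity

lemma GG_le (x) : (∀ i j, |pd (u i) j x| ≤ √(GG u v θ x)) ∧ (∀ i j, |pd (v i) j x| ≤ √(GG u v θ x)) ∧ ∀ j, |pd θ j x| ≤ √(GG u v θ x) := by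
  have h : ∀ j, (∑ i, ((pd (u i) j x) ^ 2 + (pd (v i) j x) ^ 2) + (pd θ j x) ^ 2) ≤ GG u v θ x := fun j =>
    Finset.single_le_sum (f := fun j => (∑ i, ((pd (u i) j x) ^ 2 + (pd (v i) j x) ^ 2) + (pd θ j x) ^ 2)) (fun i _ => by positivity) (Finset.mem_univ j)
  have h' : ∀ i j, (pd (u i) j x) ^ 2 + (pd (v i) j x) ^ 2 ≤ ∑ i, ((pd (u i) j x) ^ 2 + (pd (v i) j x) ^ 2) := fun i j =>
    Finset.single_le_sum (f := fun i => (pd (u i) j x) ^ 2 + (pd (v i) j x) ^ 2) (fun i _ => by positivity) (Finset.mem_univ i)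
  refine ⟨fun i j => Real.abs_le_sqrt ?_, fun i j => Real.abs_le_sqrt ?_, fun j => Real.abs_le_sqrt ?_⟩
  · nlinarith only [h j, h' i j, sq_nonneg (pd (v i) j x), sq_nonneg (pd θ j x)]
  · nlinarith only [h j, h' i j, sq_nonneg (pd (u i) j x), sq_nonneg (pd θ j x)]
  · have := h j
    have : 0 ≤ ∑ i, ((pd (u i) j x) ^ 2 + (pd (v i) j x) ^ 2) := by positivity
    linarith [h j]

lemma Sol.gc (S : Sol u v pr θ) : Continuous (GG u v θ) := by
  have h1 := fun i j => pd_cont (c1 (S.su i)) j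
  have h2 := fun i j => pd_cont (c1 (S.sv i)) j
  have h3 := fun j => pd_cont (c1 S.st) j
  unfold GG; fun_prop

def aF (u A : Fin 3 → R3 → ℝ) (R : ℝ) (x : R3) : ℝ := ∑ l, |R⁻¹ * A l x| + ∑ l, ∑ k, |pd (A l) k x| + ∑ n, |u n x|

def nF (v : Fin 3 → R3 → ℝ) (x : R3) : ℝ := ∑ n, |v n x|

lemma le_nF (i x) : |v i x| ≤ nF v x := Finset.single_le_sum (f := fun i => |v i x|) (fun i _ => abs_nonneg _) (Finset.mem_univ i)

lemma nF_nonneg (x) : 0 ≤ nF v x := by unfold nF; positivity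

lemma aF_nonneg {A} (x) : 0 ≤ aF u A R x := by unfold aF; positivity

lemma aF_ge {A} (x) : (∀ l, |R⁻¹ * A l x| ≤ aF u A R x) ∧ (∀ l k, |pd (A l) k x| ≤ aF u A R x) ∧ ∀ l, |u l x| ≤ aF u A R x := by
  have h1 : 0 ≤ ∑ l, |R⁻¹ * A l x| := by positivity
  have h2 : 0 ≤ ∑ l, ∑ k, |pd (A l) k x| := by positivity
  have h3 : 0 ≤ ∑ n, |u n x| := by positivity
  refine ⟨fun l => ?_, fun l k => ?_, fun l => ?_⟩
  · have : |R⁻¹ * A l x| ≤ ∑ l, |R⁻¹ * A l x| := le_nF (v := fun l x => R⁻¹ * A l x) l x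
    unfold aF; linarith
  · have a1 : |pd (A l) k x| ≤ ∑ k, |pd (A l) k x| := le_nF (v := fun k x => pd (A l) k x) k x
    have a2 : ∑ k, |pd (A l) k x| ≤ ∑ l, ∑ k, |pd (A l) k x| := Finset.single_le_sum (f := fun l => ∑ k, |pd (A l) k x|) (fun i _ => by positivity) (Finset.mem_univ l)
    unfold aF; linarith
  · have : |u l x| ≤ ∑ l, |u l x| := le_nF l x
    unfold aF; linarith

lemma lp_aF {p : ℝ} (hp : 1 ≤ p) (hu : ∀ i, Continuous (u i)) {A : Fin 3 → R3 → ℝ} (hA : ∀ i, ContDiff ℝ 1 (A i)) {s : Set R3}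
    (hs : MeasurableSet s) {c : ℝ} (hc : 0 ≤ c) {S : ℝ≥0∞} (b1 : ∀ l, LI p s (fun x => R⁻¹ * A l x) ≤ ENNReal.ofReal c * S)
    (b2 : ∀ l k, LI p s (pd (A l) k) ≤ ENNReal.ofReal c * S) (b3 : ∀ n, LI p s (u n) ≤ ENNReal.ofReal c * S) :
    LI p s (aF u A R) ≤ ENNReal.ofReal (15 ^ p * c) * S := by
  have := lp_dom (ι := Fin 3 ⊕ (Fin 3 × Fin 3) ⊕ Fin 3) (g := aF u A R) (K := 1) hp hs
    (h := Sum.elim (fun l x => R⁻¹ * A l x) (Sum.elim (fun lk => pd (A lk.1) lk.2) u)) (c := c) (S := S) ?_ zero_le_one hc ?_ ?_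
  · simpa [LI] using this
  · rintro (l | l | l)
    · exact ((hA l).continuous.measurable).const_mul _
    · exact (pd_cont (hA l.1) l.2).measurable
    · exact (hu l).measurable
  · intro x _
    rw [abs_of_nonneg (aF_nonneg x), one_mul, aF]
    simp [Fintype.sum_sum_type, Fintype.sum_prod_type, add_assoc]
  · rintro (l | l | l)
    · exact b1 l
    · exact b2 _ _
    · exact b3 l

lemma ofReal_int_le {F : R3 → ℝ} (hF : Integrable F) : ENNReal.ofReal (∫ x, F x) ≤ ∫⁻ x, ENNReal.ofReal (F x) := by
  have h := ofReal_integral_eq_lintegral_ofReal hF.pos_part (Eventually.of_forall fun x => le_max_right _ _)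
  have e : ∀ x, ENNReal.ofReal (max (F x) 0) = ENNReal.ofReal (F x) := fun x => by
    rcases le_total (F x) 0 with h | h <;> simp [h]
  simp only [e] at h
  rw [← h]
  exact ENNReal.ofReal_le_ofReal (integral_mono hF hF.pos_part fun x => le_max_left _ _)

lemma en_est (S : Sol u v pr θ) (hK : 0 ≤ K) (hR : 0 < R) (c : Cut K R ψ) {A : Fin 3 → R3 → ℝ} (hA : ∀ i, ContDiff ℝ 1 (A i))
    (hcurl : ∀ x ∈ Shell R, ∀ m, curlF A m x = u m x) {M : ℝ} (hM : M = 2 * (380 * K ^ 2 + 40 * K)) :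
    ∫⁻ x, ENNReal.ofReal (1 / 2 * (ψ x ^ 20 * GG u v θ x)) ≤
      ∫⁻ x in Shell R, ENNReal.ofReal ((1000 * M ^ 2 + 100 * M) * Bd R⁻¹ (ψ x) (aF u A R x) (nF v x) |θ x|) := by
  set φ : R3 → ℝ := fun y => ψ y ^ 20 with hφd
  have sφ : ContDiff ℝ ∞ φ := c.sm.pow 20
  have cφ : HasCompactSupport φ := c.cs.comp_left (g := fun t : ℝ => t ^ 20) (by norm_num)
  have hw : ∀ i, ContDiff ℝ 1 (wF φ A i) := fun i =>
    ((c1 (pd_contDiff sφ _)).mul (hA _)).sub ((c1 (pd_contDiff sφ _)).mul (hA _))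
  have hwc : ∀ i, HasCompactSupport (wF φ A i) := fun i => by
    have := ((pd_cs cφ (i + 1)).mul_right (f' := A (i + 2))).sub ((pd_cs cφ (i + 2)).mul_right (f' := A (i + 1)))
    exact this
  have z1 : ∀ x, x ∉ Shell R → ∀ j, pd φ j x = 0 := fun x hx j => c.z20 hx 20 j
  have z2 : ∀ x, x ∉ Shell R → ∀ i j, pd (wF φ A i) j x = 0 := fun x hx i j =>
    zero_near (fun y hy => by simp only [wF, z1 y hy]; ring) hx j
  have iz := energy S sφ cφ hw hwc fun x => by
    rw [div_wF sφ hA]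
    by_cases hx : x ∈ Shell R
    · simp only [hcurl x hx]
    · simp only [z1 x hx, zero_mul]
  have M0 : 0 ≤ M := by rw [hM]; positivity
  have i1 : Integrable fun x => 1 / 2 * (φ x * GG u v θ x) :=
    ((c.sm.continuous.pow 20).mul S.gc |>.integrable_of_hasCompactSupport cφ.mul_right).const_mul _
  have i2 : Integrable fun x => RHS u v θ φ (wF φ A) x - 1 / 2 * (φ x * GG u v θ x) := by
    refine (i1.sub iz.1).congr (Eventually.of_forall fun x => ?_)
    simp only [Pi.sub_apply]; ring
  have e : ∫ x, 1 / 2 * (φ x * GG u v θ x) = ∫ x, (RHS u v θ φ (wF φ A) x - 1 / 2 * (φ x * GG u v θ x)) := by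
    have := integral_sub i1 iz.1
    rw [iz.2, sub_zero] at this
    rw [← this]; congr 1; funext x; ring
  rw [← ofReal_integral_eq_lintegral_ofReal i1 (Eventually.of_forall fun x => by
    have := GG_nonneg (u := u) (v := v) (θ := θ) x; have := c.nn x; simp only [hφd, Pi.zero_apply]; positivity), e]
  refine (ofReal_int_le i2).trans ?_
  rw [← lintegral_indicator (Shell_meas R)]
  refine lintegral_mono fun x => ?_
  have G0 := GG_nonneg (u := u) (v := v) (θ := θ) x
  have s0 := c.nn x
  by_cases hx : x ∈ Shell R
  · rw [Set.indicator_of_mem hx]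
    apply ENNReal.ofReal_le_ofReal
    obtain ⟨g1, g2, g3⟩ := GG_le (u := u) (v := v) (θ := θ) x
    obtain ⟨a1, a2, a3⟩ := aF_ge (u := u) (A := A) (R := R) x
    have a0 := aF_nonneg (u := u) (A := A) (R := R) x
    have Ri : 0 < R⁻¹ := by positivity
    have hD : ∀ j, |pd φ j x| ≤ 20 * K * R⁻¹ * ψ x ^ 19 := c.p20 x
    have s1 : ψ x ^ 19 ≤ ψ x ^ 18 := pow_le_pow_of_le_one s0 (c.le1 x) (by norm_num)
    have := pw (M := M) (ρ := R⁻¹) (s := ψ x) (a := aF u A R x) (n := nF v x) (th := θ x) (g := √(GG u v θ x)) (U := fun i => u i x)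
      (V := fun i => v i x) (dφ := fun j => pd φ j x) (dw := fun i j => pd (wF φ A i) j x) (du := fun i j => pd (u i) j x)
      (dv := fun i j => pd (v i) j x) (dt := fun j => pd θ j x) M0 Ri.le s0 (c.le1 x) a0 (nF_nonneg x) (Real.sqrt_nonneg _) ?_ ?_
      a3 (fun i => le_nF i x) g1 g2 g3
    · rw [Real.sq_sqrt G0] at this
      have t : RHS u v θ φ (wF φ A) x ≤ _ := this
      simp only [hφd] at t ⊢; linarith
    · intro j
      refine (hD j).trans ?_
      have : 20 * K ≤ M := by rw [hM]; nlinarith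
      gcongr
    · intro i j
      have t1 : ∀ k l, |pd (pd φ k) j x * A l x| ≤ (380 * K ^ 2 + 20 * K) * R⁻¹ * ψ x ^ 18 * aF u A R x := fun k l => by
        have b1 := c.p20' hK hR x k j
        have e : pd (pd φ k) j x * A l x = R * pd (pd φ k) j x * (R⁻¹ * A l x) := by field_simp
        rw [e]
        refine am ?_ (a1 l)
        rw [abs_mul, abs_of_pos hR]
        refine (mul_le_mul_of_nonneg_left b1 hR.le).trans (le_of_eq ?_)
        field_simp
      have t2 : ∀ k l, |pd φ k x * pd (A l) j x| ≤ 20 * K * R⁻¹ * ψ x ^ 18 * aF u A R x := fun k l =>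
        am ((hD k).trans (by gcongr)) (a2 l j)
      rw [pd_wF sφ hA]
      refine (abs_sub _ _).trans ((add_le_add (abs_add_le _ _) (abs_add_le _ _)).trans ?_)
      have := t1 (i + 1) (i + 2)
      have := t1 (i + 2) (i + 1)
      have := t2 (i + 1) (i + 2)
      have := t2 (i + 2) (i + 1)
      rw [hM]; linarith
  · rw [Set.indicator_of_notMem hx]
    simp only [nonpos_iff_eq_zero, ENNReal.ofReal_eq_zero]
    have : RHS u v θ φ (wF φ A) x = 0 := by simp [RHS, z1 x hx, z2 x hx]
    rw [this]
    simp only [hφd]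
    have : 0 ≤ ψ x ^ 20 * GG u v θ x := by positivity
    linarith
end En

section Hol
open scoped ContDiff ENNReal

lemma hol {S : Set R3} {f : Fin 4 → R3 → ℝ} (hf : ∀ i, Measurable (f i)) {e m A : Fin 4 → ℝ} (he : ∀ i, 0 < e i) (hm : ∀ i, 0 ≤ m i)
    (hA : ∀ i, 0 ≤ A i) (hb : ∀ i, LI (e i) S (f i) ≤ ENNReal.ofReal (A i ^ e i)) {V d : ℝ} (hV : 0 ≤ V) (hd : 0 ≤ d)
    (hS : volume S ≤ ENNReal.ofReal V) (hsum : ∑ i, m i / e i + d = 1) :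
    ∫⁻ x in S, ENNReal.ofReal (∏ i, |f i x| ^ m i) ≤ ENNReal.ofReal ((∏ i, A i ^ m i) * V ^ d) := by
  have h := ENNReal.lintegral_prod_norm_pow_le (μ := volume.restrict S) (Finset.univ : Finset (Option (Fin 4)))
    (f := fun o x => o.elim 1 fun i => ENNReal.ofReal (|f i x| ^ e i)) (p := fun o => o.elim d fun i => m i / e i)
    (by rintro (_ | i) _
        · exact aemeasurable_const
        · exact (LI_meas (hf i)).aemeasurable)
    (by rw [Fintype.sum_option]; simp only [Option.elim]; linarith)
    (by rintro (_ | i) _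
        · exact hd
        · exact div_nonneg (hm i) (he i).le)
  simp only [Fintype.prod_option, Option.elim, ENNReal.one_rpow, one_mul, lintegral_one, Measure.restrict_apply_univ] at h
  have e1 : ∀ x, ∏ i, ENNReal.ofReal (|f i x| ^ e i) ^ (m i / e i) = ENNReal.ofReal (∏ i, |f i x| ^ m i) := fun x => by
    rw [ENNReal.ofReal_prod_of_nonneg fun i _ => by positivity]
    refine Finset.prod_congr rfl fun i _ => ?_
    rw [ENNReal.ofReal_rpow_of_nonneg (by positivity) (div_nonneg (hm i) (he i).le), ← Real.rpow_mul (abs_nonneg _), mul_div_cancel₀ _ (he i).ne']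
  simp only [e1] at h
  refine h.trans ?_
  rw [mul_comm, ENNReal.ofReal_mul (Finset.prod_nonneg fun i _ => Real.rpow_nonneg (hA i) _), ENNReal.ofReal_prod_of_nonneg fun i _ => Real.rpow_nonneg (hA i) _,
    ← ENNReal.ofReal_rpow_of_nonneg hV hd]
  refine mul_le_mul' (Finset.prod_le_prod' fun i _ => ?_) (ENNReal.rpow_le_rpow hS hd)
  refine (ENNReal.rpow_le_rpow (hb i) (div_nonneg (hm i) (he i).le)).trans (le_of_eq ?_)
  rw [ENNReal.ofReal_rpow_of_nonneg (Real.rpow_nonneg (hA i) _) (div_nonneg (hm i) (he i).le), ← Real.rpow_mul (hA i), mul_div_cancel₀ _ (he i).ne']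

lemma holR {S : Set R3} {f : Fin 4 → R3 → ℝ} (hf : ∀ i, Measurable (f i)) {e m al X : Fin 4 → ℝ} (he : ∀ i, 0 < e i) (hm : ∀ i, 0 ≤ m i)
    (hX : ∀ i, 0 ≤ X i) {R : ℝ} (hR : 1 ≤ R) (hb : ∀ i, LI (e i) S (f i) ≤ ENNReal.ofReal ((X i * R ^ al i) ^ e i)) {W d k : ℝ} (hW : 1 ≤ W) (hd : 0 ≤ d) (hd1 : d ≤ 1)
    (hS : volume S ≤ ENNReal.ofReal (W * R ^ (3:ℝ))) (hsum : ∑ i, m i / e i + d = 1) (hk : ∑ i, al i * m i + 3 * d ≤ k) :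
    ∫⁻ x in S, ENNReal.ofReal (R ^ (-k) * ∏ i, |f i x| ^ m i) ≤ ENNReal.ofReal (W * ∏ i, X i ^ m i) := by
  have R0 : 0 < R := by linarith
  have h := hol hf he hm (fun i => mul_nonneg (hX i) (by positivity)) hb (by positivity) hd hS hsum
  have hP : 0 ≤ ∏ i, X i ^ m i := Finset.prod_nonneg fun i _ => Real.rpow_nonneg (hX i) _
  simp_rw [ENNReal.ofReal_mul (by positivity : 0 ≤ R ^ (-k))]
  rw [lintegral_const_mul' _ _ ENNReal.ofReal_ne_top]
  refine (mul_le_mul_right h _).trans ?_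
  rw [← ENNReal.ofReal_mul (by positivity)]
  apply ENNReal.ofReal_le_ofReal
  have e1 : ∏ i, (X i * R ^ al i) ^ m i = (∏ i, X i ^ m i) * R ^ (∑ i, al i * m i) := by
    rw [Real.rpow_sum_of_pos R0, ← Finset.prod_mul_distrib]
    refine Finset.prod_congr rfl fun i _ => ?_
    rw [Real.mul_rpow (hX i) (by positivity), ← Real.rpow_mul R0.le]
  rw [e1, Real.mul_rpow (by positivity) (by positivity), ← Real.rpow_mul R0.le]
  calc _ = (R ^ (-k) * R ^ (∑ i, al i * m i) * R ^ (3 * d)) * (W ^ d * ∏ i, X i ^ m i) := by ring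
    _ = R ^ (-k + ∑ i, al i * m i + 3 * d) * (W ^ d * ∏ i, X i ^ m i) := by rw [← Real.rpow_add R0, ← Real.rpow_add R0]
    _ ≤ 1 * (W ^ (1:ℝ) * ∏ i, X i ^ m i) := by
        refine mul_le_mul (Real.rpow_le_one_of_one_le_of_nonpos hR (by linarith)) ?_ (by positivity) zero_le_one
        exact mul_le_mul_of_nonneg_right (Real.rpow_le_rpow_of_exponent_le hW hd1) hP
    _ = _ := by rw [Real.rpow_one, one_mul]

structure Ex (p q r α β γ s t t' : ℝ) : Prop where
  p3 : 3 ≤ p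
  q1 : 1 ≤ q
  r2 : 2 ≤ r
  s0 : 0 < s
  s1 : s ≤ 0.8
  t0 : 0 < t
  t1 : t ≤ 0.8
  t0' : 0 < t'
  t1' : t' ≤ 0.8
  k1 : 2 * α + 3 * (1 - 2 / p) ≤ 2
  k2 : 3 * α + 3 * (1 - 3 / p) ≤ 1
  m3 : 1 / p + 2 * (1 - t) / q + 2 * t / 6 = 1
  k3 : α + β * (2 * (1 - t)) ≤ 1
  m4 : 1 / p + 2 * (1 - t') / r + 2 * t' / 6 = 1
  k4 : α + γ * (2 * (1 - t')) ≤ 1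
  m5 : 2 * (1 - s) / q + 2 * s / 6 = 1
  k5 : β * (2 * (1 - s)) ≤ 2
  k6 : γ + 3 * (5 / 6 - 1 / r) ≤ 2
  k7 : β * (1 - s) + γ + 3 * (1 / 2 - 1 / r) ≤ 1

lemma exists_Ex {p q r α β γ : ℝ} (hp1 : 3 ≤ p) (hp2 : p ≤ 9 / 2)
    (hq1 : 1 ≤ q) (hq2 : q < 2)
    (hr1 : 2 ≤ r) (hr2 : r < 2 * (p / (p - 1)))
    (hα1 : 0 ≤ α) (hα2 : α ≤ 3 / p - 2 / 3)
    (hβ1 : 0 ≤ β) (hβ2 : β ≤ 3 / q - 1 / 2)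
    (hγ1 : 0 ≤ γ) (hγ2 : γ ≤ 3 / r - 1 / 2)
    (hc1 : α + ((4 * p - 6) * q / ((6 - q) * p)) * β ≤ 1)
    (hc2 : α + ((4 * p - 6) * r / ((6 - r) * p)) * γ ≤ 1)
    (hc3 : (2 * q / (6 - q)) * β + γ ≤ (6 - r) / (2 * r)) : ∃ s t t', Ex p q r α β γ s t t' := by
  have p0 : 0 < p := by linarith
  have q0 : 0 < q := by linarith
  have r0 : 0 < r := by linarith
  have q6 : 0 < 6 - q := by linarith
  have hr3 : r * (p - 1) < 2 * p := by
    have := mul_lt_mul_of_pos_right hr2 (by linarith : 0 < p - 1)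
    rwa [mul_assoc, div_mul_cancel₀ _ (by linarith)] at this
  have r6 : 0 < 6 - r := by nlinarith
  have ip : 3 / p = 3 * (1 / p) ∧ 2 / p = 2 * (1 / p) := ⟨by ring, by ring⟩
  refine ⟨1 - 2 * q / (6 - q), 1 - (2 * p - 3) * q / ((6 - q) * p), 1 - (2 * p - 3) * r / ((6 - r) * p), hp1, hq1, hr1, ?_, ?_, ?_, ?_, ?_, ?_, ?_, ?_, ?_, ?_, ?_, ?_, ?_, ?_, ?_, ?_⟩
  · rw [sub_pos, div_lt_one q6]; linarith
  · have : 0.2 ≤ 2 * q / (6 - q) := by rw [le_div_iff₀ q6]; norm_num; linarith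
    norm_num at this ⊢; linarith
  · rw [sub_pos, div_lt_one (by positivity)]; nlinarith
  · have : 0.2 ≤ (2 * p - 3) * q / ((6 - q) * p) := by rw [le_div_iff₀ (by positivity)]; norm_num; nlinarith
    norm_num at this ⊢; linarith
  · rw [sub_pos, div_lt_one (by positivity)]; nlinarith
  · have : 0.2 ≤ (2 * p - 3) * r / ((6 - r) * p) := by rw [le_div_iff₀ (by positivity)]; norm_num; nlinarith
    norm_num at this ⊢; linarith
  · rw [ip.2]; rw [ip.1] at hα2; linarith
  · rw [ip.1] at hα2 ⊢; linarith
  · field_simp; ring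
  · refine le_trans (le_of_eq ?_) hc1; field_simp; ring
  · field_simp; ring
  · refine le_trans (le_of_eq ?_) hc2; field_simp; ring
  · field_simp; ring
  · have := mul_le_mul_of_nonneg_right hβ2 (by positivity : 0 ≤ 2 * (2 * q / (6 - q)))
    refine le_trans (le_of_eq ?_) (this.trans (le_of_eq ?_)) <;> field_simp <;> ring
  · have : 3 / r = 3 * (1 / r) := by ring
    rw [this] at hγ2; linarith
  · have : (6 - r) / (2 * r) = 3 * (1 / r) - 1 / 2 := by field_simp; norm_num
    rw [this] at hc3
    have : β * (1 - (1 - 2 * q / (6 - q))) = 2 * q / (6 - q) * β := by ring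
    rw [this]; linarith
end Hol

section BdS
open scoped ContDiff ENNReal

def Bnd (s t t' x y z H Θ : ℝ) : ℝ :=
  x ^ 2 + x ^ 3 + x * y ^ (2 * (1 - t)) * H ^ (2 * t) + x * z ^ (2 * (1 - t')) * Θ ^ (2 * t') + y ^ (2 * (1 - s)) * H ^ (2 * s)
    + z * Θ + y ^ (1 - s) * z * H ^ s

lemma psi_bd {ψ n k : ℝ} (h0 : 0 ≤ ψ) (h1 : ψ ≤ 1) (hn : 0 ≤ n) {b t : ℝ} (ht : 0 < t) (ht1 : t ≤ 1.8) (hb : b + t = k) (hb0 : 0 < b) :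
    ψ ^ 18 * n ^ k ≤ |n| ^ b * |ψ ^ 10 * n| ^ t := by
  rw [abs_of_nonneg hn, abs_of_nonneg (by positivity), Real.mul_rpow (by positivity) hn]
  have e : n ^ b * ((ψ ^ 10) ^ t * n ^ t) = ψ ^ (10 * t) * n ^ k := by
    rw [← hb, Real.rpow_add' hn (by linarith), ← Real.rpow_natCast ψ 10, ← Real.rpow_mul h0]; push_cast; ring
  rw [e]
  refine mul_le_mul_of_nonneg_right ?_ (by positivity)
  rcases h0.eq_or_lt with h | h
  · rw [← h, Real.zero_rpow (by positivity)]; norm_num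
  · rw [← Real.rpow_natCast]
    exact Real.rpow_le_rpow_of_exponent_ge h h1 (by norm_num at ht1 ⊢; linarith)

lemma lint_holR {S : Set R3} (hSm : MeasurableSet S) {R : ℝ} (hR : 1 ≤ R) {W : ℝ} (hW : 1 ≤ W) (hS : volume S ≤ ENNReal.ofReal (W * R ^ (3:ℝ)))
    {p q r α β γ x y z H : ℝ} (p0 : 0 < p) (q0 : 0 < q) (r0 : 0 < r) {a n θ h : R3 → ℝ} (ma : Measurable a) (mn : Measurable n) (mθ : Measurable θ) (mh : Measurable h)
    (ba : LI p S a ≤ ENNReal.ofReal ((x * R ^ α) ^ p)) (bn : LI q S n ≤ ENNReal.ofReal ((y * R ^ β) ^ q))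
    (bθ : LI r S θ ≤ ENNReal.ofReal ((z * R ^ γ) ^ r)) (bh : LI 6 S h ≤ ENNReal.ofReal (H ^ (6:ℝ)))
    (hx : 0 ≤ x) (hy : 0 ≤ y) (hz : 0 ≤ z) (hH : 0 ≤ H) {k : ℕ} {g : R3 → ℝ} (m0 m1 m2 m3 d : ℝ)
    (hg : ∀ w ∈ S, g w ≤ |a w| ^ m0 * |n w| ^ m1 * |θ w| ^ m2 * |h w| ^ m3)
    (n0 : 0 ≤ m0) (n1 : 0 ≤ m1) (n2 : 0 ≤ m2) (n3 : 0 ≤ m3) (hd : 0 ≤ d)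
    (hs : m0 / p + m1 / q + m2 / r + m3 / 6 + d = 1) (hk : α * m0 + β * m1 + γ * m2 + 3 * d ≤ k) :
    ∫⁻ w in S, ENNReal.ofReal (R⁻¹ ^ k * g w) ≤ ENNReal.ofReal (W * (x ^ m0 * y ^ m1 * z ^ m2 * H ^ m3)) := by
  have hd1 : d ≤ 1 := by
    have : 0 ≤ m0 / p := by positivity
    have : 0 ≤ m1 / q := by positivity
    have : 0 ≤ m2 / r := by positivity
    have : 0 ≤ m3 / 6 := by positivity
    linarith
  have key := holR (S := S) (f := ![a, n, θ, h]) (e := ![p, q, r, 6]) (m := ![m0, m1, m2, m3]) (al := ![α, β, γ, 0]) (X := ![x, y, z, H]) (d := d) (k := k) (W := W) (R := R)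
    (by intro i; fin_cases i <;> assumption) (by intro i; fin_cases i <;> first | assumption | norm_num)
    (by intro i; fin_cases i <;> assumption) (by intro i; fin_cases i <;> assumption) hR
    (by intro i; fin_cases i <;> first | assumption | simpa using bh) hW hd hd1 hS (by simpa [Fin.sum_univ_four] using hs) (by simpa [Fin.sum_univ_four] using hk)
  simp only [Fin.prod_univ_four, Matrix.cons_val] at key
  refine (setLIntegral_mono' hSm fun w hw => ENNReal.ofReal_le_ofReal ?_).trans key
  have e : R ^ (-(k:ℝ)) = R⁻¹ ^ k := by rw [Real.rpow_neg (by linarith), Real.rpow_natCast, inv_pow]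
  rw [e]
  exact mul_le_mul_of_nonneg_left (hg w hw) (by positivity)

lemma Bd_int {S : Set R3} (hSm : MeasurableSet S) {R : ℝ} (hR : 1 ≤ R) {W : ℝ} (hW : 1 ≤ W) (hS : volume S ≤ ENNReal.ofReal (W * R ^ (3:ℝ)))
    {p q r α β γ s t t' x y z H Θ : ℝ} (E : Ex p q r α β γ s t t') {a n θ ψ : R3 → ℝ} (ma : Measurable a) (mn : Measurable n) (mθ : Measurable θ) (mψ : Measurable ψ)
    (a0 : ∀ x, 0 ≤ a x) (nn0 : ∀ x, 0 ≤ n x) (ψ0 : ∀ x, 0 ≤ ψ x) (ψ1 : ∀ x, ψ x ≤ 1)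
    (ba : LI p S a ≤ ENNReal.ofReal ((x * R ^ α) ^ p)) (bn : LI q S n ≤ ENNReal.ofReal ((y * R ^ β) ^ q))
    (bθ : LI r S θ ≤ ENNReal.ofReal ((z * R ^ γ) ^ r)) (bh : LI 6 S (fun w => ψ w ^ 10 * n w) ≤ ENNReal.ofReal (H ^ (6:ℝ)))
    (bk : LI 6 S (fun w => ψ w ^ 10 * |θ w|) ≤ ENNReal.ofReal (Θ ^ (6:ℝ)))
    (hx : 0 ≤ x) (hy : 0 ≤ y) (hz : 0 ≤ z) (hH : 0 ≤ H) (hΘ : 0 ≤ Θ) :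
    (∫⁻ w in S, ENNReal.ofReal (Bd R⁻¹ (ψ w) (a w) (n w) |θ w|) ≤ ENNReal.ofReal (W * Bnd s t t' x y z H Θ)) ∧
    (∫⁻ w in S, ENNReal.ofReal (R⁻¹ ^ 2 * (ψ w ^ 18 * n w ^ 2)) ≤ ENNReal.ofReal (W * (y ^ (2 * (1 - s)) * H ^ (2 * s)))) ∧
    (∫⁻ w in S, ENNReal.ofReal (R⁻¹ ^ 2 * (ψ w ^ 18 * |θ w| ^ 2)) ≤ ENNReal.ofReal (W * (z * Θ))) := by
  obtain ⟨p3, q1, r2, s0, s1, t0, t1, t0', t1', k1, k2, m3, k3, m4, k4, m5, k5, k6, k7⟩ := E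
  norm_num at s1 t1 t1'
  have p0 : 0 < p := by linarith
  have q0 : 0 < q := by linarith
  have r0 : 0 < r := by linarith
  have ip : 3 / p = 3 * (1 / p) ∧ 2 / p = 2 * (1 / p) := ⟨by ring, by ring⟩
  have ip3 : 1 / p ≤ 1 / 3 := one_div_le_one_div_of_le (by norm_num) p3
  have ir : 1 / r ≤ 1 / 2 := one_div_le_one_div_of_le (by norm_num) r2
  have R0 : 0 < R := by linarith
  have Ri : 0 ≤ R⁻¹ := by positivity
  have r1 : ∀ c : ℝ, c ^ (1:ℝ) = c := Real.rpow_one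
  have r00 : ∀ c : ℝ, c ^ (0:ℝ) = 1 := Real.rpow_zero
  have mh : Measurable fun w => ψ w ^ 10 * n w := (mψ.pow_const 10).mul mn
  have mk : Measurable fun w => ψ w ^ 10 * |θ w| := (mψ.pow_const 10).mul mθ.abs
  have mab := mθ.abs
  have T := fun {k : ℕ} {g : R3 → ℝ} => lint_holR hSm hR hW hS p0 q0 r0 ma mn mθ mh ba bn bθ bh hx hy hz hH (k := k) (g := g)
  have T' := fun {k : ℕ} {g : R3 → ℝ} => lint_holR hSm hR hW hS p0 q0 r0 ma mn mθ mk ba bn bθ bk hx hy hz hΘ (k := k) (g := g)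
  have J1 := T (k := 2) (g := fun w => a w ^ 2) 2 0 0 0 (1 - 2 / p)
    (fun w _ => by simp only [r00, mul_one, abs_of_nonneg (a0 w)]; norm_cast) (by norm_num) le_rfl le_rfl le_rfl
    (by rw [ip.2]; linarith) (by ring) (by push_cast; linarith)
  have J2 := T (k := 1) (g := fun w => a w ^ 3) 3 0 0 0 (1 - 3 / p)
    (fun w _ => by simp only [r00, mul_one, abs_of_nonneg (a0 w)]; norm_cast) (by norm_num) le_rfl le_rfl le_rfl
    (by rw [ip.1]; linarith) (by ring) (by push_cast; linarith)
  have J3 := T (k := 1) (g := fun w => ψ w ^ 18 * (n w ^ 2 * a w)) 1 (2 * (1 - t)) 0 (2 * t) 0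
    (fun w _ => by
      have := psi_bd (ψ0 w) (ψ1 w) (nn0 w) (b := 2 * (1 - t)) (t := 2 * t) (k := 2) (by positivity) (by norm_num; linarith) (by ring) (by linarith)
      have := mul_le_mul_of_nonneg_left this (a0 w)
      simp only [r00, r1, mul_one, abs_of_nonneg (a0 w)]; norm_cast at this; linarith) (by norm_num) (by linarith) le_rfl (by linarith)
    le_rfl (by linear_combination m3) (by push_cast; linarith)
  have J4 := T' (k := 1) (g := fun w => ψ w ^ 18 * (|θ w| ^ 2 * a w)) 1 0 (2 * (1 - t')) (2 * t') 0
    (fun w _ => by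
      have := psi_bd (ψ0 w) (ψ1 w) (abs_nonneg (θ w)) (b := 2 * (1 - t')) (t := 2 * t') (k := 2) (by positivity) (by norm_num; linarith) (by ring) (by linarith)
      have := mul_le_mul_of_nonneg_left this (a0 w)
      simp only [r00, r1, mul_one, abs_of_nonneg (a0 w)]; rw [abs_abs] at this; norm_cast at this; linarith) (by norm_num) le_rfl (by linarith) (by linarith)
    le_rfl (by linear_combination m4) (by push_cast; linarith)
  have J5 := T (k := 2) (g := fun w => ψ w ^ 18 * n w ^ 2) 0 (2 * (1 - s)) 0 (2 * s) 0
    (fun w _ => by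
      have := psi_bd (ψ0 w) (ψ1 w) (nn0 w) (b := 2 * (1 - s)) (t := 2 * s) (k := 2) (by positivity) (by norm_num; linarith) (by ring) (by linarith)
      simp only [r00, mul_one, one_mul]; norm_cast at this) (by norm_num) (by linarith) le_rfl (by linarith)
    le_rfl (by linear_combination m5) (by push_cast; linarith)
  have J6 := T' (k := 2) (g := fun w => ψ w ^ 18 * |θ w| ^ 2) 0 0 1 1 (5 / 6 - 1 / r)
    (fun w _ => by
      have := psi_bd (ψ0 w) (ψ1 w) (abs_nonneg (θ w)) (b := 1) (t := 1) (k := 2) (by norm_num) (by norm_num) (by norm_num) (by norm_num)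
      rw [abs_abs] at this
      simp only [r00, r1, mul_one, one_mul] at this ⊢; norm_cast at this) (by norm_num) le_rfl (by linarith) (by linarith)
    (by linarith) (by ring) (by push_cast; linarith)
  have J7 := T (k := 1) (g := fun w => ψ w ^ 18 * (|θ w| * n w)) 0 (1 - s) 1 s (1 / 2 - 1 / r)
    (fun w _ => by
      have := psi_bd (ψ0 w) (ψ1 w) (nn0 w) (b := 1 - s) (t := s) (k := 1) (by positivity) (by norm_num; linarith) (by ring) (by linarith)
      have := mul_le_mul_of_nonneg_left this (abs_nonneg (θ w))
      simp only [r00, r1, mul_one, one_mul] at this ⊢; linarith) (by norm_num) (by linarith) (by norm_num) (by linarith)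
    (by linarith) (by linear_combination 1 / 2 * m5) (by push_cast; linarith)
  simp only [r00, r1, mul_one, one_mul, pow_one] at J1 J2 J3 J4 J5 J6 J7
  norm_cast at J1 J2
  refine ⟨?_, J5, J6⟩
  have W0 : 0 ≤ W := by linarith
  have add := fun {f g : R3 → ℝ} {A B : ℝ} (hA : 0 ≤ A) (hB : 0 ≤ B) (mg : Measurable g) (hf : ∫⁻ w in S, ENNReal.ofReal (f w) ≤ ENNReal.ofReal A)
      (hg : ∫⁻ w in S, ENNReal.ofReal (g w) ≤ ENNReal.ofReal B) => show ∫⁻ w in S, ENNReal.ofReal (f w + g w) ≤ ENNReal.ofReal (A + B) by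
    rw [ENNReal.ofReal_add hA hB]
    refine (lintegral_mono fun w => ENNReal.ofReal_add_le).trans ?_
    rw [lintegral_add_right _ mg.ennreal_ofReal]
    exact add_le_add hf hg
  have L := add (by positivity) (by positivity) (by fun_prop) (add (by positivity) (by positivity) (by fun_prop) (add (by positivity) (by positivity) (by fun_prop)
    (add (by positivity) (by positivity) (by fun_prop) (add (by positivity) (by positivity) (by fun_prop) (add (by positivity) (by positivity) (by fun_prop) J1 J2) J3) J4) J5) J6) J7
  unfold Bd
  refine L.trans (le_of_eq ?_)
  congr 1; unfold Bnd; ring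
end BdS

section Main1
open scoped ContDiff ENNReal
variable {u v : Fin 3 → R3 → ℝ} {pr θ : R3 → ℝ} {K R : ℝ} {ψ : R3 → ℝ}

lemma gns_loc : ∃ C : ℝ, 0 ≤ C ∧ ∀ {u v : Fin 3 → R3 → ℝ} {pr θ : R3 → ℝ} {K R : ℝ} {ψ : R3 → ℝ}, 0 < R → Sol u v pr θ → Cut K R ψ →
    ∀ f, ContDiff ℝ ∞ f → (∀ x, ∑ j, pd f j x ^ 2 ≤ GG u v θ x) → ∀ E F : ℝ, 0 ≤ E → 0 ≤ F →
    ∫⁻ x, ENNReal.ofReal (ψ x ^ 20 * GG u v θ x) ≤ ENNReal.ofReal E →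
    ∫⁻ x in Shell R, ENNReal.ofReal (R⁻¹ ^ 2 * (ψ x ^ 18 * f x ^ 2)) ≤ ENNReal.ofReal F →
    LI 6 Set.univ (fun x => ψ x ^ 10 * f x) ≤ ENNReal.ofReal ((C * (2 * E + 600 * K ^ 2 * F)) ^ 3) := by
  obtain ⟨C, C0, h⟩ := gns
  refine ⟨C + 1, by positivity, fun {u v pr θ K R ψ} hR S c f hf hG E F E0 F0 hE hF => ?_⟩
  have sm : ContDiff ℝ ∞ fun x => ψ x ^ 10 * f x := (c.sm.pow 10).mul hf
  have cs : HasCompactSupport fun x => ψ x ^ 10 * f x := (c.cs.comp_left (g := fun t : ℝ => t ^ 10) (by norm_num)).mul_right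
  have := h _ (c1 sm) cs
  have e : LI 6 Set.univ (fun x => ψ x ^ 10 * f x) = ∫⁻ x, ENNReal.ofReal (|ψ x ^ 10 * f x| ^ 6) := by
    unfold LI; rw [Measure.restrict_univ]; norm_cast
  rw [e]
  refine this.trans ?_
  have b : ∫⁻ x, ENNReal.ofReal (∑ j, pd (fun x => ψ x ^ 10 * f x) j x ^ 2) ≤ ENNReal.ofReal (2 * E + 600 * K ^ 2 * F) := by
    rw [ENNReal.ofReal_add (by positivity) (by positivity), ENNReal.ofReal_mul (by norm_num), ENNReal.ofReal_mul (by positivity : 0 ≤ 600 * K ^ 2)]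
    have mm : Measurable fun x => ENNReal.ofReal 2 * ENNReal.ofReal (ψ x ^ 20 * GG u v θ x) :=
      ((c.sm.continuous.pow 20).mul S.gc).measurable.ennreal_ofReal.const_mul _
    refine le_trans ?_ (add_le_add (mul_le_mul_right hE _) (mul_le_mul_right hF _))
    rw [← lintegral_const_mul' _ _ ENNReal.ofReal_ne_top, ← lintegral_const_mul' _ _ ENNReal.ofReal_ne_top, ← lintegral_indicator (Shell_meas R),
      ← lintegral_add_left mm]
    refine lintegral_mono fun x => ?_
    have s0 := c.nn x
    have G0 := GG_nonneg (u := u) (v := v) (θ := θ) x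
    have pe : ∀ j, pd (fun x => ψ x ^ 10 * f x) j x = 10 * ψ x ^ 9 * pd ψ j x * f x + ψ x ^ 10 * pd f j x := fun j => by
      rw [pd_mul ((c1d (c1 c.sm) x).fun_pow 10) (c1d (c1 hf) x), c.p1]; norm_num
    have hgx := mul_le_mul_of_nonneg_left (hG x) (by positivity : 0 ≤ 2 * ψ x ^ 20)
    by_cases hx : x ∈ Shell R
    · simp only [Set.indicator_of_mem hx]
      rw [← ENNReal.ofReal_mul (by norm_num), ← ENNReal.ofReal_mul (by positivity), ← ENNReal.ofReal_add (by positivity) (by positivity)]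
      apply ENNReal.ofReal_le_ofReal
      have T : ∀ j, pd (fun x => ψ x ^ 10 * f x) j x ^ 2 ≤ 200 * K ^ 2 * (R⁻¹ ^ 2 * (ψ x ^ 18 * f x ^ 2)) + 2 * ψ x ^ 20 * pd f j x ^ 2 := fun j => by
        rw [pe]
        have d := sq_le_sq' (by linarith [(abs_le.1 (c.d1 x j)).1]) (abs_le.1 (c.d1 x j)).2
        have d' := mul_le_mul_of_nonneg_right d (by positivity : 0 ≤ 200 * (ψ x ^ 18 * f x ^ 2))
        nlinarith only [d', sq_nonneg (10 * ψ x ^ 9 * pd ψ j x * f x - ψ x ^ 10 * pd f j x)]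
      refine (Finset.sum_le_sum fun j _ => T j).trans ?_
      rw [Finset.sum_add_distrib, Finset.sum_const, ← Finset.mul_sum]
      simp only [Finset.card_univ, Fintype.card_fin, nsmul_eq_mul]
      push_cast; linarith
    · simp only [Set.indicator_of_notMem hx, add_zero]
      rw [← ENNReal.ofReal_mul (by norm_num)]
      apply ENNReal.ofReal_le_ofReal
      have T : ∀ j, pd (fun x => ψ x ^ 10 * f x) j x ^ 2 = ψ x ^ 20 * pd f j x ^ 2 := fun j => by
        rw [pe, c.d0 x hx]; ring
      simp only [T]
      rw [← Finset.mul_sum]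
      have : 0 ≤ ψ x ^ 20 * ∑ j, pd f j x ^ 2 := by positivity
      linarith
  have Q : 0 ≤ 2 * E + 600 * K ^ 2 * F := by positivity
  refine (mul_le_mul_right (pow_le_pow_left' b 3) _).trans ?_
  rw [← ENNReal.ofReal_pow Q, ← ENNReal.ofReal_mul C0]
  apply ENNReal.ofReal_le_ofReal
  rw [mul_pow]
  refine mul_le_mul_of_nonneg_right ?_ (by positivity)
  nlinarith [sq_nonneg C]

lemma vol_Shell : ∃ W : ℝ, 1 ≤ W ∧ ∀ R : ℝ, 1 ≤ R → volume (Shell R) ≤ ENNReal.ofReal (W * R ^ (3:ℝ)) := by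
  refine ⟨max 1 (8 * (volume (ball (0:R3) 1)).toReal), le_max_left _ _, fun R hR => ?_⟩
  have R0 : 0 < R := by linarith
  have h1 : volume (Shell R) ≤ volume (closedBall (0:R3) (2 * R)) := measure_mono fun x hx => by
    rw [mem_closedBall_zero_iff]; have := hx.2; norm_num at this ⊢; linarith
  rw [Measure.addHaar_closedBall _ _ (by positivity)] at h1
  refine h1.trans ?_
  conv_lhs => rw [← ENNReal.ofReal_toReal (measure_ball_lt_top (μ := volume) (x := (0:R3)) (r := 1)).ne, ← ENNReal.ofReal_mul (by positivity)]
  apply ENNReal.ofReal_le_ofReal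
  have : Module.finrank ℝ R3 = 3 := by simp
  rw [this, mul_pow]
  have e : R ^ (3:ℝ) = R ^ 3 := by norm_cast
  rw [e]
  refine le_trans (le_of_eq ?_) (mul_le_mul_of_nonneg_right (le_max_right _ _) (by positivity))
  ring

lemma LI_cs {f : R3 → ℝ} (hf : Continuous f) (hs : HasCompactSupport f) (S : Set R3) : LI 6 S f ≠ ⊤ := by
  have h := (((hf.abs.rpow_const (p := 6) fun x => Or.inr (by norm_num)).integrable_of_hasCompactSupport
    (hs.comp_left (g := fun t : ℝ => |t| ^ (6:ℝ)) (by norm_num))).lintegral_lt_top (μ := volume))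
  exact ((setLIntegral_le_lintegral S _).trans_lt h).ne

lemma LI_mono {p : ℝ} (hp : 0 ≤ p) {s t : Set R3} (hs : MeasurableSet s) (hst : s ⊆ t) {f g : R3 → ℝ} (h : ∀ x ∈ s, |f x| ≤ |g x|) : LI p s f ≤ LI p t g :=
  (setLIntegral_mono' hs fun x hx => ENNReal.ofReal_le_ofReal (Real.rpow_le_rpow (abs_nonneg _) (h x hx) hp)).trans (lintegral_mono_set hst)

lemma exists_H {f : R3 → ℝ} (hf : Continuous f) (hs : HasCompactSupport f) (S : Set R3) : ∃ H : ℝ, 0 ≤ H ∧ LI 6 S f = ENNReal.ofReal (H ^ (6:ℝ)) := by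
  refine ⟨(LI 6 S f).toReal ^ (1 / 6 : ℝ), by positivity, ?_⟩
  rw [← Real.rpow_mul ENNReal.toReal_nonneg]; norm_num
  rw [ENNReal.ofReal_toReal (LI_cs hf hs S)]

lemma Shell_sub {R : ℝ} (hR : 0 < R) : Shell R ⊆ annulus R := fun x hx => by
  rw [ann_mem]; obtain ⟨h1, h2⟩ := hx; norm_num at h1 h2 ⊢; constructor <;> linarith

lemma LI_nF {p : ℝ} (hp : 1 ≤ p) {v : Fin 3 → R3 → ℝ} (hv : ∀ i, Measurable (v i)) {s : Set R3} (hs : MeasurableSet s) {g : R3 → ℝ}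
    (hg : ∀ x, |g x| ≤ nF v x) {Y : ℝ} (hY : 0 ≤ Y)
    (hb : ∀ i, LI p s (v i) ≤ ENNReal.ofReal (Y ^ p)) : LI p s g ≤ ENNReal.ofReal ((3 * Y) ^ p) := by
  have := lp_dom (ι := Fin 3) (g := g) (h := v) (K := 1) (c := 1) (S := ENNReal.ofReal (Y ^ p)) hp hs hv zero_le_one zero_le_one
    (fun x _ => by rw [one_mul]; exact hg x) (fun n => by rw [ENNReal.ofReal_one, one_mul]; exact hb n)
  rw [Real.mul_rpow (by norm_num) hY, ENNReal.ofReal_mul (by positivity)]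
  simpa [LI] using this
end Main1

section Main2
open scoped ContDiff ENNReal

lemma Bnd_ge {s t t' x y z H Θ : ℝ} (hx : 0 ≤ x) (hy : 0 ≤ y) (hz : 0 ≤ z) (hH : 0 ≤ H) (hΘ : 0 ≤ Θ) :
    0 ≤ Bnd s t t' x y z H Θ ∧ y ^ (2 * (1 - s)) * H ^ (2 * s) ≤ Bnd s t t' x y z H Θ ∧ z * Θ ≤ Bnd s t t' x y z H Θ := by
  have h1 : 0 ≤ x ^ 2 := by positivity
  have h2 : 0 ≤ x ^ 3 := by positivity
  have h3 : 0 ≤ x * y ^ (2 * (1 - t)) * H ^ (2 * t) := by positivity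
  have h4 : 0 ≤ x * z ^ (2 * (1 - t')) * Θ ^ (2 * t') := by positivity
  have h5 : 0 ≤ y ^ (2 * (1 - s)) * H ^ (2 * s) := by positivity
  have h6 : 0 ≤ z * Θ := by positivity
  have h7 : 0 ≤ y ^ (1 - s) * z * H ^ s := by positivity
  unfold Bnd; refine ⟨by positivity, ?_, ?_⟩ <;> linarith

lemma cs10 {ψ g : R3 → ℝ} (h : HasCompactSupport ψ) : HasCompactSupport (fun w => ψ w ^ 10 * g w) := by
  refine h.mono fun x hx => ?_
  rw [Function.mem_support] at hx ⊢
  intro h0; apply hx; rw [h0]; norm_num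

lemma main_est {p q r α β γ s t t' : ℝ} (E : Ex p q r α β γ s t t') (hp6 : p < 6) : ∃ C D : ℝ, 0 ≤ C ∧ 0 ≤ D ∧
    ∀ {u v : Fin 3 → R3 → ℝ} {pr θ : R3 → ℝ}, Sol u v pr θ → ∀ R : ℝ, 1 ≤ R → ∀ x y z : ℝ, 0 ≤ x → 0 ≤ y → 0 ≤ z →
    (∀ i, LI p (annulus R) (u i) ≤ ENNReal.ofReal ((x * R ^ α) ^ p)) → (∀ i, LI q (annulus R) (v i) ≤ ENNReal.ofReal ((y * R ^ β) ^ q)) →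
    LI r (annulus R) θ ≤ ENNReal.ofReal ((z * R ^ γ) ^ r) →
    ∃ H Θ B : ℝ, 0 ≤ H ∧ 0 ≤ Θ ∧ B = C * Bnd s t t' (D * x) (3 * y) z H Θ ∧ 0 ≤ B ∧ ∫⁻ x in ball 0 R, ENNReal.ofReal (GG u v θ x) ≤ ENNReal.ofReal B ∧
      (∀ i, LI 6 (ball 0 R) (v i) ≤ ENNReal.ofReal (B ^ 3)) ∧ LI 6 (ball 0 R) θ ≤ ENNReal.ofReal (B ^ 3) ∧ H ^ 2 ≤ B ∧ Θ ^ 2 ≤ B ∧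
      ENNReal.ofReal (H ^ (6:ℝ)) ≤ LI 6 (Shell R) (nF v) ∧ ENNReal.ofReal (Θ ^ (6:ℝ)) ≤ LI 6 (Shell R) θ := by
  obtain ⟨K, K0, hcut⟩ := exists_cut
  obtain ⟨Cg, Cg0, hg⟩ := gns_loc
  obtain ⟨W, W1, hW⟩ := vol_Shell
  obtain ⟨Cp, Cpt, hpot⟩ := vecpot E.p3 hp6
  have p0 : 0 < p := by linarith [E.p3]
  obtain ⟨M, hM⟩ : ∃ a : ℝ, a = 2 * (380 * K ^ 2 + 40 * K) := ⟨_, rfl⟩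
  have M0 : 0 ≤ M := by rw [hM]; positivity
  obtain ⟨N, hN⟩ : ∃ a : ℝ, a = 1000 * M ^ 2 + 100 * M := ⟨_, rfl⟩
  have N0 : 0 ≤ N := by rw [hN]; positivity
  obtain ⟨cp, hcp⟩ : ∃ a : ℝ, a = Cp.toReal + 1 := ⟨_, rfl⟩
  have cp0 : 0 ≤ cp := by have := Cp.toReal_nonneg; linarith
  have cpC : Cp ≤ ENNReal.ofReal cp := by
    rw [← ENNReal.ofReal_toReal Cpt]; exact ENNReal.ofReal_le_ofReal (by linarith)
  obtain ⟨D, hD⟩ : ∃ a : ℝ, a = (15 ^ p * cp * 3) ^ (1 / p) := ⟨_, rfl⟩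
  have D0 : 0 ≤ D := by rw [hD]; positivity
  have W0 : 0 ≤ W := by linarith
  obtain ⟨C1, hC1⟩ : ∃ a : ℝ, a = 2 * N * W := ⟨_, rfl⟩
  obtain ⟨C2, hC2⟩ : ∃ a : ℝ, a = Cg * (2 * C1 + 600 * K ^ 2 * W) := ⟨_, rfl⟩
  have C10 : 0 ≤ C1 := by rw [hC1]; positivity
  have C20 : 0 ≤ C2 := by rw [hC2]; positivity
  refine ⟨C1 + 9 * C2, D, by positivity, D0, fun {u v pr θ} S R hR x y z hx hy hz bu bv bθ => ?_⟩
  have R0 : 0 < R := by linarith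
  obtain ⟨ψ, c⟩ := hcut R R0
  obtain ⟨A, hA, hcurl, hA1, hA2⟩ := hpot u S.su S.e4 R R0
  have sub := Shell_sub R0
  have Sm := Shell_meas R
  have mn : Continuous (nF v) := by
    have := fun i => (S.sv i).continuous
    unfold nF; fun_prop
  have ma : Continuous (aF u A R) := by
    have h1 := fun i => (S.su i).continuous
    have h2 := fun i => (hA i).continuous
    have h3 := fun i j => pd_cont (hA i) j
    unfold aF; fun_prop
  have cψ := c.sm.continuous
  obtain ⟨H, H0, hH⟩ := exists_H (f := fun w => ψ w ^ 10 * nF v w) ((cψ.pow 10).mul mn) (cs10 c.cs) (Shell R)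
  obtain ⟨Θ, Θ0, hΘ⟩ := exists_H (f := fun w => ψ w ^ 10 * |θ w|) ((cψ.pow 10).mul S.st.continuous.abs) (cs10 c.cs) (Shell R)
  have hSum : Cp * ∑ n, LI p (annulus R) (u n) ≤ ENNReal.ofReal cp * ENNReal.ofReal (3 * (x * R ^ α) ^ p) := by
    refine mul_le_mul' cpC ((Finset.sum_le_sum fun i _ => bu i).trans (le_of_eq ?_))
    rw [Finset.sum_const, ENNReal.ofReal_mul (by norm_num)]; simp
  have ba : LI p (Shell R) (aF u A R) ≤ ENNReal.ofReal ((D * x * R ^ α) ^ p) := by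
    refine (lp_aF (by linarith [E.p3]) (fun i => (S.su i).continuous) hA Sm cp0 (fun l => (hA2 l).trans hSum) (fun l k => (hA1 l k).trans hSum) (fun n => ?_)).trans (le_of_eq ?_)
    · refine (lintegral_mono_set sub).trans ((bu n).trans ?_)
      rw [← ENNReal.ofReal_mul cp0]
      apply ENNReal.ofReal_le_ofReal
      have : 1 ≤ cp := by have := Cp.toReal_nonneg; linarith
      have : 0 ≤ (x * R ^ α) ^ p := by positivity
      nlinarith
    · rw [← ENNReal.ofReal_mul (by positivity), mul_assoc D, Real.mul_rpow D0 (by positivity), hD, ← Real.rpow_mul (by positivity), one_div_mul_cancel p0.ne', Real.rpow_one]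
      congr 1; ring
  have bn : LI q (Shell R) (nF v) ≤ ENNReal.ofReal ((3 * y * R ^ β) ^ q) := by
    rw [mul_assoc]
    exact LI_nF E.q1 (fun i => (S.sv i).continuous.measurable) Sm (fun x => by rw [abs_of_nonneg (nF_nonneg x)]) (by positivity) fun i => (lintegral_mono_set sub).trans (bv i)
  obtain ⟨I1, I2, I3⟩ := Bd_int (p := p) (q := q) (r := r) (α := α) (β := β) (γ := γ) (x := D * x) (y := 3 * y) (z := z) (H := H) (Θ := Θ) Sm hR W1 (hW R hR) E ma.measurable mn.measurable S.st.continuous.measurable cψ.measurable aF_nonneg nF_nonneg c.nn c.le1 ba bn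
    ((lintegral_mono_set sub).trans bθ) hH.le hΘ.le (by positivity) (by positivity) hz H0 Θ0
  obtain ⟨B0, B1, B2⟩ := Bnd_ge (s := s) (t := t) (t' := t') (x := D * x) (y := 3 * y) (z := z) (H := H) (Θ := Θ) (by positivity) (by positivity) hz H0 Θ0
  obtain ⟨b, hb⟩ : ∃ a, a = Bnd s t t' (D * x) (3 * y) z H Θ := ⟨_, rfl⟩
  rw [← hb] at I1 B0 B1 B2
  have I2' := I2.trans (ENNReal.ofReal_le_ofReal (mul_le_mul_of_nonneg_left B1 W0))
  have I3' := I3.trans (ENNReal.ofReal_le_ofReal (mul_le_mul_of_nonneg_left B2 W0))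
  have En : ∫⁻ x, ENNReal.ofReal (ψ x ^ 20 * GG u v θ x) ≤ ENNReal.ofReal (C1 * b) := by
    have h := en_est S K0 R0 c hA hcurl hM
    rw [← hN] at h
    simp_rw [ENNReal.ofReal_mul N0, ENNReal.ofReal_mul (by norm_num : (0:ℝ) ≤ 1 / 2)] at h
    rw [lintegral_const_mul' _ _ ENNReal.ofReal_ne_top, lintegral_const_mul' _ _ ENNReal.ofReal_ne_top] at h
    have h2 := mul_le_mul_right (h.trans (mul_le_mul_right I1 _)) (ENNReal.ofReal 2)
    rw [← mul_assoc, ← ENNReal.ofReal_mul (by norm_num), ← ENNReal.ofReal_mul N0, ← ENNReal.ofReal_mul (by norm_num)] at h2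
    rw [show (2:ℝ) * (1 / 2) = 1 by norm_num, ENNReal.ofReal_one, one_mul] at h2
    refine h2.trans (le_of_eq ?_)
    rw [hC1]; congr 1; ring
  have e1 : C2 * b = Cg * (2 * (C1 * b) + 600 * K ^ 2 * (W * b)) := by rw [hC2]; ring
  have gt : LI 6 Set.univ (fun x => ψ x ^ 10 * θ x) ≤ ENNReal.ofReal ((C2 * b) ^ 3) := by
    rw [e1]
    refine hg R0 S c θ S.st (fun w => ?_) _ _ (by positivity) (by positivity) En (by simpa only [sq_abs] using I3')
    exact Finset.sum_le_sum fun j _ => by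
      have : 0 ≤ ∑ i, ((pd (u i) j w) ^ 2 + (pd (v i) j w) ^ 2) := by positivity
      linarith
  have gv : ∀ i, LI 6 Set.univ (fun x => ψ x ^ 10 * v i x) ≤ ENNReal.ofReal ((C2 * b) ^ 3) := fun i => by
    rw [e1]
    refine hg R0 S c (v i) (S.sv i) (fun w => ?_) _ _ (by positivity) (by positivity) En ?_
    · refine Finset.sum_le_sum fun j _ => ?_
      have := Finset.single_le_sum (f := fun i => (pd (u i) j w) ^ 2 + (pd (v i) j w) ^ 2) (fun i _ => by positivity) (Finset.mem_univ i)
      nlinarith only [this, sq_nonneg (pd θ j w), sq_nonneg (pd (u i) j w)]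
    · refine le_trans (setLIntegral_mono' Sm fun w _ => ENNReal.ofReal_le_ofReal ?_) I2'
      have := sq_le_sq' (by linarith [(abs_le.1 (le_nF (v := v) i w)).1]) (abs_le.1 (le_nF (v := v) i w)).2
      have := c.nn w
      gcongr
  have hB : C2 * b ≤ (C1 + 9 * C2) * b := by nlinarith [mul_nonneg C10 B0, mul_nonneg C20 B0]
  have hB3 : (C2 * b) ^ 3 ≤ ((C1 + 9 * C2) * b) ^ 3 := pow_le_pow_left₀ (by positivity) hB 3
  have one : ∀ w ∈ ball (0:R3) R, ψ w = 1 := fun w hw => c.one w (by rw [mem_ball_zero_iff] at hw; exact hw.le)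
  have sub1 : ∀ w, |nF v w| ≥ |ψ w ^ 10 * nF v w| ∧ |θ w| ≥ abs (ψ w ^ 10 * |θ w|) := fun w => by
    have h1 : |ψ w ^ 10| ≤ 1 := by rw [abs_of_nonneg (by have := c.nn w; positivity)]; exact pow_le_one₀ (c.nn w) (c.le1 w)
    rw [abs_mul, abs_mul, abs_abs]
    exact ⟨mul_le_of_le_one_left (abs_nonneg _) h1, mul_le_of_le_one_left (abs_nonneg _) h1⟩
  have six : ∀ h Q : ℝ, 0 ≤ h → 0 ≤ Q → ENNReal.ofReal (h ^ (6:ℝ)) ≤ ENNReal.ofReal (Q ^ 3) → h ^ 2 ≤ Q := fun h Q h0 hQ hh => by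
    rw [ENNReal.ofReal_le_ofReal_iff (by positivity)] at hh
    refine le_of_pow_le_pow_left₀ (n := 3) (by norm_num) hQ (le_trans (le_of_eq ?_) hh)
    rw [← pow_mul]; norm_cast
  refine ⟨H, Θ, (C1 + 9 * C2) * b, H0, Θ0, by rw [hb], by positivity, ?_, fun i => ?_, ?_, ?_, ?_, ?_, ?_⟩
  · refine le_trans (setLIntegral_mono' measurableSet_ball fun w hw => ENNReal.ofReal_le_ofReal (le_of_eq ?_)) ((setLIntegral_le_lintegral _ _).trans
      (En.trans (ENNReal.ofReal_le_ofReal ?_)))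
    · rw [one w hw]; ring
    · nlinarith [mul_nonneg C20 B0]
  · exact (LI_mono (by norm_num) measurableSet_ball (Set.subset_univ _) fun w hw => by rw [one w hw]; norm_num).trans ((gv i).trans (ENNReal.ofReal_le_ofReal hB3))
  · exact (LI_mono (by norm_num) measurableSet_ball (Set.subset_univ _) fun w hw => by rw [one w hw]; norm_num).trans (gt.trans (ENNReal.ofReal_le_ofReal hB3))
  · have sq3 : ∀ Q : ℝ, 0 ≤ Q → Q ^ 3 = (Q ^ (1 / 2 : ℝ)) ^ (6:ℝ) := fun Q hQ => by
      rw [← Real.rpow_mul hQ]; norm_num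
    have h := LI_nF (p := 6) (by norm_num) (v := fun i w => ψ w ^ 10 * v i w) (fun i => ((cψ.pow 10).mul (S.sv i).continuous).measurable) Sm
      (g := fun w => ψ w ^ 10 * nF v w) (fun w => by
        have := c.nn w
        rw [abs_of_nonneg (mul_nonneg (by positivity) (nF_nonneg w)), nF, nF, Finset.mul_sum]
        exact le_of_eq (Finset.sum_congr rfl fun i _ => by rw [abs_mul, abs_of_nonneg (by positivity : 0 ≤ ψ w ^ 10)]))
      (Y := (C2 * b) ^ (1 / 2 : ℝ)) (by positivity) (fun i => by
        rw [← sq3 _ (by positivity)]; exact (lintegral_mono_set (Set.subset_univ _)).trans (gv i))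
    rw [hH] at h
    have h' : H ^ 2 ≤ 9 * (C2 * b) := six _ _ H0 (by positivity) (h.trans (le_of_eq ?_))
    · nlinarith [mul_nonneg C10 B0]
    · congr 1
      rw [Real.mul_rpow (by norm_num) (by positivity), ← sq3 _ (by positivity)]; norm_num; ring
  · refine (six _ _ Θ0 (by positivity) (hΘ.ge.trans (le_trans ?_ gt))).trans hB
    exact LI_mono (by norm_num) Sm (Set.subset_univ _) fun w _ => by rw [abs_mul, abs_mul, abs_abs]
  · rw [← hH]; exact LI_mono (by norm_num) Sm le_rfl fun w _ => (sub1 w).1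
  · rw [← hΘ]; exact LI_mono (by norm_num) Sm le_rfl fun w _ => (sub1 w).2
end Main2

section Concl
open scoped ContDiff ENNReal

lemma XS_LI {g : R3 → ℝ} (hg : Continuous g) {p a R : ℝ} (p0 : 0 < p) (R0 : 0 < R) :
    0 ≤ XnS g a p R ∧ LI p (annulus R) g = ENNReal.ofReal ((XnS g a p R * R ^ a) ^ p) := by
  have I0 : 0 ≤ ∫ x in annulus R, |g x| ^ p := integral_nonneg fun x => by positivity
  refine ⟨by unfold XnS lpS; positivity, ?_⟩
  have hc : Continuous fun x => |g x| ^ p := hg.abs.rpow_const fun x => Or.inr p0.le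
  have hi : IntegrableOn (fun x => |g x| ^ p) (annulus R) :=
    (hc.continuousOn.integrableOn_compact (isCompact_closedBall (0:R3) (2 * R))).mono_set (Set.diff_subset.trans ball_subset_closedBall)
  have e : XnS g a p R * R ^ a = (∫ x in annulus R, |g x| ^ p) ^ (1 / p) := by
    unfold XnS lpS
    rw [mul_right_comm, ← Real.rpow_add R0, neg_add_cancel, Real.rpow_zero, one_mul]
  rw [e, ← Real.rpow_mul I0, one_div_mul_cancel p0.ne', Real.rpow_one]
  exact (ofReal_integral_eq_lintegral_ofReal hi (ae_of_all _ fun x => by positivity)).symm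

lemma XV_LI {f : R3 → R3} (hf : Continuous f) {p a R : ℝ} (p0 : 0 < p) (R0 : 0 < R) :
    0 ≤ XnV f a p R ∧ ∀ i, LI p (annulus R) (fun x => f x i) ≤ ENNReal.ofReal ((XnV f a p R * R ^ a) ^ p) := by
  obtain ⟨h1, h2⟩ := XS_LI (a := a) hf.norm p0 R0
  refine ⟨h1, fun i => le_trans ?_ h2.le⟩
  exact LI_mono p0.le (ann_meas R) le_rfl fun x _ => by rw [abs_norm]; exact PiLp.norm_apply_le (f x) i

lemma Bnd_mono {s t t' x y z H Θ x' y' z' H' Θ' : ℝ} (hs : 0 < s ∧ s ≤ 0.8) (ht : 0 < t ∧ t ≤ 0.8) (ht' : 0 < t' ∧ t' ≤ 0.8)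
    (hx : 0 ≤ x) (hy : 0 ≤ y) (hz : 0 ≤ z) (hH : 0 ≤ H) (hΘ : 0 ≤ Θ) (hx' : x ≤ x') (hy' : y ≤ y') (hz' : z ≤ z') (hH' : H ≤ H') (hΘ' : Θ ≤ Θ') :
    Bnd s t t' x y z H Θ ≤ Bnd s t t' x' y' z' H' Θ' := by
  obtain ⟨s0, s1⟩ := hs; obtain ⟨t0, t1⟩ := ht; obtain ⟨t0', t1'⟩ := ht'
  norm_num at s1 t1 t1'
  have a1 : 0 ≤ 2 * (1 - s) := by linarith
  have a2 : 0 ≤ 2 * (1 - t) := by linarith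
  have a3 : 0 ≤ 2 * (1 - t') := by linarith
  have a4 : 0 ≤ 1 - s := by linarith
  have x0 := hx.trans hx'
  have y0 := hy.trans hy'
  have z0 := hz.trans hz'
  have p1 := Real.rpow_le_rpow hy hy' a1
  have p2 := Real.rpow_le_rpow hy hy' a2
  have p3 := Real.rpow_le_rpow hz hz' a3
  have p4 := Real.rpow_le_rpow hy hy' a4
  have q1 := Real.rpow_le_rpow hH hH' (z := 2 * s) (by linarith)
  have q2 := Real.rpow_le_rpow hH hH' (z := 2 * t) (by linarith)
  have q3 := Real.rpow_le_rpow hΘ hΘ' (z := 2 * t') (by linarith)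
  have q4 := Real.rpow_le_rpow hH hH' (z := s) (by linarith)
  unfold Bnd
  have H0 := hH.trans hH'
  gcongr

lemma pass1 {s t t' : ℝ} (hs : 0 < s ∧ s ≤ 0.8) (ht : 0 < t ∧ t ≤ 0.8) (ht' : 0 < t' ∧ t' ≤ 0.8) {C m : ℝ} (hC : 0 ≤ C) (hm : 1 ≤ m) :
    ∃ B : ℝ, 0 ≤ B ∧ ∀ x y z H Θ : ℝ, 0 ≤ x → 0 ≤ y → 0 ≤ z → 0 ≤ H → 0 ≤ Θ → x ≤ m → y ≤ m → z ≤ m →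
      H ^ 2 ≤ C * Bnd s t t' x y z H Θ → Θ ^ 2 ≤ C * Bnd s t t' x y z H Θ → C * Bnd s t t' x y z H Θ ≤ B := by
  set K := C * (7 * m ^ 3) + 1 with hK
  have K1 : 1 ≤ K := by have : 0 ≤ C * (7 * m ^ 3) := by positivity
                        linarith
  refine ⟨K * (K ^ (2.5:ℝ)) ^ (1.6:ℝ), by positivity, fun x y z H Θ hx hy hz hH hΘ xm ym zm h1 h2 => ?_⟩
  set X := max 1 (max H Θ)
  have X1 : 1 ≤ X := le_max_left _ _
  have X0 : 0 < X := by linarith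
  have HX : H ≤ X := (le_max_left _ _).trans (le_max_right _ _)
  have ΘX : Θ ≤ X := (le_max_right _ _).trans (le_max_right _ _)
  have pX : ∀ e : ℝ, e ≤ 1.6 → X ^ e ≤ X ^ (1.6:ℝ) := fun e he => Real.rpow_le_rpow_of_exponent_le X1 he
  have pm : ∀ e : ℝ, e ≤ 2 → m ^ e ≤ m ^ 2 := fun e he => by
    have := Real.rpow_le_rpow_of_exponent_le hm he
    rwa [Real.rpow_two] at this
  have P1 : 1 ≤ X ^ (1.6:ℝ) := Real.one_le_rpow X1 (by norm_num)
  have m0 : 0 ≤ m := by linarith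
  have key : Bnd s t t' x y z H Θ ≤ 7 * m ^ 3 * X ^ (1.6:ℝ) := by
    refine (Bnd_mono hs ht ht' hx hy hz hH hΘ xm ym zm HX ΘX).trans ?_
    obtain ⟨s0, s1⟩ := hs; obtain ⟨t0, t1⟩ := ht; obtain ⟨t0', t1'⟩ := ht'
    norm_num at s1 t1 t1'
    have m3 : m ^ 2 ≤ m ^ 3 := pow_le_pow_right₀ hm (by norm_num)
    have m1 : m ≤ m ^ 3 := le_self_pow₀ hm (by norm_num)
    have m30 : 0 ≤ m ^ 3 := by positivity
    have e1 : m ^ 2 ≤ m ^ 3 * X ^ (1.6:ℝ) := by nlinarith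
    have e2 : m ^ 3 ≤ m ^ 3 * X ^ (1.6:ℝ) := by nlinarith
    have e3 : m * m ^ (2 * (1 - t)) * X ^ (2 * t) ≤ m ^ 3 * X ^ (1.6:ℝ) := by
      rw [show m ^ 3 = m * m ^ 2 by ring]
      exact mul_le_mul (mul_le_mul_of_nonneg_left (pm _ (by linarith)) m0) (pX _ (by norm_num; linarith)) (by positivity) (by positivity)
    have e4 : m * m ^ (2 * (1 - t')) * X ^ (2 * t') ≤ m ^ 3 * X ^ (1.6:ℝ) := by
      rw [show m ^ 3 = m * m ^ 2 by ring]
      exact mul_le_mul (mul_le_mul_of_nonneg_left (pm _ (by linarith)) m0) (pX _ (by norm_num; linarith)) (by positivity) (by positivity)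
    have e5 : m ^ (2 * (1 - s)) * X ^ (2 * s) ≤ m ^ 3 * X ^ (1.6:ℝ) :=
      mul_le_mul ((pm _ (by linarith)).trans m3) (pX _ (by norm_num; linarith)) (by positivity) (by positivity)
    have e6 : m * X ≤ m ^ 3 * X ^ (1.6:ℝ) :=
      mul_le_mul m1 (by have := pX 1 (by norm_num); rwa [Real.rpow_one] at this) (by positivity) (by positivity)
    have e7 : m ^ (1 - s) * m * X ^ s ≤ m ^ 3 * X ^ (1.6:ℝ) := by
      rw [show m ^ 3 = m ^ 2 * m by ring]
      exact mul_le_mul (mul_le_mul_of_nonneg_right (pm _ (by linarith)) m0) (pX _ (by norm_num; linarith)) (by positivity) (by positivity)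
    unfold Bnd; linarith
  have kC : C * Bnd s t t' x y z H Θ ≤ K * X ^ (1.6:ℝ) := by
    have := mul_le_mul_of_nonneg_left key hC
    rw [hK]; nlinarith
  have X2 : X ^ 2 ≤ K * X ^ (1.6:ℝ) := by
    rcases le_total 1 (max H Θ) with h | h
    · rw [show X = max H Θ from max_eq_right h] at kC ⊢
      rcases le_total H Θ with h' | h'
      · rw [max_eq_right h'] at kC ⊢; exact h2.trans kC
      · rw [max_eq_left h'] at kC ⊢; exact h1.trans kC
    · rw [show X = 1 from max_eq_left h]; simpa using K1
  have XK : X ≤ K ^ (2.5:ℝ) := by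
    have h : X ^ (0.4:ℝ) ≤ K := by
      refine le_of_mul_le_mul_right ?_ (Real.rpow_pos_of_pos X0 1.6)
      rw [← Real.rpow_add X0]; norm_num; norm_num at X2; exact X2
    have := Real.rpow_le_rpow (by positivity) h (z := 2.5) (by norm_num)
    rw [← Real.rpow_mul X0.le] at this; norm_num at this ⊢; exact this
  exact kC.trans (mul_le_mul_of_nonneg_left (Real.rpow_le_rpow X0.le XK (by norm_num)) (by linarith))

lemma pass2 {s t t' : ℝ} (hs : 0 < s) (ht : 0 < t) (ht' : 0 < t') {C m ε : ℝ} (hε : 0 < ε) :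
    ∃ δ : ℝ, 0 < δ ∧ C * Bnd s t t' δ m m δ δ ≤ ε := by
  have hc : Continuous fun δ : ℝ => C * Bnd s t t' δ m m δ δ := by
    unfold Bnd
    have h1 := Real.continuous_rpow_const (q := 2 * t) (by positivity)
    have h2 := Real.continuous_rpow_const (q := 2 * t') (by positivity)
    have h3 := Real.continuous_rpow_const (q := 2 * s) (by positivity)
    have h4 := Real.continuous_rpow_const (q := s) (by positivity)
    fun_prop
  have h0 : C * Bnd s t t' 0 m m 0 0 = 0 := by
    unfold Bnd
    rw [Real.zero_rpow (by positivity : 2 * s ≠ 0), Real.zero_rpow hs.ne']; ring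
  have := (hc.tendsto 0).mono_left (nhdsWithin_le_nhds (s := Set.Ioi 0))
  rw [h0] at this
  obtain ⟨δ, h, hδ⟩ := ((this.eventually (gt_mem_nhds hε)).and self_mem_nhdsWithin).exists
  exact ⟨δ, hδ, h.le⟩

lemma li_univ {F : R3 → ℝ≥0∞} (hF : Measurable F) {Rs : ℕ → ℝ} (hRs : Tendsto Rs atTop atTop) {b : ℝ≥0∞}
    (h : ∀ᶠ j in atTop, ∫⁻ x in ball 0 (Rs j), F x ≤ b) : ∫⁻ x, F x ≤ b :=
  le_of_tendsto ((aecover_ball hRs).lintegral_tendsto_of_countably_generated hF.aemeasurable) h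

lemma li_tail {F : R3 → ℝ≥0∞} (hF : Measurable F) {Rs : ℕ → ℝ} (hRs : Tendsto Rs atTop atTop) (hI : ∫⁻ x, F x ≠ ⊤) {ε : ℝ≥0∞} (hε : 0 < ε) :
    ∀ᶠ j in atTop, ∫⁻ x in Shell (Rs j), F x ≤ ε := by
  have h := (aecover_ball (x := (0:R3)) (μ := volume) hRs).lintegral_tendsto_of_countably_generated hF.aemeasurable
  have h2 := ENNReal.Tendsto.sub (tendsto_const_nhds (x := ∫⁻ x, F x)) h (Or.inl hI)
  rw [tsub_self] at h2
  filter_upwards [h2.eventually (gt_mem_nhds hε), hRs.eventually_ge_atTop 1] with j hj h1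
  refine le_trans ?_ hj.le
  refine ENNReal.le_sub_of_add_le_right (ne_top_of_le_ne_top hI (setLIntegral_le_lintegral _ _)) ?_
  rw [← lintegral_add_compl (μ := volume) F (measurableSet_ball (x := (0:R3)) (ε := Rs j)), add_comm]
  refine add_le_add le_rfl (lintegral_mono_set fun x hx => ?_)
  exact ((Shell_sub (by linarith)) hx).2

lemma ae_zero {f : R3 → ℝ} (hf : Continuous f) {F : ℝ → ℝ} (hF : Continuous F) (h0 : ∀ y, F y ≤ 0 → y = 0)
    (h : ∀ ε : ℝ, 0 < ε → ∫⁻ x, ENNReal.ofReal (F (f x)) ≤ ENNReal.ofReal ε) (x : R3) : f x = 0 := by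
  have hz : ∫⁻ x, ENNReal.ofReal (F (f x)) = 0 := by
    refine le_antisymm (ENNReal.le_of_forall_pos_le_add fun ε hε _ => ?_) zero_le
    simpa using h ε (by exact_mod_cast hε)
  rw [lintegral_eq_zero_iff (by fun_prop)] at hz
  have := (Continuous.ae_eq_iff_eq volume (ENNReal.continuous_ofReal.comp (hF.comp hf)) continuous_const).1 hz
  have := congrFun this x
  exact h0 _ (by simpa using this)

end Concl

section Concl2
open scoped ContDiff ENNReal

lemma const_zero {u : R3 → R3} (hu : Continuous u) {i : Fin 3} {c p α : ℝ} (hc : ∀ x, u x i = c) (p0 : 0 < p) (hα : α * p ≤ 3)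
    {Rs : ℕ → ℝ} (hRs : Tendsto Rs atTop atTop) (hX : Tendsto (fun j => XnV u α p (Rs j)) atTop (nhds 0)) : c = 0 := by
  have h : ∀ᶠ j in atTop, ENNReal.ofReal (|c| ^ p / 8) * volume (ball (0:R3) 1) ≤ ENNReal.ofReal (XnV u α p (Rs j) ^ p) := by
    filter_upwards [hRs.eventually_ge_atTop 1] with j hj
    set R := Rs j
    have R0 : 0 < R := by linarith
    obtain ⟨x0, h1⟩ := XV_LI (a := α) hu p0 R0
    have h1 := h1 i
    set e : R3 := EuclideanSpace.single 0 (1.5 * R)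
    have en : ‖e‖ = 1.5 * R := by simp [e, abs_of_pos R0]; left; norm_num
    have sub : ball e (R / 2) ⊆ annulus R := fun x hx => by
      rw [mem_ball, dist_eq_norm] at hx
      have a1 := norm_le_norm_add_norm_sub' x e
      have a2 := norm_le_norm_add_norm_sub x e
      rw [ann_mem]; norm_num at en; constructor <;> linarith
    have h2 := (lintegral_mono_set sub).trans h1
    simp_rw [hc] at h2
    rw [lintegral_const, Measure.restrict_apply_univ, Measure.addHaar_ball _ _ (by positivity), finrank_euclideanSpace, Fintype.card_fin,
      ← mul_assoc, ← ENNReal.ofReal_mul (by positivity)] at h2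
    have h3 : (XnV u α p R * R ^ α) ^ p ≤ XnV u α p R ^ p * R ^ 3 := by
      rw [Real.mul_rpow x0 (by positivity), ← Real.rpow_mul R0.le, ← Real.rpow_natCast R 3]
      exact mul_le_mul_of_nonneg_left (Real.rpow_le_rpow_of_exponent_le hj (by simpa using hα)) (by positivity)
    have h4 := h2.trans (ENNReal.ofReal_le_ofReal h3)
    rw [show |c| ^ p * (R / 2) ^ 3 = |c| ^ p / 8 * R ^ 3 by ring, ENNReal.ofReal_mul (by positivity), ENNReal.ofReal_mul (by positivity), mul_right_comm] at h4
    exact (ENNReal.mul_le_mul_iff_left (by positivity) ENNReal.ofReal_ne_top).1 h4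
  have hl : Tendsto (fun j => ENNReal.ofReal (XnV u α p (Rs j) ^ p)) atTop (nhds 0) := by
    have := ENNReal.tendsto_ofReal (hX.rpow_const (p := p) (Or.inr p0.le))
    rwa [Real.zero_rpow p0.ne', ENNReal.ofReal_zero] at this
  have h0 := le_antisymm (ge_of_tendsto hl h) zero_le
  rcases mul_eq_zero.1 h0 with h0 | h0
  · rw [ENNReal.ofReal_eq_zero] at h0
    by_contra hc0
    have : 0 < |c| ^ p := Real.rpow_pos_of_pos (abs_pos.2 hc0) p
    linarith
  · exact absurd h0 (measure_ball_pos _ _ one_pos).ne'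

lemma conclude {p q r α β γ s t t' : ℝ} (E : Ex p q r α β γ s t t') (hp6 : p < 6) (hα2 : α ≤ 3 / p - 2 / 3) {u v : R3 → R3} {pr θ : R3 → ℝ}
    (cu : Continuous u) (cv : Continuous v)
    (S : Sol (fun i x => u x i) (fun i x => v x i) pr θ)
    (Rs : ℕ → ℝ) (hRs : Tendsto Rs atTop atTop)
    (hX : Tendsto (fun j => XnV u α p (Rs j)) atTop (nhds 0))
    (hY : ∃ L : ℝ, Tendsto (fun j => XnV v β q (Rs j)) atTop (nhds L))
    (hZ : ∃ L : ℝ, Tendsto (fun j => XnS θ γ r (Rs j)) atTop (nhds L)) :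
    (∀ x, u x = 0) ∧ (∀ x, v x = 0) ∧ (∀ x, θ x = 0) := by
  obtain ⟨C, D, C0, D0, hm⟩ := main_est E hp6
  obtain ⟨LY, hY⟩ := hY
  obtain ⟨LZ, hZ⟩ := hZ
  have p0 : 0 < p := by linarith [E.p3]
  have q0 : 0 < q := by linarith [E.q1]
  have r0 : 0 < r := by linarith [E.r2]
  have cθ := S.st.continuous
  set U := fun (i : Fin 3) x => u x i
  set V := fun (i : Fin 3) x => v x i
  set m := 1 + D + 3 * |LY + 1| + |LZ + 1| with hmd
  have m1 : 1 ≤ m := by have := abs_nonneg (LY + 1); have := abs_nonneg (LZ + 1); linarith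
  have ey : ∀ᶠ j in atTop, 3 * XnV v β q (Rs j) ≤ m := by
    filter_upwards [hY.eventually (gt_mem_nhds (lt_add_one LY))] with j hj
    have := le_abs_self (LY + 1); have := abs_nonneg (LZ + 1); linarith
  have ez : ∀ᶠ j in atTop, XnS θ γ r (Rs j) ≤ m := by
    filter_upwards [hZ.eventually (gt_mem_nhds (lt_add_one LZ))] with j hj
    have := le_abs_self (LZ + 1); have := abs_nonneg (LY + 1); linarith
  have hDX : Tendsto (fun j => D * XnV u α p (Rs j)) atTop (nhds 0) := by simpa using hX.const_mul D
  have ex : ∀ δ : ℝ, 0 < δ → ∀ᶠ j in atTop, D * XnV u α p (Rs j) ≤ δ := fun δ hδ => (hDX.eventually (gt_mem_nhds hδ)).mono fun j hj => hj.le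
  have e1 := hRs.eventually_ge_atTop 1
  have main := fun j (hj : 1 ≤ Rs j) => hm S (Rs j) hj _ _ _ (XV_LI (a := α) cu p0 (by linarith)).1 (XV_LI (a := β) cv q0 (by linarith)).1
    (XS_LI (a := γ) cθ r0 (by linarith)).1 (XV_LI cu p0 (by linarith)).2 (XV_LI cv q0 (by linarith)).2 (XS_LI cθ r0 (by linarith)).2.le
  obtain ⟨B, B0, hB⟩ := pass1 ⟨E.s0, E.s1⟩ ⟨E.t0, E.t1⟩ ⟨E.t0', E.t1'⟩ C0 m1
  have p1 : ∀ᶠ j in atTop, (∀ i, LI 6 (ball 0 (Rs j)) (V i) ≤ ENNReal.ofReal (B ^ 3)) ∧ LI 6 (ball 0 (Rs j)) θ ≤ ENNReal.ofReal (B ^ 3) := by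
    filter_upwards [e1, ex m (by linarith), ey, ez] with j hj hx hy hz
    obtain ⟨H, Θ, b, H0, Θ0, hb, b0, -, h1, h2, h3, h4, -, -⟩ := main j hj
    have x0 := (XV_LI (a := α) cu p0 (by linarith : 0 < Rs j)).1
    have y0 := (XV_LI (a := β) cv q0 (by linarith : 0 < Rs j)).1
    have z0 := (XS_LI (a := γ) cθ r0 (by linarith : 0 < Rs j)).1
    have bB : b ≤ B := by
      rw [hb] at h3 h4 ⊢
      exact hB _ _ _ _ _ (by positivity) (by positivity) z0 H0 Θ0 hx hy hz h3 h4
    have := ENNReal.ofReal_le_ofReal (pow_le_pow_left₀ b0 bB 3)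
    exact ⟨fun i => (h1 i).trans this, h2.trans this⟩
  have mV : ∀ i, Measurable (V i) := fun i => (S.sv i).continuous.measurable
  have mN : Measurable (nF V) := by
    have := mV; unfold nF; fun_prop
  have fV : ∀ i, LI 6 Set.univ (V i) ≤ ENNReal.ofReal (B ^ 3) := fun i => by
    unfold LI; rw [Measure.restrict_univ]
    exact li_univ (LI_meas (mV i)) hRs (p1.mono fun j hj => hj.1 i)
  have fθ : ∫⁻ x, ENNReal.ofReal (|θ x| ^ (6:ℝ)) ≠ ⊤ :=
    ne_top_of_le_ne_top ENNReal.ofReal_ne_top (li_univ (LI_meas cθ.measurable) hRs (p1.mono fun j hj => hj.2))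
  have fN : ∫⁻ x, ENNReal.ofReal (|nF V x| ^ (6:ℝ)) ≠ ⊤ := by
    have h := LI_nF (p := 6) (by norm_num) mV MeasurableSet.univ (g := nF V) (fun x => by rw [abs_of_nonneg (nF_nonneg x)])
      (Y := B ^ (1 / 2 : ℝ)) (by positivity) (fun i => (fV i).trans (le_of_eq (by rw [← Real.rpow_mul B0]; norm_num)))
    unfold LI at h; rw [Measure.restrict_univ] at h
    exact ne_top_of_le_ne_top ENNReal.ofReal_ne_top h
  have p2 : ∀ ε : ℝ, 0 < ε → ∀ᶠ j in atTop, ∫⁻ x in ball 0 (Rs j), ENNReal.ofReal (GG U V θ x) ≤ ENNReal.ofReal ε ∧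
      (∀ i, LI 6 (ball 0 (Rs j)) (V i) ≤ ENNReal.ofReal (ε ^ 3)) ∧ LI 6 (ball 0 (Rs j)) θ ≤ ENNReal.ofReal (ε ^ 3) := fun ε hε => by
    obtain ⟨δ, δ0, hδ⟩ := pass2 (C := C) (m := m) E.s0 E.t0 E.t0' hε
    have d6 : 0 < ENNReal.ofReal (δ ^ (6:ℝ)) := ENNReal.ofReal_pos.2 (by positivity)
    filter_upwards [e1, ex δ δ0, ey, ez, li_tail (LI_meas mN) hRs fN d6, li_tail (LI_meas cθ.measurable) hRs fθ d6] with j hj hx hy hz hN hT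
    obtain ⟨H, Θ, b, H0, Θ0, hb, b0, h0, h1, h2, -, -, h3, h4⟩ := main j hj
    have x0 := (XV_LI (a := α) cu p0 (by linarith : 0 < Rs j)).1
    have y0 := (XV_LI (a := β) cv q0 (by linarith : 0 < Rs j)).1
    have z0 := (XS_LI (a := γ) cθ r0 (by linarith : 0 < Rs j)).1
    have le6 : ∀ a : ℝ, 0 ≤ a → ENNReal.ofReal (a ^ (6:ℝ)) ≤ ENNReal.ofReal (δ ^ (6:ℝ)) → a ≤ δ := fun a ha h => by
      rw [ENNReal.ofReal_le_ofReal_iff (by positivity)] at h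
      exact (Real.rpow_le_rpow_iff ha δ0.le (by norm_num)).1 h
    have bB : b ≤ ε := by
      rw [hb]
      refine le_trans (mul_le_mul_of_nonneg_left ?_ C0) hδ
      exact Bnd_mono ⟨E.s0, E.s1⟩ ⟨E.t0, E.t1⟩ ⟨E.t0', E.t1'⟩ (by positivity) (by positivity) z0 H0 Θ0 hx hy hz
        (le6 H H0 (h3.trans hN)) (le6 Θ Θ0 (h4.trans hT))
    have := ENNReal.ofReal_le_ofReal (pow_le_pow_left₀ b0 bB 3)
    exact ⟨h0.trans (ENNReal.ofReal_le_ofReal bB), fun i => (h1 i).trans this, h2.trans this⟩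
  have p3 : ∀ ε : ℝ, 0 < ε → (ε ^ (1 / 3 : ℝ)) ^ 3 = ε := fun ε hε => by
    rw [← Real.rpow_natCast, ← Real.rpow_mul hε.le]; norm_num
  have c6 : Continuous fun y : ℝ => |y| ^ (6:ℝ) := continuous_abs.rpow_const fun x => Or.inr (by norm_num)
  have z6 : ∀ y : ℝ, |y| ^ (6:ℝ) ≤ 0 → y = 0 := fun y hy => by
    by_contra h
    exact absurd hy (not_le.2 (Real.rpow_pos_of_pos (abs_pos.2 h) _))
  have zv : ∀ i x, V i x = 0 := fun i => ae_zero (S.sv i).continuous c6 z6 fun ε hε => by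
    have := li_univ (LI_meas (mV i)) hRs ((p2 (ε ^ (1 / 3 : ℝ)) (by positivity)).mono fun j hj => hj.2.1 i)
    rwa [p3 ε hε] at this
  have zθ : ∀ x, θ x = 0 := ae_zero cθ c6 z6 fun ε hε => by
    have := li_univ (LI_meas cθ.measurable) hRs ((p2 (ε ^ (1 / 3 : ℝ)) (by positivity)).mono fun j hj => hj.2.2)
    rwa [p3 ε hε] at this
  have zG : ∀ x, GG U V θ x = 0 := fun x => by
    have h := ae_zero (f := fun x => √(GG U V θ x)) S.gc.sqrt (F := fun y => y ^ 2) (by fun_prop) (fun y hy => by nlinarith [sq_nonneg y]) (fun ε hε => by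
      simp_rw [Real.sq_sqrt (GG_nonneg _)]
      exact li_univ (S.gc.measurable.ennreal_ofReal) hRs ((p2 ε hε).mono fun j hj => hj.1)) x
    exact (Real.sqrt_eq_zero (GG_nonneg x)).1 h
  have zu : ∀ i x, U i x = 0 := fun i => by
    have hd : ∀ x, fderiv ℝ (U i) x = 0 := fun x => by
      rw [← norm_le_zero_iff]
      refine (clm_le_sum _).trans (le_of_eq (Finset.sum_eq_zero fun j _ => ?_))
      have := (GG_le (u := U) (v := V) (θ := θ) x).1 i j
      rw [zG, Real.sqrt_zero] at this
      exact le_antisymm this (abs_nonneg _)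
    have hk := fun x => is_const_of_fderiv_eq_zero (𝕜 := ℝ) ((S.su i).differentiable (by simp)) hd x 0
    have h0 : U i 0 = 0 := const_zero cu (i := i) hk p0 (by
      have := mul_le_mul_of_nonneg_right hα2 p0.le
      rw [sub_mul, div_mul_cancel₀ _ p0.ne'] at this
      linarith) hRs hX
    exact fun x => (hk x).trans h0
  exact ⟨fun x => by ext i; exact zu i x, fun x => by ext i; exact zv i x, zθ⟩

end Concl2

theorem liouville_tcm_A2 (u v : R3 → R3) (pr θ : R3 → ℝ)
    (hu : ContDiff ℝ (⊤ : ℕ∞) u) (hv : ContDiff ℝ (⊤ : ℕ∞) v)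
    (hpr : ContDiff ℝ (⊤ : ℕ∞) pr) (hθ : ContDiff ℝ (⊤ : ℕ∞) θ)
    (hsol : TCM u v pr θ)
    (p q r α β γ : ℝ)
    (hp1 : 3 ≤ p) (hp2 : p ≤ 9 / 2)
    (hq1 : 1 ≤ q) (hq2 : q < 2)
    (hr1 : 2 ≤ r) (hr2 : r < 2 * (p / (p - 1)))
    (hα1 : 0 ≤ α) (hα2 : α ≤ 3 / p - 2 / 3)
    (hβ1 : 0 ≤ β) (hβ2 : β ≤ 3 / q - 1 / 2)
    (hγ1 : 0 ≤ γ) (hγ2 : γ ≤ 3 / r - 1 / 2)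
    (hc1 : α + ((4 * p - 6) * q / ((6 - q) * p)) * β ≤ 1)
    (hc2 : α + ((4 * p - 6) * r / ((6 - r) * p)) * γ ≤ 1)
    (hc3 : (2 * q / (6 - q)) * β + γ ≤ (6 - r) / (2 * r))
    (Rs : ℕ → ℝ) (hRs : Tendsto Rs atTop atTop)
    (hX : Tendsto (fun j => XnV u α p (Rs j)) atTop (nhds 0))
    (hY : ∃ L : ℝ, Tendsto (fun j => XnV v β q (Rs j)) atTop (nhds L))
    (hZ : ∃ L : ℝ, Tendsto (fun j => XnS θ γ r (Rs j)) atTop (nhds L)) :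
    (∀ x, u x = 0) ∧ (∀ x, v x = 0) ∧ (∀ x, θ x = 0) := by
  obtain ⟨s, t, t', E⟩ := exists_Ex hp1 hp2 hq1 hq2 hr1 hr2 hα1 hα2 hβ1 hβ2 hγ1 hγ2 hc1 hc2 hc3
  have cd : ∀ {f : R3 → R3}, ContDiff ℝ (⊤ : ℕ∞) f → ∀ i, ContDiff ℝ (⊤ : ℕ∞) (fun x => f x i) := fun hf i =>
    (contDiff_euclidean.1 hf) i
  have S : Sol (fun i x => u x i) (fun i x => v x i) pr θ := ⟨cd hu, cd hv, hpr, hθ, hsol.1, hsol.2.1, hsol.2.2.1, hsol.2.2.2⟩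
  exact conclude E (by linarith) hα2 hu.continuous hv.continuous S Rs hRs hX hY hZ
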